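/- There exists a constant C > 0, depending only on Ω, such that for every λ > 0 and every Dirichlet eigenfunction φ of Ω with eigenvalue λ², the set of boundary critical points {s ∈ [0, ℓ) : ⟨∇φ(q(s)), ν(s)⟩ = 0} (zeros of the normal derivative along ∂Ω) is finite and has cardinality at most C·λ. -/

import Mathlib

open MeasureTheory Real
open scoped RealInnerProductSpace

noncomputable section

abbrev E2 : Type := EuclideanSpace ℝ (Fin 2)

/-- The Euclidean Laplacian `∂²/∂x₁² + ∂²/∂x₂²` on `ℝ²`. -/
def lap (φ : E2 → ℝ) (x : E2) : ℝ :=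
  ∑ i : Fin 2,
    fderiv ℝ (fun y => fderiv ℝ φ y (EuclideanSpace.single i 1)) x (EuclideanSpace.single i 1)

/-- A bounded open connected planar domain. -/
structure IsPlaneDomain (Ω : Set E2) : Prop where
  isOpen : IsOpen Ω
  isBounded : Bornology.IsBounded Ω
  isConnected : IsConnected Ω

/-- An arc-length parametrization `q` of the boundary of `Ω` (periodic with period `len`,
injective on `[0, len)`, unit speed, image equal to the frontier of `Ω`), together with the
unit normal `ν` along the boundary, pointing into `Ω`. -/
structure BoundaryParam (Ω : Set E2) where
  len : ℝ
  len_pos : 0 < len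
  q : ℝ → E2
  qd : ℝ → E2
  hasDerivAt : ∀ s, HasDerivAt q (qd s) s
  periodic : Function.Periodic q len
  injOn : Set.InjOn q (Set.Ico 0 len)
  unitSpeed : ∀ s, ‖qd s‖ = 1
  range_eq : Set.range q = frontier Ω
  ν : ℝ → E2
  ν_unit : ∀ s, ‖ν s‖ = 1
  ν_orth : ∀ s, ⟪ν s, qd s⟫ = 0
  ν_inward : ∀ s, ∃ δ > 0, ∀ t ∈ Set.Ioo (0 : ℝ) δ, q s + t • ν s ∈ Ω

/-- The boundary parametrization is real-analytic. -/
def BoundaryParam.IsAnalytic {Ω : Set E2} (B : BoundaryParam Ω) : Prop :=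
  AnalyticOnNhd ℝ B.q Set.univ

/-- `φ` is a Dirichlet eigenfunction of `Ω` with eigenvalue `lam²`: it is real-analytic on an
open neighborhood of the closure of `Ω`, not identically zero on `Ω`, satisfies
`Δφ = -lam² φ` on `Ω` and vanishes along the boundary. -/
structure IsDirichletEigenfunction {Ω : Set E2} (B : BoundaryParam Ω) (lam : ℝ)
    (φ : E2 → ℝ) : Prop where
  analytic : ∃ U : Set E2, IsOpen U ∧ closure Ω ⊆ U ∧ AnalyticOnNhd ℝ φ U
  nontrivial : ∃ x ∈ Ω, φ x ≠ 0
  eigen : ∀ x ∈ Ω, lap φ x = -lam ^ 2 * φ x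
  dirichlet : ∀ s : ℝ, φ (B.q s) = 0

/-- `g` is differentiable near `x` and its derivative has derivative `c` at `x`. -/
def HasSecondDerivAt (g : ℝ → ℝ) (c x : ℝ) : Prop :=
  ∃ g' : ℝ → ℝ, (∀ᶠ t in nhds x, HasDerivAt g (g' t) t) ∧ HasDerivAt g' c x

namespace HasSecondDerivAt

theorem sub {g h : ℝ → ℝ} {c d x : ℝ} (hg : HasSecondDerivAt g c x)
    (hh : HasSecondDerivAt h d x) : HasSecondDerivAt (fun t => g t - h t) (c - d) x := by
  obtain ⟨g', h1, h2⟩ := hg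
  obtain ⟨h', h3, h4⟩ := hh
  refine ⟨fun t => g' t - h' t, ?_, h2.sub h4⟩
  filter_upwards [h1, h3] with t ht1 ht2 using ht1.sub ht2

theorem const_mul {g : ℝ → ℝ} {c x : ℝ} (k : ℝ) (hg : HasSecondDerivAt g c x) :
    HasSecondDerivAt (fun t => k * g t) (k * c) x := by
  obtain ⟨g', h1, h2⟩ := hg
  refine ⟨fun t => k * g' t, ?_, h2.const_mul k⟩
  filter_upwards [h1] with t ht1 using ht1.const_mul k

theorem neg {g : ℝ → ℝ} {c x : ℝ} (hg : HasSecondDerivAt g c x) :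
    HasSecondDerivAt (fun t => -g t) (-c) x := by
  simpa using hg.const_mul (-1)

theorem comp_neg {g : ℝ → ℝ} {c x : ℝ} (hg : HasSecondDerivAt g c (-x)) :
    HasSecondDerivAt (fun t => g (-t)) c x := by
  obtain ⟨g', h1, h2⟩ := hg
  refine ⟨fun t => -g' (-t), ?_, ?_⟩
  · have : Filter.Tendsto (fun t : ℝ => -t) (nhds x) (nhds (-x)) := continuous_neg.tendsto x
    filter_upwards [this.eventually h1] with t ht
    simpa [Function.comp_def] using ht.comp t (hasDerivAt_neg t)
  · simpa [Function.comp_def] using (h2.comp x (hasDerivAt_neg x)).fun_neg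

theorem quadratic (A B C x : ℝ) :
    HasSecondDerivAt (fun t => A * t ^ 2 + B * t + C) (2 * A) x := by
  refine ⟨fun t => 2 * A * t + B, Filter.Eventually.of_forall fun t => ?_, ?_⟩
  · have h := (((hasDerivAt_pow 2 t).const_mul A).add ((hasDerivAt_id t).const_mul B)).add_const C
    refine (h.congr_deriv ?_)
    simp; ring
  · simpa using ((hasDerivAt_id x).const_mul (2 * A)).add_const B

theorem nonpos_of_isLocalMax {g : ℝ → ℝ} {c x : ℝ} (hg : HasSecondDerivAt g c x)
    (hmax : IsLocalMax g x) : c ≤ 0 := by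
  obtain ⟨g', h1, h2⟩ := hg
  by_contra hc
  push Not at hc
  have hd : deriv g =ᶠ[nhds x] g' := h1.mono fun t ht => ht.deriv
  have hdd : deriv (deriv g) x = c := by rw [hd.deriv_eq, h2.deriv]
  have hmin : IsLocalMin g x := isLocalMin_of_deriv_deriv_pos (by rw [hdd]; exact hc)
    hmax.deriv_eq_zero h1.self_of_nhds.continuousAt
  have hconst : g =ᶠ[nhds x] fun _ => g x := by
    filter_upwards [hmin, hmax] with t ht1 ht2 using le_antisymm ht2 ht1
  have : deriv g =ᶠ[nhds x] fun _ => 0 := by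
    have := hconst.deriv
    simpa using this
  rw [this.deriv_eq] at hdd
  simp at hdd
  linarith

end HasSecondDerivAt

theorem nonpos_of_laplacian_pos {K : Set (ℝ × ℝ)} (hK : IsCompact K) {w : ℝ → ℝ → ℝ}
    (hw : ContinuousOn (fun p : ℝ × ℝ => w p.1 p.2) K)
    (h : ∀ a b, (a, b) ∈ K → w a b ≤ 0 ∨ (K ∈ nhds (a, b) ∧ ∃ α β,
      HasSecondDerivAt (fun t => w t b) α a ∧ HasSecondDerivAt (fun t => w a t) β b ∧ 0 < α + β))
    {a b : ℝ} (hab : (a, b) ∈ K) : w a b ≤ 0 := by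
  obtain ⟨⟨a₀, b₀⟩, hp, hmax⟩ := hK.exists_isMaxOn ⟨_, hab⟩ hw
  refine le_trans (hmax hab) ?_
  rcases h a₀ b₀ hp with h0 | ⟨hnhds, α, β, hα, hβ, hpos⟩
  · exact h0
  · exfalso
    have hloc : IsLocalMax (fun p : ℝ × ℝ => w p.1 p.2) (a₀, b₀) := hmax.isLocalMax hnhds
    have ha : IsLocalMax (fun t => w t b₀) a₀ := by
      have hc : Filter.Tendsto (fun t : ℝ => (t, b₀)) (nhds a₀) (nhds (a₀, b₀)) :=
        (Continuous.prodMk_left b₀).tendsto a₀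
      exact hc.eventually hloc
    have hb : IsLocalMax (fun t => w a₀ t) b₀ := by
      have hc : Filter.Tendsto (fun t : ℝ => (a₀, t)) (nhds b₀) (nhds (a₀, b₀)) :=
        (Continuous.prodMk_right a₀).tendsto b₀
      exact hc.eventually hloc
    have := hα.nonpos_of_isLocalMax ha
    have := hβ.nonpos_of_isLocalMax hb
    linarith

/-- Bounds on a function and its Laplacian on the rectangle `[-d, d] × [c, d]`. -/
structure RectBound (U : ℝ → ℝ → ℝ) (c d M N : ℝ) : Prop where
  cont : ContinuousOn (fun p : ℝ × ℝ => U p.1 p.2) (Set.Icc (-d) d ×ˢ Set.Icc c d)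
  bound : ∀ a ∈ Set.Icc (-d) d, ∀ b ∈ Set.Icc c d, |U a b| ≤ M
  lapl : ∀ a ∈ Set.Ioo (-d) d, ∀ b ∈ Set.Ioo c d, ∃ α β,
    HasSecondDerivAt (fun t => U t b) α a ∧ HasSecondDerivAt (fun t => U a t) β b ∧ |α + β| ≤ N

theorem RectBound.neg {U : ℝ → ℝ → ℝ} {c d M N : ℝ} (h : RectBound U c d M N) :
    RectBound (fun a b => -U a b) c d M N where
  cont := h.cont.neg
  bound a ha b hb := by simpa using h.bound a ha b hb
  lapl a ha b hb := by
    obtain ⟨α, β, h1, h2, h3⟩ := h.lapl a ha b hb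
    refine ⟨-α, -β, h1.neg, h2.neg, ?_⟩
    rw [← abs_neg]; convert h3 using 2; ring

theorem RectBound.sub_reflect_le {U : ℝ → ℝ → ℝ} {c d M N : ℝ} (hd : 0 < d) (hc : -d ≤ c)
    (hc0 : c ≤ 0) (h : RectBound U c d M N)
    (hz : c = -d ∨ ∀ a ∈ Set.Icc (-d) d, U a c = 0) {N' : ℝ} (hN : N < N') {a : ℝ}
    (ha : a ∈ Set.Icc 0 d) :
    (U a 0 - U (-a) 0) / 2 ≤ M / d ^ 2 * (a * (2 * d - a)) + N' * (a * (d - a)) / 2 := by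
  have hM : 0 ≤ M := (abs_nonneg _).trans
    (h.bound 0 ⟨by linarith, hd.le⟩ 0 ⟨hc0, hd.le⟩)
  have hN0 : 0 ≤ N' := by
    by_cases hcd : c < d
    · obtain ⟨α, β, -, -, h3⟩ := h.lapl 0 ⟨by linarith, hd⟩ ((c + d) / 2)
        ⟨by linarith, by linarith⟩
      linarith [abs_nonneg (α + β)]
    · linarith
  set w : ℝ → ℝ → ℝ := fun a b => (1 / 2) * (U a b - U (-a) b) -
    (M / d ^ 2 * (b ^ 2 + a * (2 * d - a)) + N' * (a * (d - a)) / 2) with hw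
  set K : Set (ℝ × ℝ) := Set.Icc 0 d ×ˢ Set.Icc c d with hKdef
  have hK : IsCompact K := isCompact_Icc.prod isCompact_Icc
  have hbar : ∀ a ∈ Set.Icc 0 d, ∀ b : ℝ, 0 ≤ M / d ^ 2 * (b ^ 2 + a * (2 * d - a)) +
      N' * (a * (d - a)) / 2 := by
    rintro a ⟨h1, h2⟩ b
    have : 0 ≤ a * (2 * d - a) := mul_nonneg h1 (by linarith)
    have : 0 ≤ a * (d - a) := mul_nonneg h1 (by linarith)
    positivity
  have hsub1 : ∀ a ∈ Set.Icc 0 d, a ∈ Set.Icc (-d) d := fun a ha => ⟨by linarith [ha.1], ha.2⟩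
  have hsub2 : ∀ a ∈ Set.Icc 0 d, -a ∈ Set.Icc (-d) d :=
    fun a ha => ⟨by linarith [ha.2], by linarith [ha.1]⟩
  have hdiff : ∀ a ∈ Set.Icc 0 d, ∀ b ∈ Set.Icc c d, (1 / 2) * (U a b - U (-a) b) ≤ M := by
    intro a ha b hb
    have h1 := abs_le.1 (h.bound a (hsub1 a ha) b hb)
    have h2 := abs_le.1 (h.bound (-a) (hsub2 a ha) b hb)
    linarith
  have hside : ∀ a ∈ Set.Icc 0 d, ∀ b : ℝ, (b = d ∨ b = -d ∨ a = d) →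
      M ≤ M / d ^ 2 * (b ^ 2 + a * (2 * d - a)) + N' * (a * (d - a)) / 2 := by
    rintro a ⟨h1, h2⟩ b hab
    have h3 : 0 ≤ a * (2 * d - a) := mul_nonneg h1 (by linarith)
    have h4 : 0 ≤ a * (d - a) := mul_nonneg h1 (by linarith)
    have h5 : d ^ 2 ≤ b ^ 2 + a * (2 * d - a) := by
      rcases hab with rfl | rfl | rfl
      · linarith
      · nlinarith
      · nlinarith [sq_nonneg b]
    have h6 : M / d ^ 2 * d ^ 2 ≤ M / d ^ 2 * (b ^ 2 + a * (2 * d - a)) := by gcongr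
    have h7 : M / d ^ 2 * d ^ 2 = M := by field_simp
    have h8 : 0 ≤ N' * (a * (d - a)) / 2 := by positivity
    linarith
  have key : ∀ a b, (a, b) ∈ K → w a b ≤ 0 := by
    intro a b hab
    refine nonpos_of_laplacian_pos hK ?_ ?_ hab
    · refine ContinuousOn.sub (ContinuousOn.mul continuousOn_const (ContinuousOn.sub ?_ ?_)) ?_
      · exact h.cont.mono (Set.prod_mono (fun a ha => hsub1 a ha) subset_rfl)
      · refine h.cont.comp (f := fun p : ℝ × ℝ => (-p.1, p.2)) (by fun_prop) ?_
        rintro ⟨a, b⟩ ⟨ha, hb⟩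
        exact ⟨hsub2 a ha, hb⟩
      · fun_prop
    · rintro a b ⟨ha, hb⟩
      simp only at ha hb
      by_cases hint : 0 < a ∧ a < d ∧ c < b ∧ b < d
      · right
        obtain ⟨h1, h2, h3, h4⟩ := hint
        refine ⟨prod_mem_nhds (Icc_mem_nhds h1 h2) (Icc_mem_nhds h3 h4), ?_⟩
        obtain ⟨α, β, hα, hβ, hl⟩ := h.lapl a ⟨by linarith, h2⟩ b ⟨h3, h4⟩
        obtain ⟨α', β', hα', hβ', hl'⟩ := h.lapl (-a) ⟨by linarith, by linarith⟩ b ⟨h3, h4⟩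
        refine ⟨(1 / 2) * (α - α') - 2 * (-(M / d ^ 2) - N' / 2),
          (1 / 2) * (β - β') - 2 * (M / d ^ 2), ?_, ?_, ?_⟩
        · convert ((hα.sub hα'.comp_neg).const_mul (1 / 2)).sub
            (HasSecondDerivAt.quadratic (-(M / d ^ 2) - N' / 2) (M / d ^ 2 * (2 * d) + N' * d / 2)
              (M / d ^ 2 * b ^ 2) a) using 2 with t
          simp only [hw]; ring
        · convert ((hβ.sub hβ').const_mul (1 / 2)).sub
            (HasSecondDerivAt.quadratic (M / d ^ 2) 0
              (M / d ^ 2 * (a * (2 * d - a)) + N' * (a * (d - a)) / 2) b) using 2 with t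
          simp only [hw]; ring
        · have := abs_le.1 hl
          have := abs_le.1 hl'
          linarith
      · left
        have hw' : w a b = (1 / 2) * (U a b - U (-a) b) -
          (M / d ^ 2 * (b ^ 2 + a * (2 * d - a)) + N' * (a * (d - a)) / 2) := rfl
        have hd1 := hdiff a ha b hb
        rcases eq_or_lt_of_le ha.1 with h0 | h0
        · have hb0 := hbar 0 ⟨le_rfl, hd.le⟩ b
          rw [hw', ← h0, neg_zero, sub_self, mul_zero]; linarith
        rcases eq_or_lt_of_le ha.2 with h1 | h1
        · have := hside a ha b (Or.inr (Or.inr h1))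
          linarith
        rcases eq_or_lt_of_le hb.2 with h2 | h2
        · have := hside a ha b (Or.inl h2)
          linarith
        rcases eq_or_lt_of_le hb.1 with h3 | h3
        · rcases hz with hz | hz
          · have := hside a ha b (Or.inr (Or.inl (h3.symm.trans hz)))
            linarith
          · rw [hw', ← h3, hz a (hsub1 a ha), hz (-a) (hsub2 a ha)]
            have := hbar a ha c
            linarith
        · exact absurd ⟨h0, h1, h3, h2⟩ hint
  have := key a 0 ⟨ha, hc0, hd.le⟩
  simp only [hw] at this
  nlinarith

theorem RectBound.deriv_le {U : ℝ → ℝ → ℝ} {c d M N u' : ℝ} (hd : 0 < d) (hc : -d ≤ c)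
    (hc0 : c ≤ 0) (h : RectBound U c d M N)
    (hz : c = -d ∨ ∀ a ∈ Set.Icc (-d) d, U a c = 0)
    (hu : HasDerivAt (fun t => U t 0) u' 0) : u' ≤ 2 * M / d + N * d / 2 := by
  have hder : HasDerivAt (fun t => (U t 0 - U (-t) 0) / 2) u' 0 := by
    have h1 : HasDerivAt (fun t => U (-t) 0) (-u') 0 := by
      have h2 : HasDerivAt (fun t => U t 0) u' (-0) := by simpa using hu
      simpa [Function.comp_def] using h2.comp (0 : ℝ) (hasDerivAt_neg 0)
    exact ((hu.fun_sub h1).div_const 2).congr_deriv (by ring)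
  refine le_of_forall_pos_le_add fun ε hε => ?_
  set N' := N + 2 * ε / d with hN'
  have hNN : N < N' := by rw [hN']; have : 0 < 2 * ε / d := by positivity
                          linarith
  have hbar : HasDerivAt (fun a => M / d ^ 2 * (a * (2 * d - a)) + N' * (a * (d - a)) / 2)
      (2 * M / d + N * d / 2 + ε) 0 := by
    have e1 : HasDerivAt (fun a : ℝ => a * (2 * d - a)) (2 * d) 0 := by
      simpa using (hasDerivAt_id' (0 : ℝ)).fun_mul ((hasDerivAt_id' (0 : ℝ)).const_sub (2 * d))
    have e2 : HasDerivAt (fun a : ℝ => a * (d - a)) d 0 := by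
      simpa using (hasDerivAt_id' (0 : ℝ)).fun_mul ((hasDerivAt_id' (0 : ℝ)).const_sub d)
    refine ((e1.const_mul (M / d ^ 2)).add ((e2.const_mul N').div_const 2)).congr_deriv ?_
    rw [hN']; field_simp; ring
  have hdiff := hbar.sub hder
  have hnn : 0 ≤ (2 * M / d + N * d / 2 + ε) - u' := by
    have hs := (hasDerivWithinAt_iff_tendsto_slope' (by simp)).1
      (hdiff.hasDerivWithinAt (s := Set.Ioi 0))
    refine ge_of_tendsto hs ?_
    filter_upwards [Ioo_mem_nhdsGT hd] with t ht
    rw [slope_def_field]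
    have := h.sub_reflect_le hd hc hc0 hz hNN (a := t) ⟨ht.1.le, ht.2.le⟩
    apply div_nonneg
    · simp; linarith
    · simp [ht.1.le]
  linarith

/-- Interior gradient estimate, valid up to a side on which the function vanishes. -/
theorem RectBound.abs_deriv_le {U : ℝ → ℝ → ℝ} {c d M N u' : ℝ} (hd : 0 < d) (hc : -d ≤ c)
    (hc0 : c ≤ 0) (h : RectBound U c d M N)
    (hz : c = -d ∨ ∀ a ∈ Set.Icc (-d) d, U a c = 0)
    (hu : HasDerivAt (fun t => U t 0) u' 0) : |u'| ≤ 2 * M / d + N * d / 2 := by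
  rw [abs_le']
  refine ⟨h.deriv_le hd hc hc0 hz hu, h.neg.deriv_le hd hc hc0 ?_ hu.neg⟩
  rcases hz with hz | hz
  · exact Or.inl hz
  · exact Or.inr fun a ha => by simp [hz a ha]

theorem RectBound.le_mul {U : ℝ → ℝ → ℝ} {d M N : ℝ} (hd : 0 < d) (h : RectBound U 0 d M N)
    (hz : ∀ a ∈ Set.Icc (-d) d, U a 0 = 0) {b : ℝ} (hb : b ∈ Set.Icc 0 d) :
    U 0 b ≤ (2 * M / d + N * d / 2) * b := by
  have hM : 0 ≤ M := (abs_nonneg _).trans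
    (h.bound 0 ⟨by linarith, hd.le⟩ 0 ⟨le_rfl, hd.le⟩)
  have hN0 : 0 ≤ N := by
    obtain ⟨α, β, -, -, h3⟩ := h.lapl 0 ⟨by linarith, hd⟩ (d / 2) ⟨by linarith, by linarith⟩
    linarith [abs_nonneg (α + β)]
  have main : ∀ N' > N, U 0 b ≤ M / d ^ 2 * (b * (2 * d - b)) + N' * (b * (d - b)) / 2 := by
    intro N' hN
    have hN0' : 0 ≤ N' := by linarith
    set w : ℝ → ℝ → ℝ := fun a b => U a b -
      (M / d ^ 2 * (a ^ 2 + b * (2 * d - b)) + N' * (b * (d - b)) / 2) with hw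
    set K : Set (ℝ × ℝ) := Set.Icc (-d) d ×ˢ Set.Icc 0 d with hKdef
    have hK : IsCompact K := isCompact_Icc.prod isCompact_Icc
    have hside : ∀ b ∈ Set.Icc 0 d, ∀ a : ℝ, (a = d ∨ a = -d ∨ b = d) →
        M ≤ M / d ^ 2 * (a ^ 2 + b * (2 * d - b)) + N' * (b * (d - b)) / 2 := by
      rintro b ⟨h1, h2⟩ a hab
      have h3 : 0 ≤ b * (2 * d - b) := mul_nonneg h1 (by linarith)
      have h4 : 0 ≤ b * (d - b) := mul_nonneg h1 (by linarith)
      have h5 : d ^ 2 ≤ a ^ 2 + b * (2 * d - b) := by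
        rcases hab with rfl | rfl | rfl
        · linarith
        · nlinarith
        · nlinarith [sq_nonneg a]
      have h6 : M / d ^ 2 * d ^ 2 ≤ M / d ^ 2 * (a ^ 2 + b * (2 * d - b)) := by gcongr
      have h7 : M / d ^ 2 * d ^ 2 = M := by field_simp
      have h8 : 0 ≤ N' * (b * (d - b)) / 2 := by positivity
      linarith
    have key : ∀ a b, (a, b) ∈ K → w a b ≤ 0 := by
      intro a b hab
      refine nonpos_of_laplacian_pos hK ?_ ?_ hab
      · exact ContinuousOn.sub h.cont (by fun_prop)
      · rintro a b ⟨ha, hb⟩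
        simp only at ha hb
        by_cases hint : -d < a ∧ a < d ∧ 0 < b ∧ b < d
        · right
          obtain ⟨h1, h2, h3, h4⟩ := hint
          refine ⟨prod_mem_nhds (Icc_mem_nhds h1 h2) (Icc_mem_nhds h3 h4), ?_⟩
          obtain ⟨α, β, hα, hβ, hl⟩ := h.lapl a ⟨h1, h2⟩ b ⟨h3, h4⟩
          refine ⟨α - 2 * (M / d ^ 2), β - 2 * (-(M / d ^ 2) - N' / 2), ?_, ?_, ?_⟩
          · convert hα.sub (HasSecondDerivAt.quadratic (M / d ^ 2) 0
              (M / d ^ 2 * (b * (2 * d - b)) + N' * (b * (d - b)) / 2) a) using 2 with t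
            simp only [hw]; ring
          · convert hβ.sub (HasSecondDerivAt.quadratic (-(M / d ^ 2) - N' / 2)
              (M / d ^ 2 * (2 * d) + N' * d / 2) (M / d ^ 2 * a ^ 2) b) using 2 with t
            simp only [hw]; ring
          · have := abs_le.1 hl
            linarith
        · left
          have hw' : w a b = U a b -
            (M / d ^ 2 * (a ^ 2 + b * (2 * d - b)) + N' * (b * (d - b)) / 2) := rfl
          have hd1 := (abs_le.1 (h.bound a ha b hb)).2
          rcases eq_or_lt_of_le ha.1 with h0 | h0
          · have := hside b hb a (Or.inr (Or.inl h0.symm))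
            linarith
          rcases eq_or_lt_of_le ha.2 with h1 | h1
          · have := hside b hb a (Or.inl h1)
            linarith
          rcases eq_or_lt_of_le hb.2 with h2 | h2
          · have := hside b hb a (Or.inr (Or.inr h2))
            linarith
          rcases eq_or_lt_of_le hb.1 with h3 | h3
          · rw [hw', ← h3, hz a ha]
            have : 0 ≤ M / d ^ 2 * (a ^ 2 + 0 * (2 * d - 0)) := by
              simp only [zero_mul, add_zero]; positivity
            linarith
          · exact absurd ⟨h0, h1, h3, h2⟩ hint
    have := key 0 b ⟨⟨by linarith, hd.le⟩, hb⟩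
    simp only [hw] at this
    nlinarith
  have hb0 := hb.1
  have h1 : U 0 b ≤ M / d ^ 2 * (b * (2 * d - b)) + N * (b * (d - b)) / 2 := by
    have hcont : Continuous fun N' : ℝ =>
        M / d ^ 2 * (b * (2 * d - b)) + N' * (b * (d - b)) / 2 := by fun_prop
    refine ge_of_tendsto ((hcont.tendsto N).mono_left (nhdsWithin_le_nhds (s := Set.Ioi N))) ?_
    filter_upwards [self_mem_nhdsWithin] with N' hN' using main N' hN'
  refine h1.trans ?_
  have h2 : M / d ^ 2 * (b * (2 * d - b)) ≤ 2 * M / d * b := by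
    have : 2 * M / d * b = M / d ^ 2 * (b * (2 * d)) := by field_simp
    rw [this]; gcongr; linarith
  have h3 : N * (b * (d - b)) / 2 ≤ N * d / 2 * b := by
    have : N * d / 2 * b = N * (b * d) / 2 := by ring
    rw [this]; gcongr; linarith
  linarith

theorem RectBound.abs_le_mul {U : ℝ → ℝ → ℝ} {d M N : ℝ} (hd : 0 < d)
    (h : RectBound U 0 d M N) (hz : ∀ a ∈ Set.Icc (-d) d, U a 0 = 0) {b : ℝ}
    (hb : b ∈ Set.Icc 0 d) : |U 0 b| ≤ (2 * M / d + N * d / 2) * b := by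
  rw [abs_le']
  exact ⟨h.le_mul hd hz hb, h.neg.le_mul hd (fun a ha => by simp [hz a ha]) hb⟩

/-- A function `u 0` on the strip `0 ≤ y ≤ δ`, together with its successive derivatives `u k`
along the strip, all vanishing at `y = 0`, whose Laplacians satisfy the estimates obtained by
differentiating `Δ u = -Λ² W u` with an analytic weight `W`. -/
structure StripFamily (u : ℕ → ℝ → ℝ → ℝ) (δ A Λ M : ℝ) : Prop where
  cont : ∀ k, ContinuousOn (fun p : ℝ × ℝ => u k p.1 p.2) {p | 0 ≤ p.2 ∧ p.2 ≤ δ}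
  deriv : ∀ k x y, 0 ≤ y → y ≤ δ → HasDerivAt (fun t => u k t y) (u (k + 1) x y) x
  zero : ∀ k x, u k x 0 = 0
  lapl : ∀ k x y, 0 < y → y < δ → ∃ r, HasSecondDerivAt (fun t => u k x t) r y ∧
    |u (k + 2) x y + r| ≤ Λ ^ 2 * ∑ j ∈ Finset.range (k + 1),
      (k.choose j : ℝ) * (A ^ (j + 1) * j.factorial) * |u (k - j) x y|
  bound : ∀ x y, 0 ≤ y → y ≤ δ → |u 0 x y| ≤ M

theorem sum_choose_mul_factorial_le {k : ℕ} {A T M : ℝ} {a : ℕ → ℝ} (hA : 0 ≤ A) (hT : 0 < T)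
    (hM : 0 ≤ M) (hk : 2 * (k * A) ≤ T) (ha : ∀ j ≤ k, |a j| ≤ M * T ^ j) :
    ∑ j ∈ Finset.range (k + 1), (k.choose j : ℝ) * (A ^ (j + 1) * j.factorial) * |a (k - j)| ≤
      2 * A * M * T ^ k := by
  have hterm : ∀ j ∈ Finset.range (k + 1),
      (k.choose j : ℝ) * (A ^ (j + 1) * j.factorial) * |a (k - j)| ≤
        A * M * T ^ k * (1 / 2 : ℝ) ^ j := by
    intro j hj
    have hjk : j ≤ k := Nat.lt_succ_iff.1 (Finset.mem_range.1 hj)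
    have h1 : (k.choose j : ℝ) * j.factorial ≤ (k : ℝ) ^ j := by
      have := Nat.descFactorial_le_pow k j
      rw [Nat.descFactorial_eq_factorial_mul_choose] at this
      rw [mul_comm]; exact_mod_cast this
    have h2 : ((k : ℝ) * A) ^ j ≤ T ^ j * (1 / 2 : ℝ) ^ j := by
      rw [← mul_pow]; exact pow_le_pow_left₀ (by positivity) (by linarith) j
    calc (k.choose j : ℝ) * (A ^ (j + 1) * j.factorial) * |a (k - j)|
        = ((k.choose j : ℝ) * j.factorial) * A ^ j * A * |a (k - j)| := by ring
      _ ≤ (k : ℝ) ^ j * A ^ j * A * (M * T ^ (k - j)) := by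
        gcongr; exact ha _ (Nat.sub_le _ _)
      _ = (k * A) ^ j * (A * M * T ^ (k - j)) := by ring
      _ ≤ T ^ j * (1 / 2 : ℝ) ^ j * (A * M * T ^ (k - j)) := by gcongr
      _ = A * M * (T ^ j * T ^ (k - j)) * (1 / 2 : ℝ) ^ j := by ring
      _ = _ := by rw [← pow_add, Nat.add_sub_cancel' hjk]
  refine (Finset.sum_le_sum hterm).trans ?_
  rw [← Finset.mul_sum]
  have : ∑ j ∈ Finset.range (k + 1), (1 / 2 : ℝ) ^ j ≤ 2 := by
    have := Summable.sum_le_tsum (Finset.range (k + 1)) (fun i _ => by positivity)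
      summable_geometric_two
    rwa [tsum_geometric_two] at this
  have h0 : 0 ≤ A * M * T ^ k := by positivity
  nlinarith

namespace StripFamily

variable {u : ℕ → ℝ → ℝ → ℝ} {δ A Λ M : ℝ}

theorem rectBound (h : StripFamily u δ A Λ M) (hA : 0 ≤ A) (hΛ : 1 ≤ Λ) {B : ℝ}
    (hB : 2 + A * δ ^ 2 + 2 * A * δ ≤ B) {k : ℕ}
    (hu : ∀ j ≤ k, ∀ x y, 0 ≤ y → y < δ → |u j x y| ≤ M * (B * (j + Λ) / (δ - y)) ^ j)
    {x y : ℝ} (hy : 0 ≤ y) (hyδ : y < δ) :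
    RectBound (fun a b => u k (x + a) (y + b)) (max (-((δ - y) / (k + 1 + Λ))) (-y))
      ((δ - y) / (k + 1 + Λ)) (M * (B * (k + 1 + Λ) / (δ - y)) ^ k)
      (Λ ^ 2 * (2 * A * M * (B * (k + 1 + Λ) / (δ - y)) ^ k)) := by
  have hM : 0 ≤ M := (abs_nonneg _).trans (h.bound 0 y hy hyδ.le)
  have hδ : 0 < δ := hy.trans_lt hyδ
  have hB0 : 0 < B := by
    have : 0 ≤ A * δ ^ 2 + 2 * A * δ := by positivity
    linarith
  set m : ℝ := k + 1 + Λ with hm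
  have hk0 : (0 : ℝ) ≤ k := k.cast_nonneg
  have hm2 : 2 ≤ m := by rw [hm]; linarith
  set e := δ - y with he
  have he0 : 0 < e := by rw [he]; linarith
  have hd : 0 < e / m := by positivity
  have hde : e / m ≤ e / 2 := by gcongr
  have hdm : e / m * m = e := by field_simp
  set T : ℝ := B * m / e with hT
  have hT0 : 0 < T := by positivity
  have hy' : ∀ b, max (-(e / m)) (-y) ≤ b → b ≤ e / m → 0 ≤ y + b ∧ y + b < δ := by
    intro b h1 h2
    have := le_max_right (-(e / m)) (-y)
    constructor <;> linarith
  have hbd : ∀ j ≤ k, ∀ a b, max (-(e / m)) (-y) ≤ b → b ≤ e / m →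
      |u j (x + a) (y + b)| ≤ M * T ^ j := by
    intro j hj a b h1 h2
    obtain ⟨h3, h4⟩ := hy' b h1 h2
    refine (hu j hj (x + a) (y + b) h3 h4).trans ?_
    have hjk : (j : ℝ) ≤ k := by exact_mod_cast hj
    have hj0 : (0 : ℝ) ≤ j := j.cast_nonneg
    have h5 : 0 < δ - (y + b) := by linarith
    have : B * (j + Λ) / (δ - (y + b)) ≤ T := by
      rw [hT, div_le_div_iff₀ h5 he0]
      have h6 : e * (m - 1) ≤ m * (δ - (y + b)) := by
        have : δ - (y + b) ≥ e - e / m := by linarith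
        nlinarith
      have h7 : (j + Λ) * e ≤ m * (δ - (y + b)) := by
        refine le_trans ?_ h6
        rw [mul_comm]; gcongr; rw [hm]; linarith
      nlinarith
    gcongr
  refine ⟨?_, ?_, ?_⟩
  · refine (h.cont k).comp (f := fun p : ℝ × ℝ => (x + p.1, y + p.2)) (by fun_prop) ?_
    rintro ⟨a, b⟩ ⟨-, hb⟩
    exact ⟨(hy' b hb.1 hb.2).1, (hy' b hb.1 hb.2).2.le⟩
  · exact fun a _ b hb => hbd k le_rfl a b hb.1 hb.2
  · intro a _ b hb
    obtain ⟨-, h4⟩ := hy' b hb.1.le hb.2.le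
    have h3 : 0 < y + b := by
      have := (le_max_right (-(e / m)) (-y)).trans_lt hb.1
      linarith
    obtain ⟨r, ⟨r', hr1, hr2⟩, hr⟩ := h.lapl k (x + a) (y + b) h3 h4
    refine ⟨u (k + 2) (x + a) (y + b), r, ⟨fun t => u (k + 1) (x + t) (y + b), ?_, ?_⟩,
      ⟨fun t => r' (y + t), ?_, ?_⟩, ?_⟩
    · exact Filter.Eventually.of_forall fun t =>
        (h.deriv k (x + t) (y + b) h3.le h4.le).comp_const_add x t
    · exact (h.deriv (k + 1) (x + a) (y + b) h3.le h4.le).comp_const_add x a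
    · have : Filter.Tendsto (fun t : ℝ => y + t) (nhds b) (nhds (y + b)) :=
        (continuous_const_add y).tendsto b
      filter_upwards [this.eventually hr1] with t ht using ht.comp_const_add y t
    · exact hr2.comp_const_add y b
    · refine hr.trans ?_
      gcongr
      refine sum_choose_mul_factorial_le (a := fun j => u j (x + a) (y + b)) hA hT0 hM ?_
        (fun j hj => hbd j hj a b hb.1.le hb.2.le)
      rw [hT, le_div_iff₀ he0]
      have h8 : 2 * A * δ ≤ B := by
        have : 0 ≤ A * δ ^ 2 := by positivity
        linarith
      have h9 : e ≤ δ := by rw [he]; linarith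
      calc 2 * (k * A) * e ≤ 2 * (k * A) * δ := by gcongr
        _ = 2 * A * δ * k := by ring
        _ ≤ B * m := by gcongr; rw [hm]; linarith

theorem rectBound_arith {k : ℕ} {B e : ℝ} (hA : 0 ≤ A) (hΛ : 1 ≤ Λ) (hM : 0 ≤ M)
    (he : 0 < e) (heδ : e ≤ δ) (hB : 2 + A * δ ^ 2 + 2 * A * δ ≤ B) :
    2 * (M * (B * (k + 1 + Λ) / e) ^ k) / (e / (k + 1 + Λ)) +
      Λ ^ 2 * (2 * A * M * (B * (k + 1 + Λ) / e) ^ k) * (e / (k + 1 + Λ)) / 2 ≤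
      M * (B * (k + 1 + Λ) / e) ^ (k + 1) := by
  have hδ : 0 < δ := he.trans_le heδ
  have hB2 : 2 + A * δ ^ 2 ≤ B := by
    have : 0 ≤ 2 * A * δ := by positivity
    linarith
  have hB0 : 0 < B := by
    have : 0 ≤ A * δ ^ 2 := by positivity
    linarith
  set m : ℝ := k + 1 + Λ with hm
  have hk0 : (0 : ℝ) ≤ k := k.cast_nonneg
  have hm2 : 0 < m := by rw [hm]; linarith
  set T : ℝ := B * m / e with hT
  have hT0 : 0 < T := by positivity
  have h1 : Λ ^ 2 * A * (e / m) ≤ A * δ ^ 2 * (m / e) := by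
    have h2 : Λ ^ 2 * A * (e / m) = A * e ^ 2 * (Λ ^ 2 / m / e) := by field_simp
    have h3 : Λ ^ 2 / m ≤ m := by
      rw [div_le_iff₀ hm2]
      have : Λ ≤ m := by rw [hm]; linarith
      nlinarith
    rw [h2]; gcongr
  calc 2 * (M * T ^ k) / (e / m) + Λ ^ 2 * (2 * A * M * T ^ k) * (e / m) / 2
      = M * T ^ k * (2 * (m / e) + Λ ^ 2 * A * (e / m)) := by field_simp
    _ ≤ M * T ^ k * (2 * (m / e) + A * δ ^ 2 * (m / e)) := by gcongr
    _ = M * T ^ k * ((2 + A * δ ^ 2) * (m / e)) := by ring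
    _ ≤ M * T ^ k * (B * (m / e)) := by gcongr
    _ = M * T ^ (k + 1) := by rw [pow_succ, hT]; ring

theorem abs_le (h : StripFamily u δ A Λ M) (hA : 0 ≤ A) (hΛ : 1 ≤ Λ) {B : ℝ}
    (hB : 2 + A * δ ^ 2 + 2 * A * δ ≤ B) (k : ℕ) :
    ∀ j ≤ k, ∀ x y, 0 ≤ y → y < δ → |u j x y| ≤ M * (B * (j + Λ) / (δ - y)) ^ j := by
  induction k with
  | zero =>
    intro j hj x y hy hyδ
    obtain rfl : j = 0 := by omega
    simpa using h.bound x y hy hyδ.le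
  | succ k ih =>
    intro j hj x y hy hyδ
    rcases Nat.lt_or_ge k j with hjk | hjk
    · obtain rfl : j = k + 1 := by omega
      have hM : 0 ≤ M := (abs_nonneg _).trans (h.bound 0 y hy hyδ.le)
      have hR := h.rectBound hA hΛ hB ih (x := x) hy hyδ
      have hd : 0 < (δ - y) / (k + 1 + Λ) := by
        have : (0 : ℝ) ≤ k := k.cast_nonneg
        have : 0 < δ - y := by linarith
        positivity
      have hder : HasDerivAt (fun t => u k (x + t) (y + 0)) (u (k + 1) x y) 0 := by
        have := (h.deriv k (x + 0) (y + 0) (by simpa) (by simpa using hyδ.le)).comp_const_add x 0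
        simpa using this
      have := hR.abs_deriv_le hd (le_max_left _ _)
        (max_le (by linarith) (by linarith)) ?_ hder
      · refine this.trans ?_
        push_cast
        exact rectBound_arith hA hΛ hM (by linarith) (by linarith) hB
      · rcases le_total (-((δ - y) / (k + 1 + Λ))) (-y) with h1 | h1
        · right
          intro a _
          rw [max_eq_right h1, add_neg_cancel, h.zero]
        · left; rw [max_eq_left h1]
    · exact ih j hjk x y hy hyδ

theorem abs_le_mul (h : StripFamily u δ A Λ M) (hδ : 0 < δ) (hA : 0 ≤ A) (hΛ : 1 ≤ Λ) {B : ℝ}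
    (hB : 2 + A * δ ^ 2 + 2 * A * δ ≤ B) (k : ℕ) {x y : ℝ} (hy : 0 ≤ y)
    (hyδ : y ≤ δ / (k + 1 + Λ)) :
    |u k x y| ≤ M * (B * (k + 1 + Λ) / δ) ^ (k + 1) * y := by
  have hM : 0 ≤ M := (abs_nonneg _).trans (h.bound 0 0 le_rfl hδ.le)
  have hR := h.rectBound hA hΛ hB (h.abs_le hA hΛ hB k) (x := x) le_rfl hδ
  have hd : 0 < δ / (k + 1 + Λ) := by
    have : (0 : ℝ) ≤ k := k.cast_nonneg
    positivity
  simp only [sub_zero, neg_zero, zero_add] at hR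
  rw [max_eq_right (by linarith)] at hR
  have := hR.abs_le_mul hd (fun a _ => h.zero k (x + a)) ⟨hy, hyδ⟩
  simp only [add_zero] at this
  refine this.trans ?_
  gcongr
  exact rectBound_arith hA hΛ hM hδ le_rfl hB

end StripFamily

/-- The derivative of `u` in the direction `e`. -/
def pd (e : ℂ) (u : ℂ → ℝ) (z : ℂ) : ℝ := fderiv ℝ u z e

/-- The Laplacian on the complex plane. -/
def lapC (u : ℂ → ℝ) (z : ℂ) : ℝ := pd 1 (pd 1 u) z + pd Complex.I (pd Complex.I u) z

theorem AnalyticAt.pd {u : ℂ → ℝ} {z : ℂ} (hu : AnalyticAt ℝ u z) (e : ℂ) :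
    AnalyticAt ℝ (pd e u) z :=
  ((ContinuousLinearMap.apply ℝ ℝ e).analyticAt _).comp hu.fderiv

theorem AnalyticAt.pd_iterate {u : ℂ → ℝ} {z : ℂ} (hu : AnalyticAt ℝ u z) (e : ℂ) (k : ℕ) :
    AnalyticAt ℝ ((_root_.pd e)^[k] u) z := by
  induction k with
  | zero => exact hu
  | succ k ih => rw [Function.iterate_succ_apply']; exact ih.pd e

theorem Filter.EventuallyEq.pd {u w : ℂ → ℝ} {z : ℂ} (h : u =ᶠ[nhds z] w) (e : ℂ) :
    pd e u =ᶠ[nhds z] pd e w :=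
  (h.fderiv (𝕜 := ℝ)).mono fun x hx => by simp only [_root_.pd, hx]

theorem pd_pd {u : ℂ → ℝ} {z : ℂ} (hu : AnalyticAt ℝ u z) (e f : ℂ) :
    pd e (pd f u) z = fderiv ℝ (fderiv ℝ u) z e f := by
  have h := hu.fderiv.differentiableAt.hasFDerivAt.clm_apply (hasFDerivAt_const f z)
  have h2 : fderiv ℝ (pd f u) z = _ := h.fderiv
  rw [pd, h2]
  simp

theorem pd_comm {u : ℂ → ℝ} {z : ℂ} (hu : AnalyticAt ℝ u z) (e f : ℂ) :
    pd e (pd f u) z = pd f (pd e u) z := by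
  rw [pd_pd hu, pd_pd hu]
  exact hu.contDiffAt.isSymmSndFDerivAt (n := ⊤) (by simp) e f

theorem pd_iterate_comm {u : ℂ → ℝ} {G : Set ℂ} (hG : IsOpen G) (hu : ∀ z ∈ G, AnalyticAt ℝ u z)
    (e f : ℂ) (k : ℕ) : ∀ z ∈ G, pd f ((pd e)^[k] u) z = (pd e)^[k] (pd f u) z := by
  induction k with
  | zero => exact fun _ _ => rfl
  | succ k ih =>
    intro z hz
    rw [Function.iterate_succ_apply', Function.iterate_succ_apply',
      pd_comm ((hu z hz).pd_iterate e k)]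
    have : pd f ((pd e)^[k] u) =ᶠ[nhds z] (pd e)^[k] (pd f u) :=
      Filter.eventually_of_mem (hG.mem_nhds hz) ih
    exact (this.pd e).self_of_nhds

theorem hasDerivAt_mk_left (x y : ℝ) : HasDerivAt (fun t : ℝ => (⟨t, y⟩ : ℂ)) 1 x := by
  have h := (Complex.ofRealCLM.hasDerivAt (x := x)).add_const (y * Complex.I)
  simpa [Complex.mk_eq_add_mul_I] using h

theorem hasDerivAt_mk_right (x y : ℝ) :
    HasDerivAt (fun t : ℝ => (⟨x, t⟩ : ℂ)) Complex.I y := by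
  have h := ((Complex.ofRealCLM.hasDerivAt (x := y)).mul_const Complex.I).const_add (x : ℂ)
  simpa [Complex.mk_eq_add_mul_I] using h

theorem hasDerivAt_line_left {u : ℂ → ℝ} {x y : ℝ} (hu : DifferentiableAt ℝ u ⟨x, y⟩) :
    HasDerivAt (fun t : ℝ => u ⟨t, y⟩) (pd 1 u ⟨x, y⟩) x :=
  hu.hasFDerivAt.comp_hasDerivAt x (hasDerivAt_mk_left x y)

theorem hasDerivAt_line_right {u : ℂ → ℝ} {x y : ℝ} (hu : DifferentiableAt ℝ u ⟨x, y⟩) :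
    HasDerivAt (fun t : ℝ => u ⟨x, t⟩) (pd Complex.I u ⟨x, y⟩) y :=
  hu.hasFDerivAt.comp_hasDerivAt y (hasDerivAt_mk_right x y)

theorem continuous_mk_left (y : ℝ) : Continuous (fun t : ℝ => (⟨t, y⟩ : ℂ)) :=
  continuous_iff_continuousAt.2 fun x => (hasDerivAt_mk_left x y).continuousAt

theorem continuous_mk_right (x : ℝ) : Continuous (fun t : ℝ => (⟨x, t⟩ : ℂ)) :=
  continuous_iff_continuousAt.2 fun y => (hasDerivAt_mk_right x y).continuousAt

theorem hasSecondDerivAt_left {u : ℂ → ℝ} {x y : ℝ} (hu : AnalyticAt ℝ u ⟨x, y⟩) :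
    HasSecondDerivAt (fun t : ℝ => u ⟨t, y⟩) (pd 1 (pd 1 u) ⟨x, y⟩) x := by
  refine ⟨fun t => pd 1 u ⟨t, y⟩, ?_, hasDerivAt_line_left (hu.pd 1).differentiableAt⟩
  have := ((continuous_mk_left y).tendsto x).eventually hu.eventually_analyticAt
  filter_upwards [this] with t ht using hasDerivAt_line_left ht.differentiableAt

theorem hasSecondDerivAt_right {u : ℂ → ℝ} {x y : ℝ} (hu : AnalyticAt ℝ u ⟨x, y⟩) :
    HasSecondDerivAt (fun t : ℝ => u ⟨x, t⟩) (pd Complex.I (pd Complex.I u) ⟨x, y⟩) y := by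
  refine ⟨fun t => pd Complex.I u ⟨x, t⟩, ?_,
    hasDerivAt_line_right (hu.pd Complex.I).differentiableAt⟩
  have := ((continuous_mk_right x).tendsto y).eventually hu.eventually_analyticAt
  filter_upwards [this] with t ht using hasDerivAt_line_right ht.differentiableAt

theorem pd_comp {φ : ℂ → ℝ} {Q : ℂ → ℂ} {z : ℂ} (hφ : DifferentiableAt ℝ φ (Q z))
    (hQ : DifferentiableAt ℂ Q z) (e : ℂ) :
    pd e (fun w => φ (Q w)) z = fderiv ℝ φ (Q z) (deriv Q z * e) := by
  have h := hφ.hasFDerivAt.comp z (hQ.hasDerivAt.hasFDerivAt.restrictScalars ℝ)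
  have h2 : fderiv ℝ (fun w => φ (Q w)) z = _ := h.fderiv
  rw [pd, h2]
  simp [mul_comm]

theorem pd_pd_comp {φ : ℂ → ℝ} {Q : ℂ → ℂ} {z : ℂ} (hφ : AnalyticAt ℝ φ (Q z))
    (hQ : AnalyticAt ℂ Q z) (e : ℂ) :
    pd e (pd e (fun w => φ (Q w))) z =
      fderiv ℝ (fderiv ℝ φ) (Q z) (deriv Q z * e) (deriv Q z * e) +
      fderiv ℝ φ (Q z) (deriv (deriv Q) z * e * e) := by
  have hev : pd e (fun w => φ (Q w)) =ᶠ[nhds z]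
      fun w => fderiv ℝ φ (Q w) (deriv Q w * e) := by
    filter_upwards [hQ.continuousAt.eventually hφ.eventually_analyticAt,
      hQ.eventually_analyticAt] with w h1 h2
    exact pd_comp h1.differentiableAt h2.differentiableAt e
  rw [(hev.pd e).self_of_nhds]
  have h1 := hφ.fderiv.differentiableAt.hasFDerivAt.comp z
    (hQ.differentiableAt.hasDerivAt.hasFDerivAt.restrictScalars ℝ)
  have h2 := (hQ.deriv.differentiableAt.hasDerivAt.mul_const e).hasFDerivAt.restrictScalars ℝ
  have h3 : fderiv ℝ (fun w => fderiv ℝ φ (Q w) (deriv Q w * e)) z = _ :=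
    (h1.clm_apply h2).fderiv
  rw [pd, h3]
  simp [mul_comm, add_comm]

theorem lapC_comp {φ : ℂ → ℝ} {Q : ℂ → ℂ} {z : ℂ} (hφ : AnalyticAt ℝ φ (Q z))
    (hQ : AnalyticAt ℂ Q z) :
    lapC (fun w => φ (Q w)) z = ‖deriv Q z‖ ^ 2 * lapC φ (Q z) := by
  rw [lapC, lapC, pd_pd_comp hφ hQ, pd_pd_comp hφ hQ, pd_pd hφ, pd_pd hφ]
  set D := fderiv ℝ (fderiv ℝ φ) (Q z)
  have hsymm : D 1 Complex.I = D Complex.I 1 :=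
    hφ.contDiffAt.isSymmSndFDerivAt (n := ⊤) (by simp) 1 Complex.I
  have hI : deriv (deriv Q) z * Complex.I * Complex.I = -(deriv (deriv Q) z) := by
    rw [mul_assoc, Complex.I_mul_I]; ring
  rw [hI, mul_one, mul_one, mul_one, map_neg]
  set a := deriv Q z
  have h1 : a = a.re • (1 : ℂ) + a.im • Complex.I := by
    conv_lhs => rw [← Complex.re_add_im a]
    simp
  have h2 : a * Complex.I = (-a.im) • (1 : ℂ) + a.re • Complex.I := by
    conv_lhs => rw [← Complex.re_add_im a]
    simp only [Complex.real_smul]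
    push_cast
    linear_combination (a.im : ℂ) * Complex.I_mul_I
  have h3 : ‖a‖ ^ 2 = a.re ^ 2 + a.im ^ 2 := by
    rw [← Complex.normSq_eq_norm_sq, Complex.normSq_apply]; ring
  rw [h2, h3]
  have h4 : D a a = a.re ^ 2 * D 1 1 + 2 * a.re * a.im * D 1 Complex.I +
      a.im ^ 2 * D Complex.I Complex.I := by
    rw [h1]
    simp only [map_add, map_smul, _root_.add_apply,
      _root_.smul_apply, smul_eq_mul, hsymm]
    simp
    ring
  rw [h4]
  simp only [map_add, map_smul, _root_.add_apply,
      _root_.smul_apply, smul_eq_mul, hsymm]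
  ring

/-- A holomorphic map on the strip `|Im z| < 2δ`, parametrizing the frontier of `Ω` by the real
axis and sending the upper half of the strip into `Ω`, onto a neighbourhood of the frontier. -/
structure CollarMap (Ω : Set ℂ) (Q : ℂ → ℂ) (ℓ δ : ℝ) : Prop where
  len_pos : 0 < ℓ
  width_pos : 0 < δ
  differentiableOn : DifferentiableOn ℂ Q {z | |z.im| < 2 * δ}
  norm_deriv_le : ∀ z : ℂ, |z.im| < 2 * δ → ‖deriv Q z‖ ≤ 2
  norm_deriv_real : ∀ s : ℝ, ‖deriv Q s‖ = 1
  periodic : ∀ s : ℝ, Q ((s + ℓ : ℝ) : ℂ) = Q s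
  range_eq : Set.range (fun s : ℝ => Q s) = frontier Ω
  mem : ∀ z : ℂ, 0 < z.im → z.im < 2 * δ → Q z ∈ Ω
  exists_eq : ∀ x ∈ Ω, ∀ r, 0 < r → r ≤ δ → Metric.infDist x (frontier Ω) < r / 4 →
    ∃ z : ℂ, 0 < z.im ∧ z.im ≤ r ∧ Q z = x

/-- A Dirichlet eigenfunction on a domain in the complex plane. -/
structure IsEigenfunction (Ω : Set ℂ) (lam : ℝ) (ψ : ℂ → ℝ) : Prop where
  analytic : ∀ x ∈ closure Ω, AnalyticAt ℝ ψ x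
  nontrivial : ∃ x ∈ Ω, ψ x ≠ 0
  eigen : ∀ x ∈ Ω, lapC ψ x = -lam ^ 2 * ψ x
  dirichlet : ∀ x ∈ frontier Ω, ψ x = 0

theorem ofReal_iteratedDeriv {H : ℂ → ℂ} {w : ℝ → ℝ} (hH : ∀ t : ℝ, AnalyticAt ℂ H t)
    (hw : ∀ t : ℝ, (w t : ℂ) = H t) (k : ℕ) :
    ∀ t : ℝ, ((iteratedDeriv k w t : ℝ) : ℂ) = iteratedDeriv k H t := by
  induction k with
  | zero => simpa using hw
  | succ k ih =>
    intro t
    have hd : DifferentiableAt ℂ (iteratedDeriv k H) t := by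
      have := (hH t).iterated_deriv k
      rw [← iteratedDeriv_eq_iterate] at this
      exact this.differentiableAt
    have h1 : HasDerivAt (iteratedDeriv k w) (deriv (iteratedDeriv k H) t).re t := by
      have h := hd.hasDerivAt.real_of_complex
      simpa only [← ih, Complex.ofReal_re] using h
    have h2 := hd.hasDerivAt.comp_ofReal
    simp only [← ih] at h2
    rw [iteratedDeriv_succ, iteratedDeriv_succ, h1.deriv]
    exact h1.ofReal_comp.unique h2

theorem iteratedDeriv_line {h : ℂ → ℝ} {y : ℝ} (hh : ∀ x : ℝ, AnalyticAt ℝ h ⟨x, y⟩) (k : ℕ) :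
    ∀ x : ℝ, iteratedDeriv k (fun t : ℝ => h ⟨t, y⟩) x = (pd 1)^[k] h ⟨x, y⟩ := by
  induction k with
  | zero => exact fun _ => rfl
  | succ k ih =>
    intro x
    rw [iteratedDeriv_succ, Function.iterate_succ_apply', funext ih]
    exact (hasDerivAt_line_left ((hh x).pd_iterate 1 k).differentiableAt).deriv

theorem contDiff_line {h : ℂ → ℝ} {y : ℝ} (hh : ∀ x : ℝ, AnalyticAt ℝ h ⟨x, y⟩) {n : ℕ∞} :
    ContDiff ℝ n (fun t : ℝ => h ⟨t, y⟩) := by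
  refine contDiff_of_differentiable_iteratedDeriv fun k _ => ?_
  rw [funext (iteratedDeriv_line hh k)]
  exact fun x => (hasDerivAt_line_left ((hh x).pd_iterate 1 k).differentiableAt).differentiableAt

theorem abs_le_of_hasDerivAt {g : ℝ → ℝ} {g' C r : ℝ} (hr : 0 < r) (hg : HasDerivAt g g' 0)
    (h0 : g 0 = 0) (h : ∀ y, 0 ≤ y → y ≤ r → |g y| ≤ C * y) : |g'| ≤ C := by
  have hs := ((hasDerivWithinAt_iff_tendsto_slope' (by simp)).1
    (hg.hasDerivWithinAt (s := Set.Ioi 0))).abs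
  refine le_of_tendsto hs ?_
  filter_upwards [Ioo_mem_nhdsGT hr] with t ht
  rw [slope_def_field, h0, sub_zero, sub_zero, abs_div, abs_of_pos ht.1, div_le_iff₀ ht.1]
  exact h t ht.1.le ht.2.le

namespace CollarMap

variable {Ω : Set ℂ} {Q : ℂ → ℂ} {ℓ δ : ℝ}

theorem analyticAt (hQ : CollarMap Ω Q ℓ δ) {z : ℂ} (hz : |z.im| < 2 * δ) :
    AnalyticAt ℂ Q z := by
  refine hQ.differentiableOn.analyticAt (IsOpen.mem_nhds ?_ hz)
  exact isOpen_lt (by fun_prop) continuous_const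

theorem mem_frontier (hQ : CollarMap Ω Q ℓ δ) (s : ℝ) : Q s ∈ frontier Ω :=
  hQ.range_eq ▸ ⟨s, rfl⟩

theorem mem_closure (hQ : CollarMap Ω Q ℓ δ) {z : ℂ} (h0 : 0 ≤ z.im) (hz : z.im < 2 * δ) :
    Q z ∈ closure Ω := by
  rcases h0.eq_or_lt with h | h
  · have : z = (z.re : ℂ) := Complex.ext (by simp) (by simp [← h])
    rw [this]
    exact frontier_subset_closure (hQ.mem_frontier _)
  · exact subset_closure (hQ.mem z h hz)

theorem abs_iteratedDeriv_weight_le (hQ : CollarMap Ω Q ℓ δ) {y : ℝ} (hy : 0 < y) (hyδ : y < δ)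
    (j : ℕ) (x : ℝ) :
    |iteratedDeriv j (fun t : ℝ => ‖deriv Q ⟨t, y⟩‖ ^ 2) x| ≤
      (4 + 2 / δ) ^ (j + 1) * j.factorial := by
  have hδ := hQ.width_pos
  set H : ℂ → ℂ := fun z => deriv Q (z + y * Complex.I) *
    (starRingEnd ℂ) (deriv Q ((starRingEnd ℂ) z + y * Complex.I)) with hH
  have him : ∀ z : ℂ, |z.im| ≤ δ → |(z + y * Complex.I).im| < 2 * δ := by
    intro z hz
    rw [abs_le] at hz
    simp only [Complex.add_im, Complex.mul_im, Complex.ofReal_re, Complex.I_im, mul_one,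
      Complex.ofReal_im, Complex.I_re, mul_zero, add_zero, abs_lt]
    constructor <;> linarith [hz.1, hz.2]
  have hA : ∀ z : ℂ, |z.im| ≤ δ → AnalyticAt ℂ (fun z => deriv Q (z + y * Complex.I)) z := by
    intro z hz
    exact (hQ.analyticAt (him z hz)).deriv.fun_comp (f := fun z : ℂ => z + y * Complex.I)
      (by fun_prop)
  have hD : ∀ z : ℂ, |z.im| < δ → DifferentiableAt ℂ H z := by
    intro z hz
    refine (hA z hz.le).differentiableAt.mul ?_
    have : DifferentiableAt ℂ (fun z => deriv Q (z + y * Complex.I)) ((starRingEnd ℂ) z) :=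
      (hA _ (by simpa using hz.le)).differentiableAt
    simpa [Function.comp_def] using this.conj_conj
  have hDan : ∀ z : ℂ, |z.im| < δ → AnalyticAt ℂ H z := by
    intro z hz
    have hop : IsOpen {z : ℂ | |z.im| < δ} := isOpen_lt (by fun_prop) continuous_const
    exact DifferentiableOn.analyticAt (s := {z : ℂ | |z.im| < δ})
      (fun w hw => (hD w hw).differentiableWithinAt) (hop.mem_nhds hz)
  have hb : ∀ z : ℂ, |z.im| < δ → ‖H z‖ ≤ 4 := by
    intro z hz
    rw [hH]; simp only [norm_mul, RCLike.norm_conj]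
    have h1 := hQ.norm_deriv_le _ (him z hz.le)
    have h2 := hQ.norm_deriv_le _ (him ((starRingEnd ℂ) z) (by simpa using hz.le))
    nlinarith [norm_nonneg (deriv Q (z + y * Complex.I)),
      norm_nonneg (deriv Q ((starRingEnd ℂ) z + y * Complex.I))]
  have hw : ∀ t : ℝ, ((‖deriv Q ⟨t, y⟩‖ ^ 2 : ℝ) : ℂ) = H t := by
    intro t
    rw [hH]; simp only [Complex.conj_ofReal]
    rw [Complex.mul_conj, Complex.normSq_eq_norm_sq, Complex.mk_eq_add_mul_I]
  have hR : (0 : ℝ) < δ / 2 := by positivity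
  have hball : ∀ z ∈ Metric.closedBall (x : ℂ) (δ / 2), |z.im| < δ := by
    intro z hz
    have h1 := Complex.abs_im_le_norm (z - x)
    simp only [Complex.sub_im, Complex.ofReal_im, sub_zero] at h1
    rw [mem_closedBall_iff_norm] at hz
    linarith
  have hcauchy := Complex.norm_iteratedDeriv_le_of_forall_mem_sphere_norm_le (f := H) j hR
    (c := (x : ℂ)) (C := 4) ?_ (fun z hz => hb z (hball z (Metric.sphere_subset_closedBall hz)))
  · rw [← ofReal_iteratedDeriv (fun t => hDan t (by simpa using hδ)) hw] at hcauchy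
    rw [Complex.norm_real, Real.norm_eq_abs] at hcauchy
    refine hcauchy.trans ?_
    have h5 : (4 : ℝ) / (δ / 2) ^ j ≤ (4 + 2 / δ) ^ (j + 1) := by
      rw [pow_succ, div_eq_mul_inv, ← inv_pow, mul_comm]
      have : (δ / 2)⁻¹ = 2 / δ := by field_simp
      rw [this]
      have : 0 < 2 / δ := by positivity
      gcongr <;> linarith
    rw [mul_div_assoc, mul_comm]
    gcongr
  · refine DifferentiableOn.diffContOnCl fun z hz => ?_
    rw [closure_ball _ hR.ne'] at hz
    exact (hD z (hball z hz)).differentiableWithinAt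


theorem analyticAt_comp (hQ : CollarMap Ω Q ℓ δ) {lam : ℝ} {ψ : ℂ → ℝ}
    (hψ : IsEigenfunction Ω lam ψ) {z : ℂ} (h0 : 0 ≤ z.im) (hz : z.im < 2 * δ) :
    AnalyticAt ℝ (fun w => ψ (Q w)) z :=
  (hψ.analytic _ (hQ.mem_closure h0 hz)).fun_comp
    (hQ.analyticAt (by rwa [abs_of_nonneg h0])).restrictScalars

theorem lapC_comp_eq (hQ : CollarMap Ω Q ℓ δ) {lam : ℝ} {ψ : ℂ → ℝ}
    (hψ : IsEigenfunction Ω lam ψ) {z : ℂ} (h0 : 0 < z.im) (hz : z.im < 2 * δ) :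
    lapC (fun w => ψ (Q w)) z = -lam ^ 2 * (‖deriv Q z‖ ^ 2 * ψ (Q z)) := by
  rw [lapC_comp (hψ.analytic _ (hQ.mem_closure h0.le hz))
    (hQ.analyticAt (by rwa [abs_of_pos h0])), hψ.eigen _ (hQ.mem z h0 hz)]
  ring

theorem comp_zero (hQ : CollarMap Ω Q ℓ δ) {lam : ℝ} {ψ : ℂ → ℝ}
    (hψ : IsEigenfunction Ω lam ψ) (k : ℕ) (x : ℝ) :
    (pd 1)^[k] (fun w => ψ (Q w)) ⟨x, 0⟩ = 0 := by
  have hδ := hQ.width_pos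
  rw [← iteratedDeriv_line (fun x => hQ.analyticAt_comp hψ le_rfl (by simpa using hδ))]
  have : (fun t : ℝ => ψ (Q ⟨t, 0⟩)) = fun _ => 0 := by
    funext t
    exact hψ.dirichlet _ (hQ.mem_frontier t)
  rw [this, iteratedDeriv_const]
  simp

theorem abs_pd_pd_add_le (hQ : CollarMap Ω Q ℓ δ) {lam : ℝ} {ψ : ℂ → ℝ}
    (hψ : IsEigenfunction Ω lam ψ) (k : ℕ) {x y : ℝ} (hy : 0 < y) (hyδ : y < δ) :
    |(pd 1)^[k + 2] (fun w => ψ (Q w)) ⟨x, y⟩ +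
      pd Complex.I (pd Complex.I ((pd 1)^[k] (fun w => ψ (Q w)))) ⟨x, y⟩| ≤
    lam ^ 2 * ∑ j ∈ Finset.range (k + 1),
      (k.choose j : ℝ) * ((4 + 2 / δ) ^ (j + 1) * j.factorial) *
        |(pd 1)^[k - j] (fun w => ψ (Q w)) ⟨x, y⟩| := by
  have hδ := hQ.width_pos
  set v : ℂ → ℝ := fun w => ψ (Q w) with hv
  set G : Set ℂ := {z | 0 < z.im ∧ z.im < 2 * δ} with hG
  have hGo : IsOpen G := (isOpen_lt continuous_const Complex.continuous_im).inter
    (isOpen_lt Complex.continuous_im continuous_const)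
  have hline : ∀ t : ℝ, (⟨t, y⟩ : ℂ) ∈ G := fun t => ⟨hy, by simp only; linarith⟩
  have hva : ∀ z ∈ G, AnalyticAt ℝ v z := fun z hz => hQ.analyticAt_comp hψ hz.1.le hz.2
  have hI : pd Complex.I (pd Complex.I ((pd 1)^[k] v)) ⟨x, y⟩ =
      (pd 1)^[k] (pd Complex.I (pd Complex.I v)) ⟨x, y⟩ := by
    have h1 : pd Complex.I ((pd 1)^[k] v) =ᶠ[nhds ⟨x, y⟩] (pd 1)^[k] (pd Complex.I v) :=
      Filter.eventually_of_mem (hGo.mem_nhds (hline x)) (pd_iterate_comm hGo hva 1 Complex.I k)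
    rw [(h1.pd Complex.I).self_of_nhds]
    exact pd_iterate_comm hGo (fun z hz => (hva z hz).pd _) 1 Complex.I k _ (hline x)
  have e1 : ∀ t : ℝ, AnalyticAt ℝ (pd 1 (pd 1 v)) ⟨t, y⟩ :=
    fun t => ((hva _ (hline t)).pd 1).pd 1
  have e2 : ∀ t : ℝ, AnalyticAt ℝ (pd Complex.I (pd Complex.I v)) ⟨t, y⟩ :=
    fun t => ((hva _ (hline t)).pd _).pd _
  rw [hI, Function.iterate_add_apply]
  change |(pd 1)^[k] (pd 1 (pd 1 v)) ⟨x, y⟩ + _| ≤ _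
  rw [← iteratedDeriv_line e1, ← iteratedDeriv_line e2,
    ← iteratedDeriv_fun_add (contDiff_line e1 (n := k)).contDiffAt
      (contDiff_line e2 (n := k)).contDiffAt]
  have hlap : (fun t : ℝ => pd 1 (pd 1 v) ⟨t, y⟩ + pd Complex.I (pd Complex.I v) ⟨t, y⟩) =
      fun t : ℝ => -lam ^ 2 * ((fun t : ℝ => ‖deriv Q ⟨t, y⟩‖ ^ 2) * fun t : ℝ => v ⟨t, y⟩) t := by
    funext t
    exact hQ.lapC_comp_eq hψ (hline t).1 (hline t).2
  have hvline := fun t => hva _ (hline t)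
  have hdQ : ContDiff ℝ k (fun t : ℝ => ‖deriv Q ⟨t, y⟩‖ ^ 2) := by
    refine contDiff_iff_contDiffAt.2 fun t => ?_
    have h1 : AnalyticAt ℝ (deriv Q) ⟨t, y⟩ :=
      (hQ.analyticAt (by rw [abs_of_pos hy]; linarith)).deriv.restrictScalars
    have h2 : ContDiffAt ℝ k (fun t : ℝ => (⟨t, y⟩ : ℂ)) t := by
      have : ContDiff ℝ k (fun t : ℝ => (t : ℂ) + y * Complex.I) :=
        Complex.ofRealCLM.contDiff.add contDiff_const
      simpa only [← Complex.mk_eq_add_mul_I] using this.contDiffAt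
    exact (h1.contDiffAt.comp t h2).norm_sq ℝ
  have hvc : ContDiff ℝ k (fun t : ℝ => v ⟨t, y⟩) := contDiff_line hvline
  rw [hlap, iteratedDeriv_const_mul_field,
    iteratedDeriv_mul hdQ.contDiffAt hvc.contDiffAt, abs_mul, abs_neg, abs_of_nonneg (sq_nonneg _)]
  gcongr
  refine (Finset.abs_sum_le_sum_abs _ _).trans (Finset.sum_le_sum fun j _ => ?_)
  rw [abs_mul, abs_mul, Nat.abs_cast, iteratedDeriv_line hvline]
  gcongr
  exact hQ.abs_iteratedDeriv_weight_le hy hyδ j x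

theorem stripFamily (hQ : CollarMap Ω Q ℓ δ) {lam : ℝ} {ψ : ℂ → ℝ}
    (hψ : IsEigenfunction Ω lam ψ) {M : ℝ} (hM : ∀ z ∈ closure Ω, |ψ z| ≤ M) (hlam : 0 ≤ lam) :
    StripFamily (fun k x y => (pd 1)^[k] (fun w => ψ (Q w)) ⟨x, y⟩) δ (4 + 2 / δ) (max 1 lam) M := by
  have hδ := hQ.width_pos
  have han : ∀ k (z : ℂ), 0 ≤ z.im → z.im ≤ δ →
      AnalyticAt ℝ ((pd 1)^[k] (fun w => ψ (Q w))) z :=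
    fun k z h0 h1 => (hQ.analyticAt_comp hψ h0 (by linarith)).pd_iterate 1 k
  refine ⟨?_, ?_, ?_, ?_, ?_⟩
  · rintro k ⟨x, y⟩ ⟨h0, h1⟩
    have hc : Continuous fun p : ℝ × ℝ => (⟨p.1, p.2⟩ : ℂ) :=
      Complex.equivRealProdCLM.symm.continuous
    exact (ContinuousAt.comp (f := fun p : ℝ × ℝ => (⟨p.1, p.2⟩ : ℂ)) (x := (x, y))
      (han k ⟨x, y⟩ h0 h1).continuousAt hc.continuousAt).continuousWithinAt
  · intro k x y h0 h1
    rw [Function.iterate_succ_apply']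
    exact hasDerivAt_line_left (han k ⟨x, y⟩ h0 h1).differentiableAt
  · exact fun k x => hQ.comp_zero hψ k x
  · intro k x y h0 h1
    refine ⟨_, hasSecondDerivAt_right (han k ⟨x, y⟩ h0.le h1.le), ?_⟩
    refine (hQ.abs_pd_pd_add_le hψ k h0 h1).trans ?_
    gcongr
    exact le_max_right _ _
  · intro x y h0 h1
    exact hM _ (hQ.mem_closure h0 (by simp only; linarith))

/-- The constant in the estimates of tangential derivatives in the collar. -/
def collarConst (δ : ℝ) : ℝ :=
  (2 + (4 + 2 / δ) * δ ^ 2 + 2 * (4 + 2 / δ) * δ) / δ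

theorem collarConst_pos (hδ : 0 < δ) : 0 < collarConst δ := by
  unfold collarConst; positivity

theorem abs_comp_le (hQ : CollarMap Ω Q ℓ δ) {lam : ℝ} {ψ : ℂ → ℝ}
    (hψ : IsEigenfunction Ω lam ψ) {M : ℝ} (hM : ∀ z ∈ closure Ω, |ψ z| ≤ M) (hlam : 0 ≤ lam)
    (k : ℕ) {x y : ℝ} (hy : 0 ≤ y) (hyδ : y ≤ δ / (k + 1 + max 1 lam)) :
    |(pd 1)^[k] (fun w => ψ (Q w)) ⟨x, y⟩| ≤
      M * (collarConst δ * (k + 1 + max 1 lam)) ^ (k + 1) * y := by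
  have hδ := hQ.width_pos
  have := (hQ.stripFamily hψ hM hlam).abs_le_mul hδ (by positivity) (le_max_left _ _) le_rfl k
    (x := x) hy hyδ
  rw [mul_div_right_comm] at this
  exact this

theorem abs_iteratedDeriv_normal_le (hQ : CollarMap Ω Q ℓ δ) {lam : ℝ} {ψ : ℂ → ℝ}
    (hψ : IsEigenfunction Ω lam ψ) {M : ℝ} (hM : ∀ z ∈ closure Ω, |ψ z| ≤ M) (hlam : 0 ≤ lam)
    (k : ℕ) (x : ℝ) :
    |iteratedDeriv k (fun t : ℝ => pd Complex.I (fun w => ψ (Q w)) t) x| ≤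
      M * (collarConst δ * (k + 1 + max 1 lam)) ^ (k + 1) := by
  have hδ := hQ.width_pos
  set v : ℂ → ℝ := fun w => ψ (Q w) with hv
  have hreal : ∀ t : ℝ, AnalyticAt ℝ v ⟨t, 0⟩ :=
    fun t => hQ.analyticAt_comp hψ le_rfl (by simpa using hδ)
  have h1 : iteratedDeriv k (fun t : ℝ => pd Complex.I v t) x =
      pd Complex.I ((pd 1)^[k] v) ⟨x, 0⟩ := by
    have h2 := iteratedDeriv_line (h := pd Complex.I v) (y := 0)
      (fun t => (hreal t).pd Complex.I) k x
    refine h2.trans ?_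
    exact (pd_iterate_comm (isOpen_analyticAt ℝ v) (fun z hz => hz) 1 Complex.I k _
      (hreal x)).symm
  rw [h1]
  have hr : 0 < δ / (k + 1 + max 1 lam) := by positivity
  exact abs_le_of_hasDerivAt hr
    (hasDerivAt_line_right ((hreal x).pd_iterate 1 k).differentiableAt)
    (hQ.comp_zero hψ k x) (fun y h0 h1 => hQ.abs_comp_le hψ hM hlam k h0 h1)

theorem analyticAt_normal (hQ : CollarMap Ω Q ℓ δ) {lam : ℝ} {ψ : ℂ → ℝ}
    (hψ : IsEigenfunction Ω lam ψ) (x : ℝ) :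
    AnalyticAt ℝ (fun t : ℝ => pd Complex.I (fun w => ψ (Q w)) t) x := by
  have hδ := hQ.width_pos
  have h := (hQ.analyticAt_comp hψ (z := x) (by simp) (by simpa using hδ)).pd Complex.I
  exact h.fun_comp (Complex.ofRealCLM.analyticAt x)

end CollarMap

theorem eqOn_of_eqOn_real {F G : ℂ → ℂ} {S : Set ℂ} (hS : IsOpen S) (hc : IsPreconnected S)
    (hF : DifferentiableOn ℂ F S) (hG : DifferentiableOn ℂ G S) {a : ℝ} (ha : (a : ℂ) ∈ S)
    (h : ∀ t : ℝ, (t : ℂ) ∈ S → F t = G t) : Set.EqOn F G S := by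
  refine (hF.analyticOnNhd hS).eqOn_of_preconnected_of_frequently_eq (hG.analyticOnNhd hS) hc ha ?_
  have ht : Filter.Tendsto (fun t : ℝ => (t : ℂ)) (nhdsWithin a {a}ᶜ)
      (nhdsWithin (a : ℂ) {(a : ℂ)}ᶜ) := by
    refine tendsto_nhdsWithin_iff.2
      ⟨(Complex.continuous_ofReal.tendsto a).mono_left nhdsWithin_le_nhds, ?_⟩
    filter_upwards [self_mem_nhdsWithin] with t ht
    simpa using ht
  refine ht.frequently (Filter.Eventually.frequently ?_)
  have : ∀ᶠ t : ℝ in nhds a, (t : ℂ) ∈ S :=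
    (Complex.continuous_ofReal.tendsto a).eventually (hS.mem_nhds ha)
  filter_upwards [nhdsWithin_le_nhds this] with t ht using h t ht

theorem exists_local_extension {f : ℝ → ℂ} (hf : ∀ t, AnalyticAt ℝ f t) {a : ℕ → ℂ} {x : ℝ}
    (ha : ∀ᶠ t in nhds x, HasSum (fun n => (t - x) ^ n • a n) (f t)) {ρ K : ℝ} (hρ : 0 < ρ)
    (hb : ∀ n, ‖a n‖ * (2 * ρ) ^ n ≤ K) :
    ∃ G : ℂ → ℂ, DifferentiableOn ℂ G (Metric.ball x ρ) ∧
      (∀ t : ℝ, (t : ℂ) ∈ Metric.ball (x : ℂ) ρ → G t = f t) ∧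
      ∀ z ∈ Metric.ball (x : ℂ) ρ, ‖G z‖ ≤ 2 * K := by
  have hle : ∀ n, ∀ z ∈ Metric.ball (x : ℂ) ρ, ‖a n * (z - x) ^ n‖ ≤ K * (1 / 2 : ℝ) ^ n := by
    intro n z hz
    rw [mem_ball_iff_norm] at hz
    rw [norm_mul, norm_pow]
    calc ‖a n‖ * ‖z - x‖ ^ n ≤ ‖a n‖ * ρ ^ n := by gcongr
      _ = ‖a n‖ * (2 * ρ) ^ n * (1 / 2 : ℝ) ^ n := by
        rw [mul_assoc, ← mul_pow]; congr 2; ring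
      _ ≤ _ := by gcongr; exact hb n
  have hsum : Summable fun n : ℕ => K * (1 / 2 : ℝ) ^ n := summable_geometric_two.mul_left K
  set G : ℂ → ℂ := fun z => ∑' n, a n * (z - x) ^ n with hG
  have hGd : DifferentiableOn ℂ G (Metric.ball x ρ) := by
    refine Complex.differentiableOn_tsum_of_summable_norm hsum (fun n => ?_) Metric.isOpen_ball hle
    fun_prop
  refine ⟨G, hGd, ?_, ?_⟩
  · have hGa : AnalyticOnNhd ℝ (fun t : ℝ => G t) (Metric.ball x ρ) := by
      intro t ht
      have h1 : AnalyticAt ℂ G t := by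
        refine hGd.analyticAt (Metric.isOpen_ball.mem_nhds ?_)
        rw [mem_ball_iff_norm, ← Complex.ofReal_sub, Complex.norm_real]
        exact mem_ball_iff_norm.1 ht
      exact h1.restrictScalars.fun_comp (Complex.ofRealCLM.analyticAt t)
    have heq : Set.EqOn (fun t : ℝ => G t) f (Metric.ball x ρ) := by
      refine hGa.eqOn_of_preconnected_of_eventuallyEq (fun t _ => hf t)
        (convex_ball x ρ).isPreconnected (Metric.mem_ball_self hρ) ?_
      filter_upwards [ha] with t ht
      rw [← ht.tsum_eq]
      refine tsum_congr fun n => ?_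
      rw [Complex.real_smul]; push_cast; ring
    intro t ht
    refine heq ?_
    rw [mem_ball_iff_norm, ← Complex.ofReal_sub, Complex.norm_real] at ht
    exact mem_ball_iff_norm.2 ht
  · intro z hz
    have h2 := tsum_of_norm_bounded (hsum.hasSum) (fun n => hle n z hz)
    rw [tsum_mul_left, tsum_geometric_two] at h2
    linarith

theorem isOpen_strip (ρ : ℝ) : IsOpen {z : ℂ | |z.im| < ρ} :=
  isOpen_lt (by fun_prop) continuous_const

theorem convex_strip (ρ : ℝ) : Convex ℝ {z : ℂ | |z.im| < ρ} := by
  have : {z : ℂ | |z.im| < ρ} = Complex.imLm ⁻¹' Set.Ioo (-ρ) ρ := by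
    ext z; simp [abs_lt]
  rw [this]
  exact (convex_Ioo _ _).linear_preimage _

theorem glue_extension {f : ℝ → ℂ} {ρ : ℝ} {G : ℝ → ℂ → ℂ} (hρ : 0 < ρ)
    (hG : ∀ x : ℝ, DifferentiableOn ℂ (G x) (Metric.ball x ρ))
    (hGf : ∀ x t : ℝ, (t : ℂ) ∈ Metric.ball (x : ℂ) ρ → G x t = f t) :
    DifferentiableOn ℂ (fun z => G z.re z) {z | |z.im| < ρ} ∧ ∀ t : ℝ, G (t : ℂ).re t = f t := by
  refine ⟨fun z₀ hz₀ => ?_, fun t => hGf t t (by simpa using hρ)⟩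
  have hre : ∀ z : ℂ, |z.im| < ρ → z ∈ Metric.ball (z.re : ℂ) ρ := by
    intro z hz
    rw [mem_ball_iff_norm]
    have : z - z.re = z.im * Complex.I := by
      apply Complex.ext <;> simp
    rw [this]; simpa using hz
  have hev : (fun z => G z.re z) =ᶠ[nhds z₀] G z₀.re := by
    filter_upwards [Metric.isOpen_ball.mem_nhds (hre z₀ hz₀), (isOpen_strip ρ).mem_nhds hz₀]
      with z h1 h2
    refine eqOn_of_eqOn_real (S := Metric.ball (z.re : ℂ) ρ ∩ Metric.ball (z₀.re : ℂ) ρ)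
      (a := z.re) (Metric.isOpen_ball.inter Metric.isOpen_ball)
      ((convex_ball _ _).inter (convex_ball _ _)).isPreconnected
      ((hG z.re).mono Set.inter_subset_left) ((hG z₀.re).mono Set.inter_subset_right) ?_ ?_
      ⟨hre z h2, h1⟩
    · refine ⟨Metric.mem_ball_self hρ, ?_⟩
      rw [mem_ball_iff_norm] at h1 ⊢
      refine lt_of_le_of_lt ?_ h1
      rw [← Complex.ofReal_sub, Complex.norm_real]
      simpa using Complex.abs_re_le_norm (z - z₀.re)
    · rintro t ⟨h3, h4⟩
      rw [hGf _ _ h3, hGf _ _ h4]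
  have h5 := (hG z₀.re).differentiableAt (Metric.isOpen_ball.mem_nhds (hre z₀ hz₀))
  exact (hev.differentiableAt_iff.2 h5).differentiableWithinAt

theorem exists_strip_extension {f : ℝ → ℂ} (hf : ∀ t, AnalyticAt ℝ f t) {a : ℝ → ℕ → ℂ}
    (ha : ∀ x, ∀ᶠ t in nhds x, HasSum (fun n => (t - x) ^ n • a x n) (f t)) {ρ K : ℝ}
    (hρ : 0 < ρ) (hb : ∀ x n, ‖a x n‖ * (2 * ρ) ^ n ≤ K) :
    ∃ F : ℂ → ℂ, DifferentiableOn ℂ F {z | |z.im| < ρ} ∧ (∀ t : ℝ, F t = f t) ∧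
      ∀ z : ℂ, |z.im| < ρ → ‖F z‖ ≤ 2 * K := by
  choose G hG1 hG2 hG3 using fun x => exists_local_extension hf (ha x) hρ (hb x)
  obtain ⟨h1, h2⟩ := glue_extension hρ hG1 hG2
  refine ⟨_, h1, h2, fun z hz => hG3 _ _ ?_⟩
  rw [mem_ball_iff_norm]
  have : z - z.re = z.im * Complex.I := by
    apply Complex.ext <;> simp
  rw [this]; simpa using hz

/-- A real-analytic periodic curve extends holomorphically to a strip. -/
theorem exists_periodic_extension {f : ℝ → ℂ} (hf : ∀ t, AnalyticAt ℝ f t) {ℓ : ℝ} (hℓ : 0 < ℓ)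
    (hper : Function.Periodic f ℓ) :
    ∃ ρ > 0, ∃ F : ℂ → ℂ, DifferentiableOn ℂ F {z | |z.im| < ρ} ∧ ∀ t : ℝ, F t = f t := by
  have hloc : ∀ x : ℝ, ∃ r > 0, ∃ G : ℂ → ℂ, DifferentiableOn ℂ G (Metric.ball x r) ∧
      ∀ t : ℝ, (t : ℂ) ∈ Metric.ball (x : ℂ) r → G t = f t := by
    intro x
    obtain ⟨p, hp⟩ := hf x
    obtain ⟨r, hr, hr'⟩ : ∃ r : NNReal, 0 < r ∧ (r : ENNReal) < p.radius := by
      obtain ⟨r, h1, h2⟩ := ENNReal.lt_iff_exists_nnreal_btwn.1 hp.radius_pos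
      exact ⟨r, by exact_mod_cast h1, h2⟩
    obtain ⟨C, hC, hC'⟩ := p.norm_mul_pow_le_of_lt_radius hr'
    obtain ⟨G, h1, h2, -⟩ := exists_local_extension hf (hasFPowerSeriesAt_iff'.1 hp)
      (ρ := r / 2) (K := C) (by positivity) (fun n => by
        rw [← FormalMultilinearSeries.norm_apply_eq_norm_coef]
        convert hC' n using 3; ring)
    exact ⟨r / 2, by positivity, G, h1, h2⟩
  choose r hr G hG1 hG2 using hloc
  have hcpt : IsCompact (Complex.ofReal '' Set.Icc 0 ℓ) :=
    isCompact_Icc.image Complex.continuous_ofReal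
  obtain ⟨ρ, hρ, hρ'⟩ := lebesgue_number_lemma_of_metric
    (c := fun x : ℝ => Metric.ball (x : ℂ) (r x)) hcpt (fun _ => Metric.isOpen_ball)
    (by
      rintro _ ⟨x, -, rfl⟩
      exact Set.mem_iUnion.2 ⟨x, Metric.mem_ball_self (hr x)⟩)
  have hshift : ∀ x : ℝ, ∃ H : ℂ → ℂ, DifferentiableOn ℂ H (Metric.ball x ρ) ∧
      ∀ t : ℝ, (t : ℂ) ∈ Metric.ball (x : ℂ) ρ → H t = f t := by
    intro x
    set k := ⌊x / ℓ⌋ with hk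
    have h0 : x - k * ℓ ∈ Set.Icc 0 ℓ := by
      have h1 := Int.floor_le (x / ℓ)
      have h2 := Int.lt_floor_add_one (x / ℓ)
      rw [le_div_iff₀ hℓ] at h1
      rw [div_lt_iff₀ hℓ] at h2
      constructor <;> linarith
    obtain ⟨i, hi⟩ := hρ' _ ⟨_, h0, rfl⟩
    have hmem : ∀ z ∈ Metric.ball (x : ℂ) ρ, z - ((k * ℓ : ℝ) : ℂ) ∈ Metric.ball (i : ℂ) (r i) := by
      intro z hz
      apply hi
      rw [mem_ball_iff_norm] at hz ⊢
      convert hz using 2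
      push_cast; ring
    refine ⟨fun z => G i (z - ((k * ℓ : ℝ) : ℂ)), (hG1 i).comp (by fun_prop) hmem, ?_⟩
    intro t ht
    have h3 := hG2 i (t - k * ℓ) (by
      have := hmem _ ht
      rwa [← Complex.ofReal_sub] at this)
    rw [hper.sub_int_mul_eq] at h3
    rw [← h3]; push_cast; rfl
  choose H hH1 hH2 using hshift
  obtain ⟨h1, h2⟩ := glue_extension hρ hH1 hH2
  exact ⟨ρ, hρ, _, h1, h2⟩

theorem hasSum_taylor_ofReal {f : ℝ → ℝ} {x : ℝ} (hf : AnalyticAt ℝ f x) :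
    ∀ᶠ t in nhds x, HasSum
      (fun n => (t - x) ^ n • ((iteratedDeriv n f x / n.factorial : ℝ) : ℂ)) ((f t : ℝ) : ℂ) := by
  filter_upwards [hasFPowerSeriesAt_iff'.1 hf.hasFPowerSeriesAt] with t ht
  simp only [FormalMultilinearSeries.coeff_ofScalars, smul_eq_mul] at ht
  simpa only [Complex.real_smul, Complex.ofReal_mul] using Complex.hasSum_ofReal.2 ht

theorem pow_mul_le_exp (n : ℕ) {L : ℝ} (hL : 0 ≤ L) :
    (n + 1 + L) ^ (n + 1) ≤ 2 ^ n * n.factorial * exp (n + 1 + L) := by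
  have h := Real.pow_div_factorial_le_exp (n + 1 + L) (by positivity) (n + 1)
  rw [div_le_iff₀ (by positivity), Nat.factorial_succ] at h
  have h2 : ((n + 1 : ℕ) : ℝ) ≤ 2 ^ n := by exact_mod_cast Nat.lt_two_pow_self
  calc _ ≤ _ := h
    _ ≤ exp (n + 1 + L) * (2 ^ n * n.factorial) := by
      rw [Nat.cast_mul]; gcongr
    _ = _ := by ring

/-- The normal derivative of an eigenfunction extends holomorphically to a strip whose width
does not depend on the eigenvalue. -/
theorem CollarMap.exists_normal_extension {Ω : Set ℂ} {Q : ℂ → ℂ} {ℓ δ : ℝ}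
    (hQ : CollarMap Ω Q ℓ δ) {lam : ℝ} {ψ : ℂ → ℝ} (hψ : IsEigenfunction Ω lam ψ) {M : ℝ}
    (hM : ∀ z ∈ closure Ω, |ψ z| ≤ M) (hlam : 0 ≤ lam) :
    ∃ F : ℂ → ℂ, DifferentiableOn ℂ F {z | |z.im| < (4 * exp 1 * collarConst δ)⁻¹} ∧
      (∀ t : ℝ, F t = ((pd Complex.I (fun w => ψ (Q w)) t : ℝ) : ℂ)) ∧
      ∀ z : ℂ, |z.im| < (4 * exp 1 * collarConst δ)⁻¹ →
        ‖F z‖ ≤ 2 * (M * collarConst δ * exp (1 + max 1 lam)) := by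
  have hC := collarConst_pos hQ.width_pos
  have hM0 : 0 ≤ M := (abs_nonneg _).trans (hM _ (hQ.mem_closure (z := 0) (by simp) (by simpa using hQ.width_pos)))
  refine exists_strip_extension (f := fun t : ℝ => ((pd Complex.I (fun w => ψ (Q w)) t : ℝ) : ℂ))
    (fun t => (Complex.ofRealCLM.analyticAt _).fun_comp (hQ.analyticAt_normal hψ t))
    (fun x => hasSum_taylor_ofReal (hQ.analyticAt_normal hψ x)) (by positivity) ?_
  intro x n
  have h := hQ.abs_iteratedDeriv_normal_le hψ hM hlam n x
  rw [Complex.norm_real, norm_div, Real.norm_natCast, Real.norm_eq_abs]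
  have h2 := pow_mul_le_exp n (L := max 1 lam) (by positivity)
  set D := |iteratedDeriv n (fun t : ℝ => pd Complex.I (fun w => ψ (Q w)) t) x|
  set C := collarConst δ
  set L := max 1 lam
  have e1 : 2 * (4 * exp 1 * C)⁻¹ = (2 * exp 1 * C)⁻¹ := by field_simp; norm_num
  have e2 : exp (n + 1 + L) = exp 1 ^ n * exp (1 + L) := by
    rw [← Real.exp_nat_mul, ← Real.exp_add]; ring_nf
  rw [e1, inv_pow, ← div_eq_mul_inv, div_div, div_le_iff₀ (by positivity)]
  calc D ≤ M * (C * (n + 1 + L)) ^ (n + 1) := h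
    _ = M * C ^ (n + 1) * (n + 1 + L) ^ (n + 1) := by rw [mul_pow]; ring
    _ ≤ M * C ^ (n + 1) * (2 ^ n * n.factorial * (exp 1 ^ n * exp (1 + L))) := by
      rw [← e2]; gcongr
    _ = _ := by rw [mul_pow, mul_pow]; ring

theorem exists_lt_of_norm_sub_lt {q : ℝ → ℂ} (hq : Continuous q) {ℓ : ℝ} (hℓ : 0 < ℓ)
    (hper : Function.Periodic q ℓ) (hinj : Set.InjOn q (Set.Ico 0 ℓ)) {δ : ℝ} (hδ : 0 < δ) :
    ∃ ε > 0, ∀ s t : ℝ, ‖q s - q t‖ < ε → ∃ k : ℤ, |s - t - k * ℓ| < δ := by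
  set K : Set (ℝ × ℝ) := {p | p ∈ Set.Icc 0 ℓ ×ˢ Set.Icc 0 ℓ ∧ δ ≤ |p.1 - p.2| ∧
    δ ≤ |p.1 - p.2 - ℓ| ∧ δ ≤ |p.1 - p.2 + ℓ|} with hK
  have hKc : IsCompact K := by
    refine (isCompact_Icc.prod isCompact_Icc).inter_right ?_
    have hc : ∀ c : ℝ, IsClosed {p : ℝ × ℝ | δ ≤ |p.1 - p.2 + c|} := fun c =>
      isClosed_le (by fun_prop) (by fun_prop)
    have := (hc 0).inter ((hc (-ℓ)).inter (hc ℓ))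
    simp only [add_zero, ← sub_eq_add_neg] at this
    exact this
  have hpos : ∀ p ∈ K, 0 < ‖q p.1 - q p.2‖ := by
    rintro ⟨s, t⟩ ⟨⟨⟨h1, h2⟩, ⟨h3, h4⟩⟩, h5, h6, h7⟩
    simp only at h1 h2 h3 h4 h5 h6 h7 ⊢
    rw [norm_pos_iff, sub_ne_zero]
    intro h
    have hq0 : q ℓ = q 0 := by simpa using hper 0
    rcases h2.lt_or_eq with h2 | rfl <;> rcases h4.lt_or_eq with h4 | rfl
    · have := hinj ⟨h1, h2⟩ ⟨h3, h4⟩ h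
      simp [this] at h5; linarith
    · have := hinj ⟨h1, h2⟩ ⟨le_rfl, hℓ⟩ (h.trans hq0)
      simp [this] at h7; linarith
    · have := hinj ⟨h3, h4⟩ ⟨le_rfl, hℓ⟩ (h.symm.trans hq0)
      simp [this] at h6; linarith
    · simp at h5; linarith
  obtain ⟨ε, hε, hε'⟩ : ∃ ε > 0, ∀ p ∈ K, ε ≤ ‖q p.1 - q p.2‖ := by
    rcases K.eq_empty_or_nonempty with h | h
    · exact ⟨1, one_pos, by simp [h]⟩
    · obtain ⟨p, hp, hp'⟩ := hKc.exists_isMinOn h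
        (f := fun p => ‖q p.1 - q p.2‖) (by fun_prop)
      exact ⟨_, hpos p hp, fun p' h' => hp' h'⟩
  refine ⟨ε, hε, fun s t hst => ?_⟩
  have hfl : ∀ x : ℝ, x - ⌊x / ℓ⌋ * ℓ ∈ Set.Icc 0 ℓ := by
    intro x
    have h1 := Int.floor_le (x / ℓ)
    have h2 := Int.lt_floor_add_one (x / ℓ)
    rw [le_div_iff₀ hℓ] at h1
    rw [div_lt_iff₀ hℓ] at h2
    constructor <;> linarith
  set j := ⌊s / ℓ⌋
  set k := ⌊t / ℓ⌋
  have hn : (s - j * ℓ, t - k * ℓ) ∉ K := by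
    intro h
    have := hε' _ h
    simp only [hper.sub_int_mul_eq] at this
    linarith
  by_contra! hcon
  refine hn ⟨⟨hfl s, hfl t⟩, ?_, ?_, ?_⟩
  · exact (hcon (j - k)).trans_eq (congrArg _ (by push_cast; ring))
  · exact (hcon (j - k + 1)).trans_eq (congrArg _ (by push_cast; ring))
  · exact (hcon (j - k - 1)).trans_eq (congrArg _ (by push_cast; ring))

theorem eqOn_sub_int_mul {Q : ℂ → ℂ} {ρ ℓ : ℝ} (hρ : 0 < ρ)
    (hQ : DifferentiableOn ℂ Q {z | |z.im| < ρ})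
    (hper : ∀ s : ℝ, Q ((s + ℓ : ℝ) : ℂ) = Q s) (k : ℤ) {z : ℂ} (hz : |z.im| < ρ) :
    Q (z - ((k * ℓ : ℝ) : ℂ)) = Q z := by
  have hp : Function.Periodic (fun s : ℝ => Q s) ℓ := hper
  refine eqOn_of_eqOn_real (F := fun z => Q (z - ((k * ℓ : ℝ) : ℂ))) (G := Q) (a := 0)
    (isOpen_strip ρ) (convex_strip ρ).isPreconnected (hQ.comp (by fun_prop) ?_) hQ (by simpa using hρ)
    (fun t _ => ?_) hz
  · intro z hz
    simpa using hz
  · simpa only [Complex.ofReal_sub] using hp.sub_int_mul_eq k (x := t)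

theorem exists_norm_deriv_sub_le {Q : ℂ → ℂ} {ρ ℓ : ℝ} (hρ : 0 < ρ) (hℓ : 0 < ℓ)
    (hQ : DifferentiableOn ℂ Q {z | |z.im| < ρ})
    (hper : ∀ s : ℝ, Q ((s + ℓ : ℝ) : ℂ) = Q s) :
    ∃ δ > 0, δ ≤ ρ ∧ ∀ s : ℝ, ∀ z ∈ Metric.ball (s : ℂ) δ, ‖deriv Q z - deriv Q s‖ ≤ 1 / 2 := by
  have hd : ContinuousOn (deriv Q) {z | |z.im| < ρ} := (hQ.deriv (isOpen_strip ρ)).continuousOn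
  have hcpt : IsCompact (Complex.ofReal '' Set.Icc 0 ℓ) :=
    isCompact_Icc.image Complex.continuous_ofReal
  obtain ⟨δ, hδ, hδ'⟩ := lebesgue_number_lemma_of_metric
    (c := fun x : ℝ => {z | |z.im| < ρ} ∩ deriv Q ⁻¹' Metric.ball (deriv Q x) (1 / 4)) hcpt
    (fun _ => hd.isOpen_inter_preimage (isOpen_strip ρ) Metric.isOpen_ball)
    (by
      rintro _ ⟨x, -, rfl⟩
      exact Set.mem_iUnion.2 ⟨x, by simpa using hρ, by simp⟩)
  refine ⟨min δ ρ, lt_min hδ hρ, min_le_right _ _, fun s z hz => ?_⟩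
  have hder : ∀ k : ℤ, ∀ z : ℂ, |z.im| < ρ → deriv Q (z - ((k * ℓ : ℝ) : ℂ)) = deriv Q z := by
    intro k z hz
    rw [← deriv_comp_sub_const]
    refine Filter.EventuallyEq.deriv_eq ?_
    filter_upwards [(isOpen_strip ρ).mem_nhds hz] with w hw
    exact eqOn_sub_int_mul hρ hQ hper k hw
  set k := ⌊s / ℓ⌋ with hk
  have h0 : s - k * ℓ ∈ Set.Icc 0 ℓ := by
    have h1 := Int.floor_le (s / ℓ)
    have h2 := Int.lt_floor_add_one (s / ℓ)
    rw [le_div_iff₀ hℓ] at h1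
    rw [div_lt_iff₀ hℓ] at h2
    constructor <;> linarith
  obtain ⟨i, hi⟩ := hδ' _ ⟨_, h0, rfl⟩
  rw [mem_ball_iff_norm, lt_min_iff] at hz
  have hzim : |z.im| < ρ := by
    refine lt_of_le_of_lt ?_ hz.2
    simpa using Complex.abs_im_le_norm (z - s)
  have h1 := hi (a := z - ((k * ℓ : ℝ) : ℂ)) (by
    rw [mem_ball_iff_norm, show z - ((k * ℓ : ℝ) : ℂ) - ((s - k * ℓ : ℝ) : ℂ) = z - s by
      push_cast; ring]
    exact hz.1)
  have h2 := hi (Metric.mem_ball_self hδ)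
  have h1' := h1.2
  have h2' := h2.2
  rw [Set.mem_preimage, hder k z hzim] at h1'
  rw [Set.mem_preimage, Complex.ofReal_sub, hder k s (by simpa using hρ)] at h2'
  rw [← dist_eq_norm]
  have := dist_triangle_right (deriv Q z) (deriv Q s) (deriv Q i)
  have h3 := Metric.mem_ball.1 h1'
  have h4 := Metric.mem_ball.1 h2'
  linarith

theorem norm_sub_le_of_deriv_close {Q : ℂ → ℂ} {c z w : ℂ} {δ : ℝ}
    (hQ : DifferentiableOn ℂ Q (Metric.ball c δ)) (hunit : ‖deriv Q c‖ = 1)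
    (hc : ∀ z ∈ Metric.ball c δ, ‖deriv Q z - deriv Q c‖ ≤ 1 / 2)
    (hz : z ∈ Metric.ball c δ) (hw : w ∈ Metric.ball c δ) : ‖z - w‖ / 2 ≤ ‖Q z - Q w‖ := by
  have hda : ∀ z ∈ Metric.ball c δ, HasDerivAt (fun z => Q z - deriv Q c * z)
      (deriv Q z - deriv Q c) z := by
    intro z hz
    have h1 := (hQ.differentiableAt (Metric.isOpen_ball.mem_nhds hz)).hasDerivAt
    exact (h1.sub ((hasDerivAt_id z).const_mul (deriv Q c))).congr_deriv (by ring)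
  have h := (convex_ball c δ).norm_image_sub_le_of_norm_hasDerivWithin_le
    (f := fun z => Q z - deriv Q c * z) (fun z hz => (hda z hz).hasDerivWithinAt) hc hw hz
  have h2 : ‖deriv Q c * (z - w)‖ = ‖z - w‖ := by rw [norm_mul, hunit, one_mul]
  have h3 : deriv Q c * (z - w) = (Q z - Q w) - (Q z - deriv Q c * z - (Q w - deriv Q c * w)) := by
    ring
  have h4 := norm_sub_le (Q z - Q w) (Q z - deriv Q c * z - (Q w - deriv Q c * w))
  rw [← h3, h2] at h4
  linarith

theorem ball_subset_image_of_deriv_close {Q : ℂ → ℂ} {c : ℂ} {δ r : ℝ}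
    (hQ : DifferentiableOn ℂ Q (Metric.ball c δ)) (hunit : ‖deriv Q c‖ = 1)
    (hc : ∀ z ∈ Metric.ball c δ, ‖deriv Q z - deriv Q c‖ ≤ 1 / 2) (hr : 0 < r) (hrδ : r < δ) :
    Metric.ball (Q c) (r / 4) ⊆ Q '' Metric.closedBall c r := by
  have h0 : c ∈ Metric.ball c δ := Metric.mem_ball_self (hr.trans hrδ)
  have h := DiffContOnCl.ball_subset_image_closedBall (f := Q) (z₀ := c) (r := r) (ε := r / 2)
    ((hQ.mono (by
      exact closure_minimal (Metric.ball_subset_closedBall.trans subset_rfl)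
        Metric.isClosed_closedBall |>.trans
        (Metric.closedBall_subset_ball hrδ))).diffContOnCl) hr (fun z hz => ?_) ?_
  · convert h using 2; ring
  · have hz' : z ∈ Metric.ball c δ := by
      rw [Metric.mem_ball, Metric.mem_sphere.1 hz]; exact hrδ
    have := norm_sub_le_of_deriv_close hQ hunit hc hz' h0
    rwa [mem_sphere_iff_norm.1 hz] at this
  · have h1 : ∀ᶠ z in nhdsWithin c {c}ᶜ, Q z ≠ Q c := by
      filter_upwards [self_mem_nhdsWithin,
        mem_nhdsWithin_of_mem_nhds (Metric.isOpen_ball.mem_nhds h0)] with z hz hz' h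
      have := norm_sub_le_of_deriv_close hQ hunit hc hz' h0
      rw [h, sub_self, norm_zero] at this
      have h5 : 0 < ‖z - c‖ := norm_pos_iff.2 (sub_ne_zero.2 hz)
      linarith
    exact h1.frequently.filter_mono nhdsWithin_le_nhds

theorem subset_or_disjoint_of_preconnected {X : Type*} [TopologicalSpace X] {S Ω : Set X}
    (hΩ : IsOpen Ω) (hS : IsPreconnected S) (h : Disjoint S (frontier Ω)) :
    S ⊆ Ω ∨ Disjoint S Ω := by
  have hcl : Disjoint Ω (closure Ω)ᶜ :=
    Set.disjoint_compl_right_iff_subset.2 subset_closure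
  refine (hS.subset_or_subset hΩ isClosed_closure.isOpen_compl hcl fun x hx => ?_).imp_right
    fun h2 => (hcl.mono_right h2).symm
  by_contra hcon
  rw [Set.mem_union, not_or, Set.mem_compl_iff, not_not] at hcon
  exact Set.disjoint_left.1 h hx (hΩ.frontier_eq ▸ ⟨hcon.2, hcon.1⟩)

theorem collarMap_of_ball_subset {Ω : Set ℂ} {Q : ℂ → ℂ} {ℓ δ : ℝ} (hΩ : IsOpen Ω)
    (hℓ : 0 < ℓ) (hδ : 0 < δ) (hd : DifferentiableOn ℂ Q {z | |z.im| < 2 * δ})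
    (hle : ∀ z : ℂ, |z.im| < 2 * δ → ‖deriv Q z‖ ≤ 2) (hunit : ∀ s : ℝ, ‖deriv Q s‖ = 1)
    (hper : ∀ s : ℝ, Q ((s + ℓ : ℝ) : ℂ) = Q s)
    (hrange : Set.range (fun s : ℝ => Q s) = frontier Ω)
    (hball : ∀ s : ℝ, ∀ r, 0 < r → r ≤ δ →
      Metric.ball (Q s) (r / 4) ⊆ Q '' Metric.closedBall (s : ℂ) r)
    (hup : ∀ z : ℂ, 0 < z.im → z.im < 2 * δ → Q z ∈ Ω)
    (hlow : ∀ z : ℂ, 0 < -z.im → -z.im < 2 * δ → Q z ∉ Ω) : CollarMap Ω Q ℓ δ := by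
  refine ⟨hℓ, hδ, hd, hle, hunit, hper, hrange, hup, fun x hx r hr hrδ hdist => ?_⟩
  obtain ⟨y, hy, hxy⟩ := (Metric.infDist_lt_iff (by rw [← hrange]; exact ⟨_, 0, rfl⟩)).1 hdist
  rw [← hrange] at hy
  obtain ⟨s, rfl⟩ := hy
  obtain ⟨z, hz, hzx⟩ := hball s r hr hrδ hxy
  rw [mem_closedBall_iff_norm] at hz
  have hzim : |z.im| ≤ r := by
    refine le_trans ?_ hz
    simpa using Complex.abs_im_le_norm (z - s)
  obtain ⟨h1, h2⟩ := abs_le.1 hzim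
  refine ⟨z, ?_, h2, hzx⟩
  rcases lt_trichotomy z.im 0 with h | h | h
  · exact absurd (hzx ▸ hx) (hlow z (by linarith) (by linarith))
  · have hz' : z = (z.re : ℂ) := Complex.ext rfl h
    have : x ∈ frontier Ω := by rw [← hrange, ← hzx, hz']; exact ⟨_, rfl⟩
    rw [hΩ.frontier_eq] at this
    exact absurd hx this.2
  · exact h

/-- A bounded open set whose boundary is a real-analytic closed curve has a holomorphic collar. -/
theorem exists_collarMap {Ω : Set ℂ} (hΩ : IsOpen Ω) (hb : Bornology.IsBounded Ω)
    (hne : Ω.Nonempty) {q : ℝ → ℂ} (hq : ∀ t, AnalyticAt ℝ q t) {ℓ : ℝ} (hℓ : 0 < ℓ)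
    (hper : Function.Periodic q ℓ) (hinj : Set.InjOn q (Set.Ico 0 ℓ))
    (hunit : ∀ s, ‖deriv q s‖ = 1) (hrange : Set.range q = frontier Ω) :
    ∃ Q δ, CollarMap Ω Q ℓ δ ∧ ((∀ s : ℝ, Q s = q s) ∨ ∀ s : ℝ, Q s = q (-s)) := by
  obtain ⟨ρ, hρ, Q, hQ, hQq⟩ := exists_periodic_extension hq hℓ hper
  have hQper : ∀ s : ℝ, Q ((s + ℓ : ℝ) : ℂ) = Q s := fun s => by rw [hQq, hQq, hper]
  obtain ⟨δ₀, hδ₀, hδρ, hclose⟩ := exists_norm_deriv_sub_le hρ hℓ hQ hQper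
  have hunit' : ∀ s : ℝ, ‖deriv Q s‖ = 1 := by
    intro s
    have h1 := (hQ.differentiableAt ((isOpen_strip ρ).mem_nhds
      (show |((s : ℝ) : ℂ).im| < ρ by simpa using hρ))).hasDerivAt.comp_ofReal
    simp only [hQq] at h1
    rw [← h1.deriv]
    exact hunit s
  have hqc : Continuous q := continuous_iff_continuousAt.2 fun t => (hq t).continuousAt
  obtain ⟨ε, hε, hsep⟩ := exists_lt_of_norm_sub_lt hqc hℓ hper hinj hδ₀
  have hqk : ∀ (t : ℝ) (k : ℤ), q (t + k * ℓ) = q t := fun t k => by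
    have := hper.sub_int_mul_eq (-k) (x := t)
    push_cast at this
    rwa [neg_mul, sub_neg_eq_add] at this
  have hdball : ∀ s : ℝ, DifferentiableOn ℂ Q (Metric.ball (s : ℂ) δ₀) := fun s =>
    hQ.mono fun z hz => by
      rw [mem_ball_iff_norm] at hz
      refine lt_of_le_of_lt ?_ (hz.trans_le hδρ)
      simpa using Complex.abs_im_le_norm (z - s)
  have hre : ∀ z : ℂ, ‖z - z.re‖ = |z.im| := by
    intro z
    have : z - z.re = z.im * Complex.I := by
      apply Complex.ext <;> simp
    rw [this]; simp
  have hle : ∀ z : ℂ, |z.im| < δ₀ → ‖deriv Q z‖ ≤ 2 := by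
    intro z hz
    have h1 := hclose z.re z (by rwa [mem_ball_iff_norm, hre])
    have h2 := norm_le_norm_add_norm_sub' (deriv Q z) (deriv Q z.re)
    rw [hunit'] at h2
    linarith
  have hup : ∀ z : ℂ, |z.im| < δ₀ → ‖Q z - Q z.re‖ ≤ 2 * |z.im| := by
    intro z hz
    have := (convex_strip δ₀).norm_image_sub_le_of_norm_deriv_le (f := Q) (C := 2) (𝕜 := ℂ)
      (x := z.re) (y := z)
      (fun w hw => hQ.differentiableAt ((isOpen_strip ρ).mem_nhds (lt_of_lt_of_le hw hδρ)))
      (fun w hw => hle w hw) (show |((z.re : ℝ) : ℂ).im| < δ₀ by simpa using hδ₀) hz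
    rwa [hre] at this
  set δ := min (δ₀ / 4) (ε / 8) with hδdef
  have hδ : 0 < δ := by positivity
  have hδ1 : 2 * δ < δ₀ := by
    have := min_le_left (δ₀ / 4) (ε / 8); linarith
  have hδ2 : 2 * (2 * δ) < ε := by
    have := min_le_right (δ₀ / 4) (ε / 8); linarith
  have hnot : ∀ z : ℂ, z.im ≠ 0 → |z.im| < 2 * δ → Q z ∉ frontier Ω := by
    intro z hz0 hz hmem
    rw [← hrange] at hmem
    obtain ⟨t, ht⟩ := hmem
    have h1 := hup z (hz.trans hδ1)
    have h2 : ‖q z.re - q t‖ < ε := by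
      rw [ht, ← hQq, norm_sub_rev]; linarith
    obtain ⟨k, hk⟩ := hsep _ _ h2
    have h3 := norm_sub_le_of_deriv_close (hdball z.re) (hunit' _) (hclose _) (z := z)
      (w := ((t + k * ℓ : ℝ) : ℂ)) (by rw [mem_ball_iff_norm, hre]; exact hz.trans hδ1) (by
        rw [mem_ball_iff_norm, ← Complex.ofReal_sub, Complex.norm_real, Real.norm_eq_abs,
          abs_sub_comm]
        convert hk using 2; ring)
    rw [hQq, hqk, ht, sub_self, norm_zero] at h3
    have h4 : z - ((t + k * ℓ : ℝ) : ℂ) = 0 := by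
      rw [← norm_le_zero_iff]; linarith
    apply hz0
    rw [sub_eq_zero.1 h4]; simp
  have hball : ∀ s : ℝ, ∀ r, 0 < r → r ≤ δ →
      Metric.ball (Q s) (r / 4) ⊆ Q '' Metric.closedBall (s : ℂ) r := fun s r hr hrδ =>
    ball_subset_image_of_deriv_close (hdball s) (hunit' s) (hclose s) hr (by linarith)
  have hdQ : DifferentiableOn ℂ Q {z | |z.im| < 2 * δ} :=
    hQ.mono fun z hz => (lt_of_lt_of_le (lt_trans hz hδ1) hδρ)
  have hrQ : Set.range (fun s : ℝ => Q s) = frontier Ω := by simp only [hQq]; exact hrange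
  have hU : ∀ (a : ℝ), a = 1 ∨ a = -1 → Q '' {z | 0 < a * z.im ∧ a * z.im < 2 * δ} ⊆ Ω ∨
      Disjoint (Q '' {z | 0 < a * z.im ∧ a * z.im < 2 * δ}) Ω := by
    intro a ha
    have habs : ∀ z : ℂ, 0 < a * z.im → a * z.im < 2 * δ → z.im ≠ 0 ∧ |z.im| < 2 * δ := by
      intro z h1 h2
      have h3 : |a * z.im| = |z.im| := by
        rw [abs_mul]; rcases ha with rfl | rfl <;> simp
      rw [abs_of_pos h1] at h3
      exact ⟨fun h => by simp [h] at h1, by rwa [← h3]⟩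
    refine subset_or_disjoint_of_preconnected hΩ ?_ ?_
    · have hconv : Convex ℝ {z : ℂ | 0 < a * z.im ∧ a * z.im < 2 * δ} := by
        have : {z : ℂ | 0 < a * z.im ∧ a * z.im < 2 * δ} =
            (a • Complex.imLm) ⁻¹' Set.Ioo 0 (2 * δ) := by
          ext z; simp
        rw [this]
        exact (convex_Ioo _ _).linear_preimage _
      exact hconv.isPreconnected.image _
        (hdQ.continuousOn.mono fun z hz => (habs z hz.1 hz.2).2)
    · rw [Set.disjoint_left]
      rintro _ ⟨z, hz, rfl⟩
      exact hnot z (habs z hz.1 hz.2).1 (habs z hz.1 hz.2).2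
  have him : ∀ s : ℝ, ∀ z ∈ Metric.closedBall (s : ℂ) δ, |z.im| ≤ δ := by
    intro s z hz
    rw [mem_closedBall_iff_norm] at hz
    refine le_trans ?_ hz
    simpa using Complex.abs_im_le_norm (z - s)
  have hu := hU 1 (Or.inl rfl)
  have hl := hU (-1) (Or.inr rfl)
  simp only [one_mul, neg_one_mul] at hu hl
  rcases hu with hu | hu <;> rcases hl with hl | hl
  · exfalso
    have hopen : IsOpen (closure Ω) := by
      rw [isOpen_iff_mem_nhds]
      intro x hx
      rw [closure_eq_self_union_frontier] at hx
      rcases hx with hx | hx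
      · exact Filter.mem_of_superset (hΩ.mem_nhds hx) subset_closure
      · rw [← hrQ] at hx
        obtain ⟨s, rfl⟩ := hx
        refine Filter.mem_of_superset (Metric.ball_mem_nhds _ (by positivity))
          ((hball s δ hδ le_rfl).trans ?_)
        rintro _ ⟨z, hz, rfl⟩
        obtain ⟨h1, h2⟩ := abs_le.1 (him s z hz)
        rcases lt_trichotomy z.im 0 with h | h | h
        · exact subset_closure (hl ⟨z, ⟨by linarith, by linarith⟩, rfl⟩)
        · have hz' : z = (z.re : ℂ) := Complex.ext rfl h
          rw [hz']
          exact frontier_subset_closure (hrQ ▸ ⟨_, rfl⟩)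
        · exact subset_closure (hu ⟨z, ⟨by linarith, by linarith⟩, rfl⟩)
    have huniv := IsClopen.eq_univ ⟨isClosed_closure, hopen⟩ hne.closure
    have hc : IsCompact (closure Ω) := hb.isCompact_closure
    rw [huniv] at hc
    exact noncompact_univ ℂ hc
  · refine ⟨Q, δ, collarMap_of_ball_subset hΩ hℓ hδ hdQ (fun z hz => hle z (hz.trans hδ1)) hunit'
      hQper hrQ hball (fun z h1 h2 => hu ⟨z, ⟨h1, h2⟩, rfl⟩) (fun z h1 h2 h3 => ?_), Or.inl hQq⟩
    exact Set.disjoint_left.1 hl ⟨z, ⟨h1, h2⟩, rfl⟩ h3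
  · have hdn : ∀ z : ℂ, deriv (fun w => Q (-w)) z = -deriv Q (-z) := fun z => deriv_comp_neg Q z
    refine ⟨fun z => Q (-z), δ, collarMap_of_ball_subset hΩ hℓ hδ ?_ ?_ ?_ ?_ ?_ ?_ ?_ ?_,
      Or.inr fun s => ?_⟩
    · exact hdQ.comp (by fun_prop) fun z hz => by simpa using hz
    · intro z hz
      rw [hdn, norm_neg]
      exact hle _ (by simpa using hz.trans hδ1)
    · intro s
      rw [hdn, norm_neg, ← Complex.ofReal_neg]
      exact hunit' _
    · intro s
      rw [← Complex.ofReal_neg, ← Complex.ofReal_neg, ← hQper (-(s + ℓ)),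
        show -(s + ℓ) + ℓ = -s by ring]
    · rw [← hrQ]
      ext x
      constructor
      · rintro ⟨s, rfl⟩
        exact ⟨-s, by simp⟩
      · rintro ⟨s, rfl⟩
        exact ⟨-s, by simp⟩
    · intro s r hr hrδ
      have := hball (-s) r hr hrδ
      rw [← Complex.ofReal_neg]
      refine this.trans ?_
      rintro _ ⟨z, hz, rfl⟩
      refine ⟨-z, ?_, by simp⟩
      rw [mem_closedBall_iff_norm] at hz ⊢
      rwa [← norm_neg, show -(-z - (s : ℂ)) = z - ((-s : ℝ) : ℂ) by push_cast; ring]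
    · exact fun z h1 h2 => hl ⟨-z, ⟨by simpa using h1, by simpa using h2⟩, rfl⟩
    · intro z h1 h2 h3
      exact Set.disjoint_left.1 hu ⟨-z, ⟨by simpa using h1, by simpa using h2⟩, rfl⟩ h3
    · simp only
      rw [← Complex.ofReal_neg, hQq]
  · exfalso
    have h0 : Q ((0 : ℝ) : ℂ) ∈ closure Ω := frontier_subset_closure (hrQ ▸ ⟨_, rfl⟩)
    obtain ⟨x, hx, hx'⟩ := Metric.mem_closure_iff.1 h0 (δ / 4) (by positivity)
    obtain ⟨z, hz, rfl⟩ := hball 0 δ hδ le_rfl (show x ∈ Metric.ball _ _ by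
      rw [Metric.mem_ball, dist_comm]; exact hx')
    obtain ⟨h1, h2⟩ := abs_le.1 (him 0 z hz)
    rcases lt_trichotomy z.im 0 with h | h | h
    · exact Set.disjoint_left.1 hl ⟨z, ⟨by linarith, by linarith⟩, rfl⟩ hx
    · have hz' : z = (z.re : ℂ) := Complex.ext rfl h
      have : Q z ∈ frontier Ω := by rw [hz']; exact hrQ ▸ ⟨_, rfl⟩
      rw [hΩ.frontier_eq] at this
      exact this.2 hx
    · exact Set.disjoint_left.1 hu ⟨z, ⟨by linarith, by linarith⟩, rfl⟩ hx

theorem card_zeros_le_of_norm_le_on_disc {g : ℂ → ℂ} {r R K : ℝ} (hr : 0 < r) (hrR : r < R)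
    (hg : AnalyticOnNhd ℂ g (Metric.closedBall 0 R)) (hg0 : g 0 ≠ 0) (hK : 1 ≤ K)
    (hbound : ∀ z ∈ Metric.closedBall (0 : ℂ) R, ‖g z‖ ≤ K * ‖g 0‖)
    (Z : Finset ℂ) (hZ : ∀ a ∈ Z, ‖a‖ ≤ r ∧ g a = 0) :
    (Z.card : ℝ) ≤ Real.log K / Real.log (R / r) := by
  have hR : 0 < R := hr.trans hrR
  have hn0 : 0 < ‖g 0‖ := norm_pos_iff.2 hg0
  set h : ℂ → ℂ := fun z => (g 0)⁻¹ * g z with hh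
  have hh0 : h 0 = 1 := inv_mul_cancel₀ hg0
  have han : AnalyticOnNhd ℂ h (Metric.closedBall 0 R) := fun z hz =>
    analyticAt_const.mul (hg z hz)
  have hJ := AnalyticOnNhd.sum_divisor_le (c := 0) (r := r) (R := R) (M := K) (f := h)
    (by positivity) (by rwa [abs_of_pos hr, abs_of_pos hR]) hK (by rwa [abs_of_pos hR])
    (by rw [hh0]; exact one_ne_zero) (by
      intro z hz
      rw [abs_of_pos hR] at hz
      have := hbound z (Metric.sphere_subset_closedBall hz)
      simp only [hh, norm_mul, norm_inv]
      rw [inv_mul_le_iff₀ hn0]; linarith)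
  rw [hh0, norm_one, div_one] at hJ
  refine le_trans ?_ hJ
  rw [abs_of_pos hr]
  have hanr : AnalyticOnNhd ℂ h (Metric.closedBall 0 r) :=
    han.mono (Metric.closedBall_subset_closedBall hrR.le)
  set D := MeromorphicOn.divisor h (Metric.closedBall 0 r) with hD
  have hfin : (Function.support D).Finite := D.finiteSupport (isCompact_closedBall ..)
  have hone : ∀ a ∈ Z, 1 ≤ D a := by
    intro a ha
    have hmem : a ∈ Metric.closedBall (0 : ℂ) r := by simpa using (hZ a ha).1
    have hord : analyticOrderAt h a ≠ ⊤ := by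
      intro htop
      have hev := analyticOrderAt_eq_top.1 htop
      have := hanr.eqOn_zero_of_preconnected_of_eventuallyEq_zero
        (convex_closedBall (0 : ℂ) r).isPreconnected hmem hev
      have h0 := this (show (0 : ℂ) ∈ Metric.closedBall (0 : ℂ) r by simp [hr.le])
      rw [hh0] at h0
      exact one_ne_zero h0
    rw [hD, MeromorphicOn.AnalyticOnNhd.divisor_apply hanr hmem]
    have hne : analyticOrderAt h a ≠ 0 := by
      rw [(hanr a hmem).analyticOrderAt_ne_zero]
      simp [hh, (hZ a ha).2]
    obtain ⟨n, hn⟩ := ENat.ne_top_iff_exists.1 hord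
    rw [← hn] at hne
    have : n ≠ 0 := by exact_mod_cast hne
    simp [← hn]
    omega
  rw [finsum_eq_sum _ hfin]
  have hsub : Z ⊆ hfin.toFinset := by
    intro a ha
    simp only [Set.Finite.mem_toFinset, Function.mem_support]
    have := hone a ha
    omega
  have h1 : (Z.card : ℤ) ≤ ∑ a ∈ hfin.toFinset, D a := by
    calc (Z.card : ℤ) = ∑ a ∈ Z, 1 := by simp
      _ ≤ ∑ a ∈ Z, D a := Finset.sum_le_sum hone
      _ ≤ ∑ a ∈ hfin.toFinset, D a := by
        refine Finset.sum_le_sum_of_subset_of_nonneg hsub fun a _ _ => ?_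
        exact MeromorphicOn.AnalyticOnNhd.divisor_nonneg hanr a
  exact_mod_cast h1

theorem exists_card_real_zeros_le_log {δ ℓ : ℝ} (hδ : 0 < δ) (hℓ : 0 < ℓ) :
    ∃ c > 0, ∀ (F : ℂ → ℂ) (s₀ K : ℝ), DifferentiableOn ℂ F {z | |z.im| < δ} → F s₀ ≠ 0 → 1 ≤ K →
      (∀ z : ℂ, |z.im| < δ → ‖F z‖ ≤ K * ‖F s₀‖) →
      ∀ Z : Finset ℝ, (∀ a ∈ Z, |a - s₀| ≤ ℓ ∧ F a = 0) → (Z.card : ℝ) ≤ c * Real.log K := by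
  set L := 4 * ℓ / δ with hL
  have hLpos : 0 < L := by positivity
  have hE : 1 < Real.exp L := Real.one_lt_exp_iff.2 hLpos
  set w : ℝ → ℝ := fun t => (Real.exp t - 1) / (Real.exp t + 1) with hw
  have hwmono : Monotone w := by
    intro a b hab
    have := Real.exp_le_exp.2 hab
    simp only [hw]
    rw [div_le_div_iff₀ (by positivity) (by positivity)]
    nlinarith
  have hwneg : ∀ t, w (-t) = - w t := by
    intro t
    have := Real.exp_pos t
    simp only [hw, Real.exp_neg]
    field_simp
    ring
  set r := w L with hr
  have hr0 : 0 < r := div_pos (by linarith) (by positivity)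
  have hr1 : r < 1 := by
    rw [hr, hw]; simp only
    rw [div_lt_one (by positivity)]; linarith
  set R := (1 + r) / 2 with hRdef
  have hrR : r < R := by rw [hRdef]; linarith
  have hR1 : R < 1 := by rw [hRdef]; linarith
  have hlog : 0 < Real.log (R / r) := Real.log_pos ((one_lt_div hr0).2 hrR)
  refine ⟨1 / Real.log (R / r), by positivity, ?_⟩
  intro F s₀ K hF hF0 hK hbd Z hZ
  set T : ℂ → ℂ := fun w => s₀ + (δ / 4 : ℝ) * (Complex.log (1 + w) - Complex.log (1 - w)) with hT
  have hre : ∀ z : ℂ, ‖z‖ < 1 → 0 < (1 + z).re ∧ 0 < (1 - z).re := by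
    intro z hz
    have := abs_le.1 (Complex.abs_re_le_norm z)
    constructor <;> simp <;> linarith
  have hTim : ∀ z : ℂ, ‖z‖ < 1 → |(T z).im| < δ := by
    intro z hz
    obtain ⟨h1, h2⟩ := hre z hz
    have a1 := abs_lt.1 (Complex.abs_arg_lt_pi_div_two_iff.2 (Or.inl h1))
    have a2 := abs_lt.1 (Complex.abs_arg_lt_pi_div_two_iff.2 (Or.inl h2))
    have him : (T z).im = δ / 4 * ((1 + z).arg - (1 - z).arg) := by
      simp only [hT, Complex.add_im, Complex.ofReal_im, zero_add, Complex.im_ofReal_mul,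
        Complex.sub_im, Complex.log_im]
    rw [him, abs_mul, abs_of_pos (by positivity : 0 < δ / 4)]
    have hab : |(1 + z).arg - (1 - z).arg| < π := by rw [abs_lt]; constructor <;> linarith
    have := Real.pi_lt_four
    nlinarith
  have hTd : ∀ z : ℂ, ‖z‖ < 1 → DifferentiableAt ℂ T z := by
    intro z hz
    obtain ⟨h1, h2⟩ := hre z hz
    have s1 : 1 + z ∈ Complex.slitPlane := Or.inl h1
    have s2 : 1 - z ∈ Complex.slitPlane := Or.inl h2
    refine ((DifferentiableAt.sub ?_ ?_).const_mul _).const_add _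
    · exact (differentiableAt_id.const_add 1).clog s1
    · exact (differentiableAt_id.const_sub 1).clog s2
  have hTw : ∀ t : ℝ, T (w t) = ((s₀ + δ / 4 * t : ℝ) : ℂ) := by
    intro t
    have hp := Real.exp_pos t
    have e1 : 1 + w t = Real.exp t * (2 / (Real.exp t + 1)) := by
      simp only [hw]; field_simp; ring
    have e2 : 1 - w t = 2 / (Real.exp t + 1) := by
      simp only [hw]; field_simp; ring
    have c1 : (1 : ℂ) + (w t : ℂ) = ((1 + w t : ℝ) : ℂ) := by push_cast; ring
    have c2 : (1 : ℂ) - (w t : ℂ) = ((1 - w t : ℝ) : ℂ) := by push_cast; ring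
    have p2 : 0 < 2 / (Real.exp t + 1) := by positivity
    simp only [hT]
    rw [c1, c2, ← Complex.ofReal_log (by rw [e1]; positivity),
      ← Complex.ofReal_log (by rw [e2]; positivity), e1, e2,
      Real.log_mul hp.ne' p2.ne', Real.log_exp]
    push_cast; ring
  have hopen : IsOpen {z : ℂ | |z.im| < δ} :=
    isOpen_lt (Complex.continuous_im.abs) continuous_const
  have hg : AnalyticOnNhd ℂ (F ∘ T) (Metric.ball 0 1) := by
    refine DifferentiableOn.analyticOnNhd ?_ Metric.isOpen_ball
    intro z hz
    have hz' : ‖z‖ < 1 := by simpa using hz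
    exact ((hF.differentiableAt (hopen.mem_nhds (hTim z hz'))).comp z
      (hTd z hz')).differentiableWithinAt
  have hT0 : T 0 = s₀ := by simp [hT]
  have key := card_zeros_le_of_norm_le_on_disc (g := F ∘ T) hr0 hrR
    (hg.mono (Metric.closedBall_subset_ball hR1)) (by simpa [hT0] using hF0) hK
    (by
      intro z hz
      have hz' : ‖z‖ < 1 := by
        have : ‖z‖ ≤ R := by simpa using hz
        linarith
      simpa [hT0] using hbd _ (hTim z hz'))
    (Z.image fun a => ((w (4 * (a - s₀) / δ) : ℝ) : ℂ)) (by
      intro b hb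
      obtain ⟨a, ha, rfl⟩ := Finset.mem_image.1 hb
      obtain ⟨h1, h2⟩ := hZ a ha
      constructor
      · rw [Complex.norm_real, Real.norm_eq_abs, abs_le]
        obtain ⟨h3, h4⟩ := abs_le.1 h1
        constructor
        · rw [hr, ← hwneg]; apply hwmono
          rw [hL, ← neg_div]; gcongr; linarith
        · apply hwmono; rw [hL]; gcongr
      · simp only [Function.comp_apply, hTw]
        rw [← h2]; congr 2; field_simp; ring)
  rw [Finset.card_image_of_injOn] at key
  · rw [one_div, inv_mul_eq_div]; exact key
  · intro a _ b _ hab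
    have hab' := congrArg T hab
    simp only [hTw] at hab'
    have := Complex.ofReal_injective hab'
    field_simp at this
    linarith

/-- The cutoff function of a set, equal to `1` at distance at least `2ε` from the complement. -/
def distCutoff (Ω : Set ℂ) (ε : ℝ) (z : ℂ) : ℝ :=
  max 0 (min 1 (ε⁻¹ * Metric.infDist z Ωᶜ - 1))

theorem lipschitzWith_distCutoff (Ω : Set ℂ) {ε : ℝ} (hε : 0 < ε) :
    LipschitzWith (Real.toNNReal ε⁻¹) (distCutoff Ω ε) := by
  refine LipschitzWith.const_max (LipschitzWith.const_min ?_ 1) 0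
  refine LipschitzWith.of_dist_le_mul fun x y => ?_
  have h := (Metric.lipschitz_infDist_pt Ωᶜ).dist_le_mul x y
  rw [NNReal.coe_one, one_mul, Real.dist_eq] at h
  rw [Real.dist_eq, Real.coe_toNNReal _ (by positivity),
    show ε⁻¹ * Metric.infDist x Ωᶜ - 1 - (ε⁻¹ * Metric.infDist y Ωᶜ - 1) =
      ε⁻¹ * (Metric.infDist x Ωᶜ - Metric.infDist y Ωᶜ) by ring, abs_mul,
    abs_of_pos (by positivity : 0 < ε⁻¹)]
  gcongr

theorem distCutoff_nonneg (Ω : Set ℂ) (ε : ℝ) (z : ℂ) : 0 ≤ distCutoff Ω ε z := le_max_left _ _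

theorem distCutoff_eq_zero {Ω : Set ℂ} {ε : ℝ} (hε : 0 < ε) {z : ℂ}
    (hz : Metric.infDist z Ωᶜ ≤ ε) : distCutoff Ω ε z = 0 := by
  have : ε⁻¹ * Metric.infDist z Ωᶜ ≤ 1 := by
    rw [← div_eq_inv_mul, div_le_one hε]; exact hz
  exact max_eq_left ((min_le_right _ _).trans (by linarith))

theorem distCutoff_eq_one {Ω : Set ℂ} {ε : ℝ} (hε : 0 < ε) {z : ℂ}
    (hz : 2 * ε ≤ Metric.infDist z Ωᶜ) : distCutoff Ω ε z = 1 := by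
  have : 2 ≤ ε⁻¹ * Metric.infDist z Ωᶜ := by
    rw [← div_eq_inv_mul, le_div_iff₀ hε]; exact hz
  rw [distCutoff, min_eq_left (by linarith), max_eq_right zero_le_one]

theorem lineDeriv_distCutoff_eq_zero {Ω : Set ℂ} {ε : ℝ} (hε : 0 < ε) {z v : ℂ}
    (hz : z ∉ {z ∈ Ω | Metric.infDist z Ωᶜ ≤ 2 * ε}) : lineDeriv ℝ (distCutoff Ω ε) z v = 0 := by
  have hc : Continuous fun z => Metric.infDist z Ωᶜ := Metric.continuous_infDist_pt _
  have hconst : ∀ c : ℝ, lineDeriv ℝ (fun _ : ℂ => c) z v = 0 := fun c => by simp [lineDeriv]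
  by_cases h : z ∈ Ω
  · have h1 : 2 * ε < Metric.infDist z Ωᶜ := by
      by_contra! h2
      exact hz ⟨h, h2⟩
    rw [← hconst 1]
    refine Filter.EventuallyEq.lineDeriv_eq ?_
    filter_upwards [(isOpen_lt continuous_const hc).mem_nhds h1] with w hw
    exact distCutoff_eq_one hε (le_of_lt hw)
  · have h1 : Metric.infDist z Ωᶜ < ε := by rwa [Metric.infDist_zero_of_mem h]
    rw [← hconst 0]
    refine Filter.EventuallyEq.lineDeriv_eq ?_
    filter_upwards [(isOpen_lt hc continuous_const).mem_nhds h1] with w hw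
    exact distCutoff_eq_zero hε (le_of_lt hw)

theorem abs_integral_distCutoff_mul_pd_le {Ω : Set ℂ} {ε : ℝ} (hε : 0 < ε)
    (hb : Bornology.IsBounded Ω)
    {G : ℂ → ℝ} (hG : ContDiff ℝ 1 G) (hGc : HasCompactSupport G) {v : ℂ} (hv : ‖v‖ = 1) {K A : ℝ}
    (hK : ∀ z ∈ Ω, Metric.infDist z Ωᶜ ≤ 2 * ε → |G z| ≤ K) (hK0 : 0 ≤ K)
    (hA : volume.real {z ∈ Ω | Metric.infDist z Ωᶜ ≤ 2 * ε} ≤ A * ε) :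
    |∫ z, distCutoff Ω ε z * pd v G z| ≤ A * K := by
  set S := {z ∈ Ω | Metric.infDist z Ωᶜ ≤ 2 * ε} with hS
  obtain ⟨D, hD⟩ := hG.lipschitzWith_of_hasCompactSupport hGc (by simp)
  have h1 := LipschitzWith.integral_lineDeriv_mul_eq (μ := volume) (lipschitzWith_distCutoff Ω hε)
    hD hGc (-v)
  have h2 : ∫ z, distCutoff Ω ε z * pd v G z =
      ∫ z, lineDeriv ℝ (distCutoff Ω ε) z (-v) * G z := by
    rw [h1, neg_neg]
    refine integral_congr_ae (Filter.Eventually.of_forall fun z => ?_)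
    simp only
    rw [((hG.differentiable (by simp)) z).lineDeriv_eq_fderiv, mul_comm]
    rfl
  rw [h2, ← setIntegral_eq_integral_of_forall_compl_eq_zero (s := S) (fun z hz => by
    rw [lineDeriv_distCutoff_eq_zero hε hz, zero_mul]), ← Real.norm_eq_abs]
  have hfin : volume S < ⊤ := (hb.subset (fun z hz => hz.1)).measure_lt_top
  refine (norm_setIntegral_le_of_norm_le_const hfin (C := ε⁻¹ * K) fun z hz => ?_).trans ?_
  · rw [norm_mul]
    have := norm_lineDeriv_le_of_lipschitz ℝ (lipschitzWith_distCutoff Ω hε) (x₀ := z) (v := -v)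
    rw [norm_neg, hv, mul_one, Real.coe_toNNReal _ (by positivity)] at this
    exact mul_le_mul this (hK z hz.1 hz.2) (norm_nonneg _) (by positivity)
  · calc ε⁻¹ * K * volume.real S ≤ ε⁻¹ * K * (A * ε) := by gcongr
      _ = A * K := by field_simp

/-- A one-sided form of the divergence theorem, with the boundary term estimated by the
Minkowski content of the boundary. -/
theorem setIntegral_divergence_le {Ω : Set ℂ} (hΩ : IsOpen Ω) (hb : Bornology.IsBounded Ω)
    {A : ℝ} (hA : ∀ ε, 0 < ε → ε ≤ 1 →
      volume.real {z ∈ Ω | Metric.infDist z Ωᶜ ≤ 2 * ε} ≤ A * ε)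
    {G H : ℂ → ℝ} (hG : ContDiff ℝ 1 G) (hGc : HasCompactSupport G)
    (hH : ContDiff ℝ 1 H) (hHc : HasCompactSupport H) {K : ℝ} (hK0 : 0 ≤ K)
    (hGK : ∀ z ∈ frontier Ω, |G z| ≤ K) (hHK : ∀ z ∈ frontier Ω, |H z| ≤ K)
    (hpos : ∀ z ∈ Ω, 0 ≤ pd 1 G z + pd Complex.I H z) {T : Set ℂ} (hT : IsCompact T)
    (hTΩ : T ⊆ Ω) : ∫ z in T, (pd 1 G z + pd Complex.I H z) ≤ 2 * A * K := by
  have hA0 : 0 ≤ A := by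
    have := (measureReal_nonneg).trans (hA 1 one_pos le_rfl); linarith
  have huniv : Ω ≠ Set.univ := by
    rintro rfl
    have hc : IsCompact (closure (Set.univ : Set ℂ)) := hb.isCompact_closure
    rw [closure_univ] at hc
    exact noncompact_univ ℂ hc
  have hlay : ∀ η > 0, ∀ F : ℂ → ℝ, Continuous F → HasCompactSupport F →
      (∀ z ∈ frontier Ω, |F z| ≤ K) →
      ∃ ε₁ > 0, ∀ ε, ε < ε₁ → ∀ z ∈ Ω, Metric.infDist z Ωᶜ ≤ 2 * ε → |F z| ≤ K + η := by
    intro η hη F hF hFc hFK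
    obtain ⟨d, hd, hd'⟩ := Metric.uniformContinuous_iff.1
      (hFc.uniformContinuous_of_continuous hF) η hη
    refine ⟨d / 2, by positivity, fun ε hε z hz hzd => ?_⟩
    obtain ⟨y, hy, hyd⟩ := exists_mem_frontier_infDist_compl_eq_dist hz huniv
    have h1 := hd' (a := z) (b := y) (by rw [← hyd]; linarith)
    rw [Real.dist_eq] at h1
    have h2 := abs_sub_abs_le_abs_sub (F z) (F y)
    linarith [hFK y hy]
  obtain ⟨d, hd, hdT⟩ : ∃ d > 0, ∀ z ∈ T, d ≤ Metric.infDist z Ωᶜ := by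
    rcases T.eq_empty_or_nonempty with rfl | hne
    · exact ⟨1, one_pos, by simp⟩
    · obtain ⟨z, hz, hmin⟩ := hT.exists_isMinOn hne
        (Metric.continuous_infDist_pt Ωᶜ).continuousOn
      refine ⟨_, ?_, fun w hw => hmin hw⟩
      refine (hΩ.isClosed_compl.notMem_iff_infDist_pos (Set.nonempty_compl.2 huniv)).1 ?_
      simpa using hTΩ hz
  have hdc : ∀ F : ℂ → ℝ, ContDiff ℝ 1 F → ∀ v, Continuous (pd v F) := fun F hF v =>
    (hF.continuous_fderiv (by simp)).clm_apply continuous_const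
  refine le_of_forall_pos_le_add fun η hη => ?_
  have hη' : 0 < η / (2 * A + 1) := by positivity
  obtain ⟨ε₁, h1, h1'⟩ := hlay _ hη' G hG.continuous hGc hGK
  obtain ⟨ε₂, h2, h2'⟩ := hlay _ hη' H hH.continuous hHc hHK
  obtain ⟨ε, hε, hεlt⟩ := exists_between (show 0 < min (min ε₁ ε₂) (min 1 (d / 2)) by positivity)
  rw [lt_min_iff, lt_min_iff, lt_min_iff] at hεlt
  obtain ⟨⟨hε1, hε2⟩, hε3, hε4⟩ := hεlt
  have b1 := abs_integral_distCutoff_mul_pd_le hε hb hG hGc (v := 1) (by simp) (h1' ε hε1)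
    (by positivity) (hA ε hε hε3.le)
  have b2 := abs_integral_distCutoff_mul_pd_le hε hb hH hHc (v := Complex.I) (by simp)
    (h2' ε hε2) (by positivity) (hA ε hε hε3.le)
  have hcc : Continuous (distCutoff Ω ε) := (lipschitzWith_distCutoff Ω hε).continuous
  have hint : ∀ F : ℂ → ℝ, ContDiff ℝ 1 F → HasCompactSupport F → ∀ v,
      Integrable (fun z => distCutoff Ω ε z * pd v F z) := fun F hF hFc v =>
    (hcc.mul (hdc F hF v)).integrable_of_hasCompactSupport
      ((hFc.fderiv_apply ℝ v).mul_left)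
  have e1 : ∫ z in T, (pd 1 G z + pd Complex.I H z) =
      ∫ z in T, (distCutoff Ω ε z * pd 1 G z + distCutoff Ω ε z * pd Complex.I H z) := by
    refine setIntegral_congr_fun hT.measurableSet fun z hz => ?_
    rw [distCutoff_eq_one hε (by linarith [hdT z hz]), one_mul, one_mul]
  rw [e1]
  refine (setIntegral_le_integral ((hint G hG hGc 1).fun_add (hint H hH hHc _))
    (Filter.Eventually.of_forall fun z => ?_)).trans ?_
  · simp only [Pi.zero_apply, ← mul_add]
    by_cases hz : z ∈ Ω
    · exact mul_nonneg (distCutoff_nonneg _ _ _) (hpos z hz)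
    · rw [distCutoff_eq_zero hε (by rw [Metric.infDist_zero_of_mem hz]; exact hε.le), zero_mul]
  · rw [integral_add (hint G hG hGc 1) (hint H hH hHc _)]
    have h3 : A * (η / (2 * A + 1)) * 2 ≤ η := by
      rw [← mul_div_assoc, div_mul_eq_mul_div, div_le_iff₀ (by positivity)]
      nlinarith
    have := le_abs_self (∫ z, distCutoff Ω ε z * pd 1 G z)
    have := le_abs_self (∫ z, distCutoff Ω ε z * pd Complex.I H z)
    nlinarith

theorem CollarMap.volume_layer_le {Ω : Set ℂ} {Q : ℂ → ℂ} {ℓ δ : ℝ} (hQ : CollarMap Ω Q ℓ δ)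
    (hb : Bornology.IsBounded Ω) {ε : ℝ} (hε : 0 < ε) (hε1 : ε ≤ 1) :
    volume.real {z ∈ Ω | Metric.infDist z Ωᶜ ≤ 2 * ε} ≤ 25 * π * (ℓ + 1) * ε := by
  have hℓ := hQ.len_pos
  have hδ := hQ.width_pos
  have huniv : Ω ≠ Set.univ := by
    rintro rfl
    have hc : IsCompact (closure (Set.univ : Set ℂ)) := hb.isCompact_closure
    rw [closure_univ] at hc
    exact noncompact_univ ℂ hc
  have hp : Function.Periodic (fun s : ℝ => Q s) ℓ := hQ.periodic
  set N := ⌊ℓ / ε⌋₊ + 1 with hN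
  have hsub : {z ∈ Ω | Metric.infDist z Ωᶜ ≤ 2 * ε} ⊆
      ⋃ j ∈ Finset.range N, Metric.ball (Q ((j * ε : ℝ) : ℂ)) (5 * ε) := by
    rintro z ⟨hz, hzd⟩
    obtain ⟨y, hy, hyd⟩ := exists_mem_frontier_infDist_compl_eq_dist hz huniv
    rw [← hQ.range_eq] at hy
    obtain ⟨s, rfl⟩ := hy
    obtain ⟨s', hs', hss⟩ := hp.exists_mem_Ico₀ hℓ s
    simp only [hss] at hyd
    have h1 := Nat.floor_le (show 0 ≤ s' / ε from div_nonneg hs'.1 hε.le)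
    have h2 := Nat.lt_floor_add_one (s' / ε)
    rw [le_div_iff₀ hε] at h1
    rw [div_lt_iff₀ hε] at h2
    simp only [Set.mem_iUnion]
    refine ⟨⌊s' / ε⌋₊, ?_, ?_⟩
    · rw [Finset.mem_range, hN, Nat.lt_succ_iff]
      exact Nat.floor_mono (by gcongr; exact hs'.2.le)
    · have h3 := (convex_strip (2 * δ)).norm_image_sub_le_of_norm_deriv_le (f := Q) (C := 2)
        (𝕜 := ℂ) (x := ((⌊s' / ε⌋₊ * ε : ℝ) : ℂ)) (y := (s' : ℂ))
        (fun w hw => hQ.differentiableOn.differentiableAt ((isOpen_strip _).mem_nhds hw))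
        (fun w hw => hQ.norm_deriv_le w hw)
        (show |(((⌊s' / ε⌋₊ * ε : ℝ)) : ℂ).im| < 2 * δ by rw [Complex.ofReal_im]; simpa using hδ)
        (show |((s' : ℝ) : ℂ).im| < 2 * δ by simpa using hδ)
      rw [← Complex.ofReal_sub, Complex.norm_real, Real.norm_eq_abs,
        abs_of_nonneg (by linarith), ← dist_eq_norm] at h3
      rw [Metric.mem_ball]
      have := dist_triangle z (Q s') (Q ((⌊s' / ε⌋₊ * ε : ℝ) : ℂ))
      linarith
  have hball : ∀ c : ℂ, volume.real (Metric.ball c (5 * ε)) = 25 * π * ε ^ 2 := by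
    intro c
    rw [measureReal_def, Complex.volume_ball, ENNReal.toReal_mul, ENNReal.toReal_pow,
      ENNReal.toReal_ofReal (by positivity)]
    simp; ring
  have hNle : (N : ℝ) * ε ≤ ℓ + 1 := by
    have := Nat.floor_le (show 0 ≤ ℓ / ε by positivity)
    rw [le_div_iff₀ hε] at this
    rw [hN]; push_cast; linarith
  calc volume.real {z ∈ Ω | Metric.infDist z Ωᶜ ≤ 2 * ε}
      ≤ volume.real (⋃ j ∈ Finset.range N, Metric.ball (Q ((j * ε : ℝ) : ℂ)) (5 * ε)) := by
        refine measureReal_mono hsub ?_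
        refine (measure_biUnion_lt_top (Finset.finite_toSet _) fun j _ => ?_).ne
        exact Metric.isBounded_ball.measure_lt_top
    _ ≤ ∑ j ∈ Finset.range N, volume.real (Metric.ball (Q ((j * ε : ℝ) : ℂ)) (5 * ε)) :=
        measureReal_biUnion_finset_le _ _
    _ = 25 * π * (N * ε) * ε := by
        simp only [hball, Finset.sum_const, Finset.card_range, nsmul_eq_mul]; ring
    _ ≤ _ := by gcongr

open Filter Topology in
/-- A function analytic near a compact set agrees near it with a compactly supported `C¹`
function. -/
theorem exists_contDiff_eventuallyEq {K : Set ℂ} (hK : IsCompact K) {F : ℂ → ℝ}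
    (hF : ∀ z ∈ K, AnalyticAt ℝ F z) :
    ∃ G : ℂ → ℝ, ContDiff ℝ 1 G ∧ HasCompactSupport G ∧ ∀ z ∈ K, G =ᶠ[𝓝 z] F := by
  obtain ⟨L, hL, hKL, hLU⟩ := exists_compact_between hK (isOpen_analyticAt ℝ F) hF
  obtain ⟨β, h1, h0, -⟩ := exists_contMDiffMap_one_nhds_of_subset_interior (n := 1)
    (modelWithCornersSelf ℝ ℂ) hK.isClosed hKL
  have hβ : ContDiff ℝ 1 β := β.contMDiff.contDiff
  have hsupp : ∀ z ∉ L, β z * F z = 0 := fun z hz => by rw [h0 z hz, zero_mul]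
  refine ⟨fun z => β z * F z, ?_, HasCompactSupport.intro hL hsupp, fun z hz => ?_⟩
  · rw [contDiff_iff_contDiffAt]
    intro z
    by_cases hz : z ∈ L
    · exact hβ.contDiffAt.mul (hLU hz : AnalyticAt ℝ F z).contDiffAt
    · refine (contDiffAt_const (c := (0 : ℝ))).congr_of_eventuallyEq ?_
      filter_upwards [hL.isClosed.isOpen_compl.mem_nhds hz] with w hw using hsupp w hw
  · filter_upwards [eventually_nhdsSet_iff_forall.1 h1 z hz] with w hw
    rw [hw, one_mul]

/-- The Rellich vector field has divergence `2λ²ψ²`. -/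
theorem pd_rellich_add {ψ : ℂ → ℝ} {z : ℂ} (hψ : AnalyticAt ℝ ψ z) {lam : ℝ}
    (heig : lapC ψ z = -lam ^ 2 * ψ z) :
    pd 1 (fun w => 2 * (w.re * pd 1 ψ w + w.im * pd Complex.I ψ w) * pd 1 ψ w -
        w.re * (pd 1 ψ w ^ 2 + pd Complex.I ψ w ^ 2) + lam ^ 2 * w.re * ψ w ^ 2) z +
      pd Complex.I (fun w => 2 * (w.re * pd 1 ψ w + w.im * pd Complex.I ψ w) * pd Complex.I ψ w -
        w.im * (pd 1 ψ w ^ 2 + pd Complex.I ψ w ^ 2) + lam ^ 2 * w.im * ψ w ^ 2) z =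
      2 * lam ^ 2 * ψ z ^ 2 := by
  obtain ⟨x, y⟩ := z
  have hp := (hψ.pd 1).differentiableAt
  have hr := (hψ.pd Complex.I).differentiableAt
  have h0 := hψ.differentiableAt
  have hre : DifferentiableAt ℝ (fun w : ℂ => w.re) ⟨x, y⟩ := Complex.reCLM.differentiableAt
  have him : DifferentiableAt ℝ (fun w : ℂ => w.im) ⟨x, y⟩ := Complex.imCLM.differentiableAt
  have e1 := hasDerivAt_line_left (u := fun w => 2 * (w.re * pd 1 ψ w + w.im * pd Complex.I ψ w) *
        pd 1 ψ w - w.re * (pd 1 ψ w ^ 2 + pd Complex.I ψ w ^ 2) + lam ^ 2 * w.re * ψ w ^ 2)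
        (x := x) (y := y) (by fun_prop)
  have e2 := hasDerivAt_line_right (u := fun w => 2 * (w.re * pd 1 ψ w + w.im * pd Complex.I ψ w) *
        pd Complex.I ψ w - w.im * (pd 1 ψ w ^ 2 + pd Complex.I ψ w ^ 2) + lam ^ 2 * w.im * ψ w ^ 2)
        (x := x) (y := y) (by fun_prop)
  have p1 := hasDerivAt_line_left hp
  have r1 := hasDerivAt_line_left hr
  have u1 := hasDerivAt_line_left h0
  have p2 := hasDerivAt_line_right hp
  have r2 := hasDerivAt_line_right hr
  have u2 := hasDerivAt_line_right h0
  have hx := hasDerivAt_id x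
  have hy := hasDerivAt_id y
  have f1 := ((((hx.fun_mul p1).fun_add (r1.const_mul y)).const_mul 2).fun_mul p1).fun_sub
    (hx.fun_mul ((p1.fun_pow 2).fun_add (r1.fun_pow 2))) |>.fun_add
    ((hx.const_mul (lam ^ 2)).fun_mul (u1.fun_pow 2))
  have f2 := ((((p2.const_mul x).fun_add (hy.fun_mul r2)).const_mul 2).fun_mul r2).fun_sub
    (hy.fun_mul ((p2.fun_pow 2).fun_add (r2.fun_pow 2))) |>.fun_add
    ((hy.const_mul (lam ^ 2)).fun_mul (u2.fun_pow 2))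
  rw [e1.unique f1, e2.unique f2, pd_comm hψ 1 Complex.I]
  rw [lapC] at heig
  simp only [id]
  linear_combination (2 * (x * pd 1 ψ ⟨x, y⟩ + y * pd Complex.I ψ ⟨x, y⟩)) * heig

theorem CollarMap.abs_pd_le {Ω : Set ℂ} {Q : ℂ → ℂ} {ℓ δ : ℝ} (hQ : CollarMap Ω Q ℓ δ)
    {lam : ℝ} {ψ : ℂ → ℝ} (hψ : IsEigenfunction Ω lam ψ) {m : ℝ} (s : ℝ)
    (hm : |pd Complex.I (fun w => ψ (Q w)) s| ≤ m) {e : ℂ} (he : ‖e‖ = 1) :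
    |pd e ψ (Q s)| ≤ m := by
  have hδ := hQ.width_pos
  have hd : DifferentiableAt ℂ Q s := (hQ.analyticAt (by simpa using hδ)).differentiableAt
  have hda : DifferentiableAt ℝ ψ (Q s) :=
    (hψ.analytic _ (frontier_subset_closure (hQ.mem_frontier s))).differentiableAt
  have ht : pd 1 (fun w => ψ (Q w)) s = 0 := by
    have h1 := hasDerivAt_line_left (u := fun w => ψ (Q w)) (x := s) (y := 0)
      (hQ.analyticAt_comp hψ (by simp) (by simpa using hδ)).differentiableAt
    have h2 : ∀ t : ℝ, ψ (Q ⟨t, 0⟩) = 0 := fun t => hψ.dirichlet _ (hQ.mem_frontier t)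
    simp only [h2] at h1
    exact h1.unique (hasDerivAt_const s (0 : ℝ))
  rw [pd_comp hda hd, mul_one] at ht
  rw [pd_comp hda hd] at hm
  set D := deriv Q s with hD
  have hD1 : ‖D‖ = 1 := hQ.norm_deriv_real s
  have hD2 : D * (starRingEnd ℂ) D = 1 := by
    rw [Complex.mul_conj, Complex.normSq_eq_norm_sq, hD1]; simp
  set c := e * (starRingEnd ℂ) D with hc
  have hc1 : ‖c‖ = 1 := by rw [hc, norm_mul, Complex.norm_conj, he, hD1, one_mul]
  have hdec : e = c.re • D + c.im • (D * Complex.I) := by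
    have h3 : e = c * D := by rw [hc, mul_assoc, mul_comm _ D, hD2, mul_one]
    rw [Complex.real_smul, Complex.real_smul]
    calc e = c * D := h3
      _ = (c.re + c.im * Complex.I) * D := by rw [Complex.re_add_im]
      _ = _ := by ring
  have h4 : pd e ψ (Q s) = c.im * fderiv ℝ ψ (Q s) (D * Complex.I) := by
    rw [pd, congrArg (fderiv ℝ ψ (Q s)) hdec, map_add, map_smul, map_smul, ht]
    simp
  rw [h4, abs_mul]
  have h5 : |c.im| ≤ 1 := hc1 ▸ Complex.abs_im_le_norm c
  calc _ ≤ 1 * |fderiv ℝ ψ (Q s) (D * Complex.I)| := by gcongr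
    _ ≤ m := by rwa [one_mul]

/-- A Rellich-type inequality: the `L²` mass is controlled by the normal derivative. -/
theorem CollarMap.setIntegral_sq_le {Ω : Set ℂ} {Q : ℂ → ℂ} {ℓ δ : ℝ} (hQ : CollarMap Ω Q ℓ δ)
    (hΩ : IsOpen Ω) {R : ℝ} (hR : Ω ⊆ Metric.closedBall 0 R) {lam : ℝ} {ψ : ℂ → ℝ}
    (hψ : IsEigenfunction Ω lam ψ) {m : ℝ}
    (hm : ∀ s : ℝ, |pd Complex.I (fun w => ψ (Q w)) s| ≤ m) {T : Set ℂ} (hT : IsCompact T)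
    (hTΩ : T ⊆ Ω) :
    ∫ z in T, 2 * lam ^ 2 * ψ z ^ 2 ≤ 2 * (25 * π * (ℓ + 1)) * (6 * R * m ^ 2) := by
  have hb : Bornology.IsBounded Ω := Metric.isBounded_closedBall.subset hR
  have hcl : closure Ω ⊆ Metric.closedBall 0 R := closure_minimal hR Metric.isClosed_closedBall
  have hm0 : 0 ≤ m := (abs_nonneg _).trans (hm 0)
  have hcpt : IsCompact (closure Ω) := hb.isCompact_closure
  have hre : ∀ z : ℂ, AnalyticAt ℝ (fun w : ℂ => w.re) z := Complex.reCLM.analyticAt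
  have him : ∀ z : ℂ, AnalyticAt ℝ (fun w : ℂ => w.im) z := Complex.imCLM.analyticAt
  set F : ℂ → ℝ := fun w => 2 * (w.re * pd 1 ψ w + w.im * pd Complex.I ψ w) * pd 1 ψ w -
        w.re * (pd 1 ψ w ^ 2 + pd Complex.I ψ w ^ 2) + lam ^ 2 * w.re * ψ w ^ 2 with hFdef
  set F' : ℂ → ℝ := fun w => 2 * (w.re * pd 1 ψ w + w.im * pd Complex.I ψ w) * pd Complex.I ψ w -
        w.im * (pd 1 ψ w ^ 2 + pd Complex.I ψ w ^ 2) + lam ^ 2 * w.im * ψ w ^ 2 with hFdef'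
  have hF : ∀ z ∈ closure Ω, AnalyticAt ℝ F z := by
    intro z hz
    have h0 := hψ.analytic z hz
    have hp := h0.pd 1
    have hr := h0.pd Complex.I
    have hx := hre z
    have hy := him z
    fun_prop
  have hF' : ∀ z ∈ closure Ω, AnalyticAt ℝ F' z := by
    intro z hz
    have h0 := hψ.analytic z hz
    have hp := h0.pd 1
    have hr := h0.pd Complex.I
    have hx := hre z
    have hy := him z
    fun_prop
  have hbd : ∀ z ∈ frontier Ω, |F z| ≤ 6 * R * m ^ 2 ∧ |F' z| ≤ 6 * R * m ^ 2 := by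
    intro z hz
    have hz0 := hψ.dirichlet z hz
    have hzR := hcl (frontier_subset_closure hz)
    rw [mem_closedBall_zero_iff] at hzR
    have hzx := (Complex.abs_re_le_norm z).trans hzR
    have hzy := (Complex.abs_im_le_norm z).trans hzR
    obtain ⟨s, rfl⟩ : ∃ s : ℝ, Q s = z := by rw [← hQ.range_eq] at hz; exact hz
    have hp := hQ.abs_pd_le hψ s (hm s) (e := 1) (by simp)
    have hr := hQ.abs_pd_le hψ s (hm s) (e := Complex.I) (by simp)
    have hprod : ∀ a b c : ℝ, |a| ≤ R → |b| ≤ m → |c| ≤ m → |a * b * c| ≤ R * m ^ 2 := by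
      intro a b c ha hb hc
      rw [abs_mul, abs_mul, sq, ← mul_assoc]
      have hR0 := (abs_nonneg _).trans ha
      gcongr
    simp only [hFdef, hFdef', hz0]
    set p := pd 1 ψ (Q s)
    set r := pd Complex.I ψ (Q s)
    set x := (Q s).re
    set y := (Q s).im
    have a1 := abs_le.1 (hprod x p p hzx hp hp)
    have a2 := abs_le.1 (hprod x r r hzx hr hr)
    have a3 := abs_le.1 (hprod x p r hzx hp hr)
    have b1 := abs_le.1 (hprod y p p hzy hp hp)
    have b2 := abs_le.1 (hprod y r r hzy hr hr)
    have b3 := abs_le.1 (hprod y p r hzy hp hr)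
    constructor <;> rw [abs_le] <;> constructor <;> linarith
  obtain ⟨G, hG1, hG2, hG3⟩ := exists_contDiff_eventuallyEq hcpt hF
  obtain ⟨H, hH1, hH2, hH3⟩ := exists_contDiff_eventuallyEq hcpt hF'
  have hdiv : ∀ z ∈ Ω, pd 1 G z + pd Complex.I H z = 2 * lam ^ 2 * ψ z ^ 2 := by
    intro z hz
    have hz' := subset_closure hz
    rw [((hG3 z hz').pd 1).self_of_nhds, ((hH3 z hz').pd Complex.I).self_of_nhds]
    exact pd_rellich_add (hψ.analytic z hz') (hψ.eigen z hz)
  have hR0 : 0 ≤ 6 * R * m ^ 2 := (abs_nonneg _).trans (hbd _ (hQ.mem_frontier 0)).1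
  rw [← setIntegral_congr_fun hT.measurableSet fun z hz => hdiv z (hTΩ hz)]
  refine setIntegral_divergence_le hΩ hb (fun ε h0 h1 => hQ.volume_layer_le hb h0 h1) hG1 hG2
    hH1 hH2 hR0 (fun z hz => ?_) (fun z hz => ?_) (fun z hz => ?_) hT hTΩ
  · rw [(hG3 z (frontier_subset_closure hz)).self_of_nhds]
    exact (hbd z hz).1
  · rw [(hH3 z (frontier_subset_closure hz)).self_of_nhds]
    exact (hbd z hz).2
  · rw [hdiv z hz]; positivity

theorem continuous_mk : Continuous fun p : ℝ × ℝ => (⟨p.1, p.2⟩ : ℂ) :=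
  Complex.equivRealProdCLM.symm.continuous

/-- A lower bound for the maximum of a solution in terms of the radius of the domain. -/
theorem IsEigenfunction.two_div_le {Ω : Set ℂ} (hΩ : IsOpen Ω) {R : ℝ} (hR0 : 0 < R)
    (hR : Ω ⊆ Metric.closedBall 0 R) {lam : ℝ} (hlam : 0 < lam) {ψ : ℂ → ℝ}
    (hψ : IsEigenfunction Ω lam ψ) {M : ℝ} (hM0 : 0 < M) (hM : ∀ z ∈ closure Ω, |ψ z| ≤ M)
    {x : ℂ} (hx : x ∈ Ω) (hxM : |ψ x| = M) : 2 / R ≤ lam := by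
  have hcl : closure Ω ⊆ Metric.closedBall 0 R := closure_minimal hR Metric.isClosed_closedBall
  have hcpt : IsCompact (closure Ω) :=
    (Metric.isBounded_closedBall.subset hR).isCompact_closure
  obtain ⟨σ, hσ, hσM⟩ : ∃ σ : ℝ, |σ| = 1 ∧ σ * ψ x = M := by
    rcases le_total 0 (ψ x) with h | h
    · exact ⟨1, by simp, by rw [← hxM, abs_of_nonneg h, one_mul]⟩
    · exact ⟨-1, by simp, by rw [← hxM, abs_of_nonpos h]; ring⟩
  have main : ∀ μ, lam ^ 2 * M < μ → M ≤ μ * R ^ 2 / 4 := by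
    intro μ hμ
    have hμ0 : 0 < μ := lt_of_le_of_lt (by positivity) hμ
    set w : ℝ → ℝ → ℝ := fun a b => σ * ψ ⟨a, b⟩ - μ / 4 * (R ^ 2 - a ^ 2 - b ^ 2) with hw
    set K : Set (ℝ × ℝ) := (fun p : ℝ × ℝ => (⟨p.1, p.2⟩ : ℂ)) ⁻¹' closure Ω with hK
    have hKc : IsCompact K :=
      Complex.equivRealProdCLM.symm.toHomeomorph.isClosedEmbedding.isCompact_preimage hcpt
    have hcw : ContinuousOn (fun p : ℝ × ℝ => w p.1 p.2) K := by
      rw [hw]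
      refine ContinuousOn.sub (continuousOn_const.mul ?_) (Continuous.continuousOn (by fun_prop))
      intro p hp
      exact (ContinuousAt.comp (f := fun p : ℝ × ℝ => (⟨p.1, p.2⟩ : ℂ)) (x := p)
        (hψ.analytic _ hp).continuousAt continuous_mk.continuousAt).continuousWithinAt
    have hsq : ∀ a b : ℝ, (⟨a, b⟩ : ℂ) ∈ closure Ω → a ^ 2 + b ^ 2 ≤ R ^ 2 := by
      intro a b h
      have := hcl h
      rw [mem_closedBall_zero_iff] at this
      have h2 : ‖(⟨a, b⟩ : ℂ)‖ ^ 2 ≤ R ^ 2 := by gcongr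
      rw [← Complex.normSq_eq_norm_sq, Complex.normSq_mk] at h2
      linarith
    have h := nonpos_of_laplacian_pos hKc hcw ?_ (a := x.re) (b := x.im)
      (show (⟨x.re, x.im⟩ : ℂ) ∈ closure Ω from subset_closure hx)
    · simp only [hw] at h
      rw [show (⟨x.re, x.im⟩ : ℂ) = x from rfl, hσM] at h
      nlinarith [mul_nonneg hμ0.le (sq_nonneg x.re), mul_nonneg hμ0.le (sq_nonneg x.im)]
    · intro a b hab
      by_cases hin : (⟨a, b⟩ : ℂ) ∈ Ω
      · right
        have han := hψ.analytic _ hab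
        refine ⟨?_, σ * pd 1 (pd 1 ψ) ⟨a, b⟩ - μ / 4 * (2 * -1),
          σ * pd Complex.I (pd Complex.I ψ) ⟨a, b⟩ - μ / 4 * (2 * -1), ?_, ?_, ?_⟩
        · exact Filter.mem_of_superset ((hΩ.preimage continuous_mk).mem_nhds hin)
            (Set.preimage_mono subset_closure)
        · have := ((hasSecondDerivAt_left han).const_mul σ).sub
            ((HasSecondDerivAt.quadratic (-1) 0 (R ^ 2 - b ^ 2) a).const_mul (μ / 4))
          convert this using 2
          rw [hw]; ring
        · have := ((hasSecondDerivAt_right han).const_mul σ).sub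
            ((HasSecondDerivAt.quadratic (-1) 0 (R ^ 2 - a ^ 2) b).const_mul (μ / 4))
          convert this using 2
          rw [hw]; ring
        · have he := hψ.eigen _ hin
          unfold lapC at he
          have h1 : σ * ψ ⟨a, b⟩ ≤ M := by
            refine (le_abs_self _).trans ?_
            rw [abs_mul, hσ, one_mul]; exact hM _ hab
          have h2 : σ * pd 1 (pd 1 ψ) ⟨a, b⟩ + σ * pd Complex.I (pd Complex.I ψ) ⟨a, b⟩ =
              -lam ^ 2 * (σ * ψ ⟨a, b⟩) := by rw [← mul_add, he]; ring
          have h3 : lam ^ 2 * (σ * ψ ⟨a, b⟩) ≤ lam ^ 2 * M := by gcongr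
          linarith
      · left
        have h0 : ψ ⟨a, b⟩ = 0 := hψ.dirichlet _ (hΩ.frontier_eq ▸ ⟨hab, hin⟩)
        simp only [hw, h0]
        have := hsq a b hab
        have : 0 ≤ μ / 4 * (R ^ 2 - a ^ 2 - b ^ 2) := mul_nonneg (by positivity) (by linarith)
        linarith
  have h1 : M ≤ lam ^ 2 * M * R ^ 2 / 4 := by
    refine le_of_forall_pos_le_add fun ε hε => ?_
    have := main (lam ^ 2 * M + 4 * ε / R ^ 2) (by have : 0 < 4 * ε / R ^ 2 := by positivity
                                                   linarith)
    refine this.trans (le_of_eq ?_)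
    field_simp
  have h2 : 4 ≤ (lam * R) ^ 2 := by
    have : M * 4 ≤ M * (lam * R) ^ 2 := by nlinarith
    exact le_of_mul_le_mul_left this hM0
  rw [div_le_iff₀ hR0]
  nlinarith [mul_pos hlam hR0]

/-- Interior control: a solution stays comparable to its maximum near a maximum point. -/
theorem IsEigenfunction.half_le_abs {Ω : Set ℂ} {lam : ℝ} {ψ : ℂ → ℝ}
    (hψ : IsEigenfunction Ω lam ψ) {M : ℝ} (hM : ∀ z ∈ closure Ω, |ψ z| ≤ M)
    {x : ℂ} {D : ℝ} (hD : 0 < D) (hlam : 0 ≤ lam) (hlD : lam * D ≤ 1) (hxM : |ψ x| = M)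
    (hball : Metric.ball x D ⊆ Ω) : ∀ z ∈ Metric.closedBall x (D / 50), M / 2 ≤ |ψ z| := by
  have hM0 : 0 ≤ M := hxM ▸ abs_nonneg _
  set d := D / 5 with hd
  have hd0 : 0 < d := by positivity
  set G := 2 * M / d + lam ^ 2 * M * d / 2 with hG
  have hG0 : 0 ≤ G := by positivity
  have hmem : ∀ z ∈ Metric.closedBall x (D / 50), ∀ a ∈ Set.Icc (-d) d, ∀ b ∈ Set.Icc (-d) d,
      (⟨z.re + a, z.im + b⟩ : ℂ) ∈ Ω := by
    intro z hz a ha b hb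
    refine hball ?_
    rw [Metric.mem_ball, dist_eq_norm]
    rw [Metric.mem_closedBall, dist_eq_norm] at hz
    have e : (⟨z.re + a, z.im + b⟩ : ℂ) - x = (z - x) + ⟨a, b⟩ := by
      apply Complex.ext <;> simp <;> ring
    have h1 := Complex.norm_le_abs_re_add_abs_im (⟨a, b⟩ : ℂ)
    have h2 := abs_le.2 ha
    have h3 := abs_le.2 hb
    rw [e]
    refine (norm_add_le _ _).trans_lt ?_
    simp only at h1
    rw [hd] at h2 h3
    linarith
  have han : ∀ z ∈ Ω, AnalyticAt ℝ ψ z := fun z hz => hψ.analytic z (subset_closure hz)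
  have hlap : ∀ z ∈ Ω, |pd 1 (pd 1 ψ) z + pd Complex.I (pd Complex.I ψ) z| ≤ lam ^ 2 * M := by
    intro z hz
    have := hψ.eigen z hz
    unfold lapC at this
    rw [this, abs_mul, abs_neg, abs_of_nonneg (by positivity : 0 ≤ lam ^ 2)]
    gcongr
    exact hM z (subset_closure hz)
  have hshift : ∀ {g : ℝ → ℝ} {c y t : ℝ}, HasSecondDerivAt g c (y + t) →
      HasSecondDerivAt (fun s => g (y + s)) c t := by
    rintro g c y t ⟨g', h1, h2⟩
    refine ⟨fun s => g' (y + s), ?_, h2.comp_const_add y t⟩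
    have : Filter.Tendsto (fun s : ℝ => y + s) (nhds t) (nhds (y + t)) :=
      (continuous_const.add continuous_id).tendsto t
    filter_upwards [this.eventually h1] with s hs using hs.comp_const_add y s
  have hp1 : ∀ z ∈ Metric.closedBall x (D / 50), |pd 1 ψ z| ≤ G := by
    intro z hz
    have hB : RectBound (fun a b => ψ ⟨z.re + a, z.im + b⟩) (-d) d M (lam ^ 2 * M) := by
      refine ⟨?_, fun a ha b hb => hM _ (subset_closure (hmem z hz a ha b hb)), ?_⟩
      · intro p hp
        refine (ContinuousAt.comp (f := fun p : ℝ × ℝ => (⟨z.re + p.1, z.im + p.2⟩ : ℂ)) (x := p)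
          (han _ (hmem z hz _ hp.1 _ hp.2)).continuousAt ?_).continuousWithinAt
        exact (continuous_mk.comp (by fun_prop :
          Continuous fun p : ℝ × ℝ => (z.re + p.1, z.im + p.2))).continuousAt
      · intro a ha b hb
        have hin := hmem z hz a (Set.Ioo_subset_Icc_self ha) b (Set.Ioo_subset_Icc_self hb)
        exact ⟨_, _, hshift (hasSecondDerivAt_left (han _ hin)),
          hshift (hasSecondDerivAt_right (han _ hin)), hlap _ hin⟩
    have h0 := hmem z hz 0 ⟨by linarith, hd0.le⟩ 0 ⟨by linarith, hd0.le⟩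
    have hz' : (⟨z.re + 0, z.im + 0⟩ : ℂ) = z := by apply Complex.ext <;> simp
    have hder := (hasDerivAt_line_left (han _ h0).differentiableAt).comp_const_add z.re 0
    rw [hz'] at hder
    exact hB.abs_deriv_le hd0 le_rfl (by linarith) (Or.inl rfl) hder
  have hp2 : ∀ z ∈ Metric.closedBall x (D / 50), |pd Complex.I ψ z| ≤ G := by
    intro z hz
    have hB : RectBound (fun a b => ψ ⟨z.re + b, z.im + a⟩) (-d) d M (lam ^ 2 * M) := by
      refine ⟨?_, fun a ha b hb => hM _ (subset_closure (hmem z hz b hb a ha)), ?_⟩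
      · intro p hp
        refine (ContinuousAt.comp (f := fun p : ℝ × ℝ => (⟨z.re + p.2, z.im + p.1⟩ : ℂ)) (x := p)
          (han _ (hmem z hz _ hp.2 _ hp.1)).continuousAt ?_).continuousWithinAt
        exact (continuous_mk.comp (by fun_prop :
          Continuous fun p : ℝ × ℝ => (z.re + p.2, z.im + p.1))).continuousAt
      · intro a ha b hb
        have hin := hmem z hz b (Set.Ioo_subset_Icc_self hb) a (Set.Ioo_subset_Icc_self ha)
        exact ⟨_, _, hshift (hasSecondDerivAt_right (han _ hin)),
          hshift (hasSecondDerivAt_left (han _ hin)), by rw [add_comm]; exact hlap _ hin⟩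
    have h0 := hmem z hz 0 ⟨by linarith, hd0.le⟩ 0 ⟨by linarith, hd0.le⟩
    have hz' : (⟨z.re + 0, z.im + 0⟩ : ℂ) = z := by apply Complex.ext <;> simp
    have hder := (hasDerivAt_line_right (han _ h0).differentiableAt).comp_const_add z.im 0
    rw [hz'] at hder
    exact hB.abs_deriv_le hd0 le_rfl (by linarith) (Or.inl rfl) hder
  have hsub : Metric.closedBall x (D / 50) ⊆ Ω := fun z hz => hball
    (Metric.closedBall_subset_ball (by linarith) hz)
  have hnorm : ∀ z ∈ Metric.closedBall x (D / 50), ‖fderiv ℝ ψ z‖ ≤ 2 * G := by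
    intro z hz
    refine ContinuousLinearMap.opNorm_le_bound _ (by positivity) fun v => ?_
    have hv : v = v.re • (1 : ℂ) + v.im • Complex.I := by
      apply Complex.ext <;> simp
    have e : fderiv ℝ ψ z v = v.re * pd 1 ψ z + v.im * pd Complex.I ψ z := by
      conv_lhs => rw [hv]
      rw [map_add, map_smul, map_smul]; rfl
    rw [e, Real.norm_eq_abs]
    refine (abs_add_le _ _).trans ?_
    rw [abs_mul, abs_mul]
    have h1 := mul_le_mul (Complex.abs_re_le_norm v) (hp1 z hz) (abs_nonneg _) (norm_nonneg _)
    have h2 := mul_le_mul (Complex.abs_im_le_norm v) (hp2 z hz) (abs_nonneg _) (norm_nonneg _)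
    linarith
  intro z hz
  have hlip := (convex_closedBall x (D / 50)).norm_image_sub_le_of_norm_fderiv_le
    (fun y hy => (han y (hsub hy)).differentiableAt) hnorm
    (Metric.mem_closedBall_self (by positivity)) hz
  rw [Metric.mem_closedBall, dist_eq_norm] at hz
  have hGD : G * D ≤ 11 * M := by
    have e : G * D = 10 * M + (lam * D) ^ 2 * M / 10 := by rw [hG, hd]; field_simp; ring
    have : (lam * D) ^ 2 ≤ 1 := by
      rw [sq_le_one_iff_abs_le_one, abs_of_nonneg (by positivity)]; exact hlD
    rw [e]; nlinarith
  have h1 : 2 * G * ‖z - x‖ ≤ M / 2 := by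
    calc 2 * G * ‖z - x‖ ≤ 2 * G * (D / 50) := by gcongr
      _ ≤ M / 2 := by linarith
  rw [Real.norm_eq_abs] at hlip
  have h2 := abs_sub_abs_le_abs_sub (ψ x) (ψ z)
  rw [abs_sub_comm, hxM] at h2
  linarith

/-- The maximum of an eigenfunction is controlled by the maximum of its normal derivative. -/
theorem CollarMap.exists_le_normal {Ω : Set ℂ} {Q : ℂ → ℂ} {ℓ δ : ℝ} (hQ : CollarMap Ω Q ℓ δ)
    (hΩ : IsOpen Ω) {R : ℝ} (hR0 : 0 < R) (hR : Ω ⊆ Metric.closedBall 0 R) :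
    ∃ C > 0, ∀ lam : ℝ, 0 < lam → ∀ ψ : ℂ → ℝ, IsEigenfunction Ω lam ψ →
      ∃ M > 0, (∀ z ∈ closure Ω, |ψ z| ≤ M) ∧ 2 / R ≤ lam ∧
        ∀ m : ℝ, (∀ s : ℝ, |pd Complex.I (fun w => ψ (Q w)) s| ≤ m) → M ≤ C * m := by
  have hδ := hQ.width_pos
  have hℓ := hQ.len_pos
  set A := collarConst δ with hA
  have hA0 : 0 < A := collarConst_pos hδ
  set κ := min (min δ 1) (1 / (2 * A)) with hκ
  have hκ0 : 0 < κ := by positivity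
  have hκδ : κ ≤ δ := (min_le_left _ _).trans (min_le_left _ _)
  have hκ1 : κ ≤ 1 := (min_le_left _ _).trans (min_le_right _ _)
  have hκA : A * κ ≤ 1 / 2 := by
    have := mul_le_mul_of_nonneg_left (min_le_right (min δ 1) (1 / (2 * A))) hA0.le
    refine this.trans (le_of_eq ?_)
    field_simp
  set τ := κ / (200 * (R + 1)) with hτ
  have hτ0 : 0 < τ := by positivity
  refine ⟨√(600 * (ℓ + 1) * R) / τ, by positivity, fun lam hlam ψ hψ => ?_⟩
  have hcpt : IsCompact (closure Ω) :=
    (Metric.isBounded_closedBall.subset hR).isCompact_closure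
  obtain ⟨x₁, hx₁, hx₁0⟩ := hψ.nontrivial
  obtain ⟨x, hx, hmax⟩ := hcpt.exists_isMaxOn ⟨x₁, subset_closure hx₁⟩
    (f := fun z => |ψ z|) fun z hz => (hψ.analytic z hz).continuousAt.abs.continuousWithinAt
  set M := |ψ x| with hMdef
  have hM : ∀ z ∈ closure Ω, |ψ z| ≤ M := fun z hz => hmax hz
  have hM0 : 0 < M := (abs_pos.2 hx₁0).trans_le (hM _ (subset_closure hx₁))
  have hxΩ : x ∈ Ω := by
    by_contra hcon
    have := hψ.dirichlet x (hΩ.frontier_eq ▸ ⟨hx, hcon⟩)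
    rw [hMdef, this, abs_zero] at hM0
    exact lt_irrefl _ hM0
  have hlow : 2 / R ≤ lam := hψ.two_div_le hΩ hR0 hR hlam hM0 hM hxΩ rfl
  refine ⟨M, hM0, hM, hlow, fun m hm => ?_⟩
  have hm0 : 0 ≤ m := (abs_nonneg _).trans (hm 0)
  set L := 1 + max 1 lam with hL
  have hL2 : 2 ≤ L := by have := le_max_left 1 lam; rw [hL]; linarith
  have hLl : lam ≤ L := by have := le_max_right 1 lam; rw [hL]; linarith
  have hLR : L ≤ lam * (R + 1) := by
    rw [div_le_iff₀ hR0] at hlow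
    have : max 1 lam ≤ 1 + lam := max_le (by linarith) (by linarith)
    rw [hL]; linarith
  set r := κ / L with hr
  have hr0 : 0 < r := by positivity
  have hrκ : r ≤ κ := div_le_self hκ0.le (by linarith)
  have hdist : r / 4 ≤ Metric.infDist x (frontier Ω) := by
    by_contra hcon
    push Not at hcon
    obtain ⟨z, hz0, hzr, hzx⟩ := hQ.exists_eq x hxΩ r hr0 (hrκ.trans hκδ) hcon
    have h := hQ.abs_comp_le hψ hM hlam.le 0 (x := z.re) (y := z.im) hz0.le (by
      refine hzr.trans ?_
      rw [Nat.cast_zero, zero_add, hr]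
      gcongr)
    rw [Nat.cast_zero, zero_add, zero_add, pow_one, Function.iterate_zero, id,
      show (⟨z.re, z.im⟩ : ℂ) = z from rfl, hzx, ← hMdef, ← hA, ← hL] at h
    have h1 : A * L * z.im ≤ 1 / 2 := by
      calc A * L * z.im ≤ A * L * r := by gcongr
        _ = A * κ := by rw [hr]; field_simp
        _ ≤ 1 / 2 := hκA
    nlinarith
  have hball : Metric.ball x (r / 4) ⊆ Ω := by
    refine (subset_or_disjoint_of_preconnected hΩ (convex_ball x (r / 4)).isPreconnected
      (Set.disjoint_left.2 fun z hz hzf => ?_)).resolve_right fun h =>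
        Set.disjoint_left.1 h (Metric.mem_ball_self (by positivity)) hxΩ
    have := Metric.infDist_le_dist_of_mem (x := x) hzf
    rw [Metric.mem_ball, dist_comm] at hz
    linarith
  have hlr : lam * (r / 4) ≤ 1 := by
    have : lam * r ≤ 1 := by
      rw [hr, mul_div_assoc', div_le_one (by linarith)]
      nlinarith
    nlinarith
  have hhalf := hψ.half_le_abs hM (by positivity : 0 < r / 4) hlam.le hlr rfl hball
  set ρ := r / 4 / 50 with hρ
  have hρ0 : 0 < ρ := by positivity
  have hsub : Metric.closedBall x ρ ⊆ Ω :=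
    (Metric.closedBall_subset_ball (by rw [hρ]; linarith)).trans hball
  have hint := hQ.setIntegral_sq_le hΩ hR hψ hm (isCompact_closedBall x ρ) hsub
  have hge := setIntegral_ge_of_const_le_real (μ := volume) (s := Metric.closedBall x ρ)
    (f := fun z => 2 * lam ^ 2 * ψ z ^ 2) (c := 2 * lam ^ 2 * (M / 2) ^ 2)
    measurableSet_closedBall measure_closedBall_lt_top.ne (fun z hz => by
      rw [← sq_abs (ψ z)]
      have := hhalf z hz
      gcongr) (ContinuousOn.integrableOn_compact (isCompact_closedBall x ρ) fun z hz =>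
        (((hψ.analytic z (subset_closure (hsub hz))).continuousAt.pow 2).const_mul
          _).continuousWithinAt)
  have hvol : volume.real (Metric.closedBall x ρ) = ρ ^ 2 * π := by
    rw [Measure.real, Complex.volume_closedBall, ENNReal.toReal_mul, ENNReal.toReal_pow,
      ENNReal.toReal_ofReal hρ0.le]
    rfl
  rw [hvol] at hge
  have hkey : M ^ 2 * (lam * ρ) ^ 2 ≤ 600 * (ℓ + 1) * R * m ^ 2 := by
    have := hge.trans hint
    refine le_of_mul_le_mul_left ?_ (half_pos pi_pos)
    linarith
  have hτle : τ ≤ lam * ρ := by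
    rw [hτ, hρ, hr, div_div, div_div, mul_div_assoc', div_le_div_iff₀ (by positivity) (by positivity)]
    nlinarith
  have hfin : (M * τ) ^ 2 ≤ (√(600 * (ℓ + 1) * R) * m) ^ 2 := by
    rw [mul_pow, mul_pow, Real.sq_sqrt (by positivity)]
    refine le_trans ?_ hkey
    gcongr
  have := (pow_le_pow_iff_left₀ (by positivity) (by positivity) two_ne_zero).1 hfin
  rw [div_mul_eq_mul_div, le_div_iff₀ hτ0]
  exact this

namespace CollarMap

variable {Ω : Set ℂ} {Q : ℂ → ℂ} {ℓ δ : ℝ}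

theorem hasDerivAt_ofReal (hQ : CollarMap Ω Q ℓ δ) (t : ℝ) :
    HasDerivAt (fun s : ℝ => Q s) (deriv Q t) t := by
  have hδ := hQ.width_pos
  exact (hQ.analyticAt (z := t) (by simpa using hδ)).differentiableAt.hasDerivAt.comp_ofReal

theorem deriv_periodic (hQ : CollarMap Ω Q ℓ δ) (t : ℝ) :
    deriv Q ((t + ℓ : ℝ) : ℂ) = deriv Q t := by
  have h := (hQ.hasDerivAt_ofReal (t + ℓ)).comp_add_const t ℓ
  simp only [hQ.periodic] at h
  exact h.unique (hQ.hasDerivAt_ofReal t)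

theorem normal_eq (hQ : CollarMap Ω Q ℓ δ) {lam : ℝ} {ψ : ℂ → ℝ} (hψ : IsEigenfunction Ω lam ψ)
    (t : ℝ) : pd Complex.I (fun w => ψ (Q w)) t = fderiv ℝ ψ (Q t) (deriv Q t * Complex.I) := by
  have hδ := hQ.width_pos
  exact pd_comp (hψ.analytic _ (frontier_subset_closure (hQ.mem_frontier t))).differentiableAt
    (hQ.analyticAt (z := t) (by simpa using hδ)).differentiableAt _

/-- The number of zeros of the normal derivative is at most linear in the frequency. -/
theorem exists_card_zeros_le (hQ : CollarMap Ω Q ℓ δ) (hΩ : IsOpen Ω)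
    (hb : Bornology.IsBounded Ω) :
    ∃ C > 0, ∀ lam : ℝ, 0 < lam → ∀ ψ : ℂ → ℝ, IsEigenfunction Ω lam ψ →
      ∀ Z : Finset ℝ, (∀ a ∈ Z, |a| ≤ ℓ ∧ fderiv ℝ ψ (Q a) (deriv Q a * Complex.I) = 0) →
        (Z.card : ℝ) ≤ C * lam := by
  have hδ := hQ.width_pos
  have hℓ := hQ.len_pos
  obtain ⟨R, hR0, hR⟩ := hb.subset_closedBall_lt 0 0
  obtain ⟨C, hC, hmain⟩ := hQ.exists_le_normal hΩ hR0 hR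
  have hA0 := collarConst_pos hδ
  set A := collarConst δ with hA
  have hη : 0 < (4 * exp 1 * A)⁻¹ := by positivity
  obtain ⟨c, hc, hzeros⟩ := exists_card_real_zeros_le_log hη (by positivity : 0 < 2 * ℓ)
  have hlog : 0 ≤ Real.log (1 + 2 * C * A) := Real.log_nonneg (by
    have : 0 < 2 * C * A := by positivity
    linarith)
  refine ⟨c * (Real.log (1 + 2 * C * A) * (R / 2) + (R + 1)), by positivity,
    fun lam hlam ψ hψ Z hZ => ?_⟩
  obtain ⟨M, hM0, hM, hlow, hnormal⟩ := hmain lam hlam ψ hψ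
  set f : ℝ → ℝ := fun t => pd Complex.I (fun w => ψ (Q w)) t with hf
  have hfper : Function.Periodic f ℓ := by
    intro t
    simp only [hf]
    rw [hQ.normal_eq hψ, hQ.normal_eq hψ, hQ.periodic, hQ.deriv_periodic]
  have hfcont : Continuous f :=
    continuous_iff_continuousAt.2 fun t => (hQ.analyticAt_normal hψ t).continuousAt
  obtain ⟨s₀, hs₀, hmax⟩ := (isCompact_Icc (a := 0) (b := ℓ)).exists_isMaxOn
    ⟨0, by simp [hℓ.le]⟩ hfcont.abs.continuousOn
  have hfle : ∀ s, |f s| ≤ |f s₀| := by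
    intro s
    obtain ⟨y, hy, hys⟩ := hfper.exists_mem_Ico₀ hℓ s
    rw [hys]
    exact hmax (Set.Ico_subset_Icc_self hy)
  have hMm := hnormal _ hfle
  have hm0 : 0 < |f s₀| := by
    by_contra hcon
    have : |f s₀| = 0 := le_antisymm (not_lt.1 hcon) (abs_nonneg _)
    rw [this] at hMm
    linarith
  obtain ⟨F, hFd, hFf, hFb⟩ := hQ.exists_normal_extension hψ hM hlam.le
  have hF0 : ‖F s₀‖ = |f s₀| := by rw [hFf, Complex.norm_real, Real.norm_eq_abs]
  have hL1 : 1 ≤ max 1 lam := le_max_left _ _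
  set K := (1 + 2 * C * A) * exp (1 + max 1 lam) with hK
  have hCA : 1 ≤ 1 + 2 * C * A := by
    have : 0 < 2 * C * A := by positivity
    linarith
  have hK1 : 1 ≤ K := one_le_mul_of_one_le_of_one_le hCA (Real.one_le_exp (by linarith))
  have hcount := hzeros F s₀ K hFd (norm_pos_iff.1 (hF0 ▸ hm0)) hK1 (fun z hz => by
    refine (hFb z hz).trans ?_
    rw [hF0, hK]
    calc 2 * (M * A * exp (1 + max 1 lam))
        ≤ 2 * (C * |f s₀| * A * exp (1 + max 1 lam)) := by gcongr
      _ = 2 * C * A * exp (1 + max 1 lam) * |f s₀| := by ring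
      _ ≤ (1 + 2 * C * A) * exp (1 + max 1 lam) * |f s₀| := by
          gcongr; linarith) Z (fun a ha => by
    obtain ⟨h1, h2⟩ := hZ a ha
    refine ⟨?_, ?_⟩
    · have h3 : |s₀| ≤ ℓ := by rw [abs_of_nonneg hs₀.1]; exact hs₀.2
      linarith [abs_sub a s₀]
    · rw [hFf, hQ.normal_eq hψ, h2, Complex.ofReal_zero])
  refine hcount.trans ?_
  rw [mul_assoc]
  gcongr
  rw [hK, Real.log_mul (by positivity) (by positivity), Real.log_exp, add_mul]
  rw [div_le_iff₀ hR0] at hlow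
  have h1 : max 1 lam ≤ 1 + lam := max_le (by linarith) (by linarith)
  have h2 : Real.log (1 + 2 * C * A) * 2 ≤ Real.log (1 + 2 * C * A) * (lam * R) := by gcongr
  linarith

end CollarMap

/-- The standard isometry between the complex plane and the Euclidean plane. -/
def planeIsometry : ℂ ≃ₗᵢ[ℝ] E2 := Complex.orthonormalBasisOneI.repr

theorem planeIsometry_one : planeIsometry 1 = EuclideanSpace.single 0 1 := by
  have := Complex.orthonormalBasisOneI.repr_self 0
  simpa [planeIsometry] using this

theorem planeIsometry_I : planeIsometry Complex.I = EuclideanSpace.single 1 1 := by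
  have := Complex.orthonormalBasisOneI.repr_self 1
  simpa [planeIsometry] using this

theorem fderiv_comp_planeIsometry (φ : E2 → ℝ) (z v : ℂ) :
    fderiv ℝ (fun w => φ (planeIsometry w)) z v =
      fderiv ℝ φ (planeIsometry z) (planeIsometry v) := by
  have h := planeIsometry.toContinuousLinearEquiv.comp_right_fderiv (f := φ) (x := z)
  exact congrArg (fun L : ℂ →L[ℝ] ℝ => L v) h

theorem lapC_comp_planeIsometry (φ : E2 → ℝ) (z : ℂ) :
    lapC (fun w => φ (planeIsometry w)) z = lap φ (planeIsometry z) := by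
  have h : ∀ v : ℂ, pd v (fun w => φ (planeIsometry w)) =
      fun w => (fun y => fderiv ℝ φ y (planeIsometry v)) (planeIsometry w) :=
    fun v => funext fun w => fderiv_comp_planeIsometry φ w v
  have h2 : ∀ v : ℂ, pd v (fun w => (fun y => fderiv ℝ φ y (planeIsometry v)) (planeIsometry w)) z =
      fderiv ℝ (fun y => fderiv ℝ φ y (planeIsometry v)) (planeIsometry z) (planeIsometry v) :=
    fun v => fderiv_comp_planeIsometry (fun y => fderiv ℝ φ y (planeIsometry v)) z v
  rw [lapC, h, h, h2, h2, lap, Fin.sum_univ_two, planeIsometry_one, planeIsometry_I]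

theorem frontier_preimage_planeIsometry (Ω : Set E2) :
    frontier (planeIsometry ⁻¹' Ω) = planeIsometry ⁻¹' frontier Ω :=
  (planeIsometry.toHomeomorph.preimage_frontier Ω).symm

theorem IsDirichletEigenfunction.isEigenfunction {Ω : Set E2} {B : BoundaryParam Ω} {lam : ℝ}
    {φ : E2 → ℝ} (hφ : IsDirichletEigenfunction B lam φ) :
    IsEigenfunction (planeIsometry ⁻¹' Ω) lam (fun w => φ (planeIsometry w)) where
  analytic x hx := by
    obtain ⟨U, -, hU, han⟩ := hφ.analytic
    have hx' : planeIsometry x ∈ closure Ω := by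
      have h := planeIsometry.toHomeomorph.preimage_closure Ω
      exact (Set.ext_iff.1 h x).2 hx
    exact (han _ (hU hx')).fun_comp
      (planeIsometry.toContinuousLinearEquiv.toContinuousLinearMap.analyticAt x)
  nontrivial := by
    obtain ⟨x, hx, h⟩ := hφ.nontrivial
    exact ⟨planeIsometry.symm x, by simpa using hx, by simpa using h⟩
  eigen x hx := by rw [lapC_comp_planeIsometry, hφ.eigen _ hx]
  dirichlet x hx := by
    rw [frontier_preimage_planeIsometry, Set.mem_preimage, ← B.range_eq] at hx
    obtain ⟨s, hs⟩ := hx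
    rw [← hs]
    exact hφ.dirichlet s

/-- In the complex plane, a vector orthogonal to a unit vector `n` is turned by a right angle
into a real multiple of `n`. -/
theorem exists_mul_I_eq_smul {n t : ℂ} (hn : ‖n‖ = 1) (h : inner ℝ n t = 0) :
    ∃ b : ℝ, t * Complex.I = b • n := by
  refine ⟨-(n.re * t.im - n.im * t.re), ?_⟩
  have h1 : n.re * n.re + n.im * n.im = 1 := by
    rw [← Complex.normSq_apply, Complex.normSq_eq_norm_sq, hn, one_pow]
  have h2 : n.re * t.re + n.im * t.im = 0 := by
    rw [Complex.inner] at h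
    simp at h
    linarith
  apply Complex.ext
  · simp
    linear_combination t.im * h1 - n.im * h2
  · simp
    linear_combination (-t.re) * h1 + n.re * h2

theorem BoundaryParam.fderiv_mul_I_eq_zero {Ω : Set E2} (B : BoundaryParam Ω) {φ : E2 → ℝ}
    {s : ℝ} (h : ⟪gradient φ (B.q s), B.ν s⟫ = 0) :
    fderiv ℝ (fun w => φ (planeIsometry w)) (planeIsometry.symm (B.q s))
      (planeIsometry.symm (B.qd s) * Complex.I) = 0 := by
  obtain ⟨b, hb⟩ := exists_mul_I_eq_smul (n := planeIsometry.symm (B.ν s))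
    (t := planeIsometry.symm (B.qd s)) (by rw [LinearIsometryEquiv.norm_map, B.ν_unit])
    (by rw [LinearIsometryEquiv.inner_map_map, B.ν_orth])
  rw [gradient, InnerProductSpace.toDual_symm_apply] at h
  rw [hb, map_smul, fderiv_comp_planeIsometry, LinearIsometryEquiv.apply_symm_apply,
    LinearIsometryEquiv.apply_symm_apply, h, smul_zero]

theorem exists_card_le_of_isAnalytic {Ω : Set E2} (hΩ : IsPlaneDomain Ω) (B : BoundaryParam Ω)
    (hB : B.IsAnalytic) :
    ∃ C > 0, ∀ lam : ℝ, 0 < lam → ∀ φ : E2 → ℝ, IsDirichletEigenfunction B lam φ →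
      ∀ Z : Finset ℝ, (∀ s ∈ Z, s ∈ Set.Ico (0 : ℝ) B.len ∧ ⟪gradient φ (B.q s), B.ν s⟫ = 0) →
        (Z.card : ℝ) ≤ C * lam := by
  have hopen : IsOpen (planeIsometry ⁻¹' Ω) := hΩ.isOpen.preimage planeIsometry.continuous
  have hbdd : Bornology.IsBounded (planeIsometry ⁻¹' Ω) :=
    planeIsometry.antilipschitz.isBounded_preimage hΩ.isBounded
  have hderiv : ∀ s, HasDerivAt (fun s => planeIsometry.symm (B.q s))
      (planeIsometry.symm (B.qd s)) s := fun s =>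
    planeIsometry.symm.toContinuousLinearEquiv.toContinuousLinearMap.hasFDerivAt.comp_hasDerivAt
      s (B.hasDerivAt s)
  obtain ⟨Q, δ, hQ, hor⟩ := exists_collarMap hopen hbdd
    (by
      obtain ⟨x, hx⟩ := hΩ.isConnected.nonempty
      exact ⟨planeIsometry.symm x, by simpa using hx⟩)
    (q := fun s => planeIsometry.symm (B.q s))
    (fun t => (planeIsometry.symm.toContinuousLinearEquiv.toContinuousLinearMap.analyticAt
      _).fun_comp (hB t trivial))
    B.len_pos (fun s => by simp only [B.periodic s])
    (fun s hs t ht h => B.injOn hs ht (planeIsometry.symm.injective h))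
    (fun s => by rw [(hderiv s).deriv, LinearIsometryEquiv.norm_map, B.unitSpeed])
    (by
      rw [frontier_preimage_planeIsometry, ← B.range_eq]
      ext z
      simp only [Set.mem_range, Set.mem_preimage, LinearIsometryEquiv.symm_apply_eq])
  obtain ⟨C, hC, hmain⟩ := hQ.exists_card_zeros_le hopen hbdd
  refine ⟨C, hC, fun lam hlam φ hφ Z hZ => ?_⟩
  have habs : ∀ s ∈ Set.Ico (0 : ℝ) B.len, |s| ≤ B.len := fun s hs => by
    rw [abs_of_nonneg hs.1]; exact hs.2.le
  rcases hor with hor | hor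
  · refine hmain lam hlam _ hφ.isEigenfunction Z fun s hs => ⟨habs s (hZ s hs).1, ?_⟩
    have hd : deriv Q s = planeIsometry.symm (B.qd s) := by
      have h := hQ.hasDerivAt_ofReal s
      simp only [hor] at h
      exact h.unique (hderiv s)
    rw [hd, hor]
    exact B.fderiv_mul_I_eq_zero (hZ s hs).2
  · rw [← Finset.card_image_of_injective Z neg_injective]
    refine hmain lam hlam _ hφ.isEigenfunction _ fun a ha => ?_
    obtain ⟨s, hs, rfl⟩ := Finset.mem_image.1 ha
    refine ⟨by rw [abs_neg]; exact habs s (hZ s hs).1, ?_⟩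
    have hd : deriv Q ((-s : ℝ) : ℂ) = -planeIsometry.symm (B.qd s) := by
      have h := hQ.hasDerivAt_ofReal (-s)
      simp only [hor] at h
      have h2 := (hderiv (- -s)).scomp (-s) (hasDerivAt_neg (-s))
      rw [neg_neg, neg_one_smul] at h2
      exact h.unique h2
    rw [hd, hor, neg_neg, neg_mul, map_neg, B.fderiv_mul_I_eq_zero (hZ s hs).2, neg_zero]

/-- The number of boundary critical points of a Dirichlet eigenfunction (zeros of the
normal derivative along the boundary) is at most `C·λ`. -/
theorem dirichlet_boundary_critical_points
    (Ω : Set E2) (hΩ : IsPlaneDomain Ω) (B : BoundaryParam Ω) (hB : B.IsAnalytic) :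
    ∃ C > 0, ∀ lam : ℝ, 0 < lam → ∀ φ : E2 → ℝ, IsDirichletEigenfunction B lam φ →
      ({s ∈ Set.Ico (0 : ℝ) B.len | ⟪gradient φ (B.q s), B.ν s⟫ = 0}).Finite ∧
      (({s ∈ Set.Ico (0 : ℝ) B.len | ⟪gradient φ (B.q s), B.ν s⟫ = 0}).ncard : ℝ) ≤
        C * lam := by
  obtain ⟨C, hC, hmain⟩ := exists_card_le_of_isAnalytic hΩ B hB
  refine ⟨C, hC, fun lam hlam φ hφ => ?_⟩
  set S := {s ∈ Set.Ico (0 : ℝ) B.len | ⟪gradient φ (B.q s), B.ν s⟫ = 0}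
  have hfin : S.Finite := by
    by_contra hinf
    obtain ⟨n, hn⟩ := exists_nat_gt (C * lam)
    obtain ⟨Z, hZS, hZn⟩ := Set.Infinite.exists_subset_card_eq hinf n
    have := hmain lam hlam φ hφ Z fun s hs => hZS hs
    rw [hZn] at this
    linarith
  refine ⟨hfin, ?_⟩
  rw [Set.ncard_eq_toFinset_card S hfin]
  exact hmain lam hlam φ hφ _ fun s hs => hfin.mem_toFinset.1 hs
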